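/- arXiv:0903.3289 — 3 statements merged into one kernel-verified Lean document; each statement's English description precedes it below -/
import Mathlib

section
/- (Yoccoz) For almost every λ ∈ S¹ (with respect to Lebesgue/Haar measure on the unit circle) the origin is a Siegel point for the quadratic polynomial f_λ(z) = λz + z², i.e. f_λ is holomorphically linearizable at 0. -/
open Set Filter Topology MeasureTheory

/-- `φ` is a biholomorphism from `W₁` onto `W₂` fixing `0` which conjugates the holomorphic
local dynamical system `f₁` (defined on `U₁`) to `f₂` (defined on `U₂`). -/
def IsHolConjVia (f₁ : ℂ → ℂ) (U₁ : Set ℂ) (f₂ : ℂ → ℂ) (U₂ : Set ℂ)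
    (φ : ℂ → ℂ) (W₁ W₂ : Set ℂ) : Prop :=
  IsOpen W₁ ∧ IsOpen W₂ ∧ (0 : ℂ) ∈ W₁ ∧ (0 : ℂ) ∈ W₂ ∧ W₁ ⊆ U₁ ∧ W₂ ⊆ U₂ ∧
    DifferentiableOn ℂ φ W₁ ∧ Set.BijOn φ W₁ W₂ ∧
    (∃ ψ : ℂ → ℂ, DifferentiableOn ℂ ψ W₂ ∧ Set.EqOn (ψ ∘ φ) id W₁) ∧
    φ 0 = 0 ∧ ∀ z ∈ W₁, f₁ z ∈ W₁ → φ (f₁ z) = f₂ (φ z)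

/-- `f₁` and `f₂` are holomorphically locally conjugated at `0`. -/
def HolLocallyConj (f₁ : ℂ → ℂ) (U₁ : Set ℂ) (f₂ : ℂ → ℂ) (U₂ : Set ℂ) : Prop :=
  ∃ φ W₁ W₂, IsHolConjVia f₁ U₁ f₂ U₂ φ W₁ W₂

/-- The coefficients of the formal linearization `w * ∑ bₙ wⁿ` of `z ↦ l * (z + z ^ 2)`. -/
noncomputable def linCoeff (l : ℂ) : ℕ → ℂ
  | 0 => 1
  | n + 1 => (∑ i : Fin n.succ, linCoeff l i * linCoeff l (n - i)) / (l ^ (n + 1) - 1)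

theorem linCoeff_zero (l : ℂ) : linCoeff l 0 = 1 := by rw [linCoeff]

theorem linCoeff_succ (l : ℂ) (n : ℕ) :
    linCoeff l (n + 1) =
      (∑ ij ∈ Finset.HasAntidiagonal.antidiagonal n, linCoeff l ij.1 * linCoeff l ij.2) / (l ^ (n + 1) - 1) := by
  rw [linCoeff, Finset.Nat.sum_antidiagonal_eq_sum_range_succ (fun x y => linCoeff l x * linCoeff l y) n,
    Finset.sum_range]

theorem norm_linCoeff_le {l : ℂ} (hl : ‖l‖ < 1) (n : ℕ) :
    ‖linCoeff l n‖ ≤ (1 - ‖l‖)⁻¹ ^ n * catalan n := by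
  have h1 : 0 < 1 - ‖l‖ := by linarith
  induction n using Nat.strong_induction_on with
  | _ n ih =>
    cases n with
    | zero => simp [linCoeff_zero]
    | succ n =>
      have hden : 1 - ‖l‖ ≤ ‖l ^ (n + 1) - 1‖ := by
        have h2 : ‖l ^ (n + 1)‖ ≤ ‖l‖ := by
          rw [norm_pow]; exact pow_le_of_le_one (norm_nonneg _) hl.le (by omega)
        have h3 := norm_sub_norm_le (1 : ℂ) (l ^ (n + 1))
        rw [norm_sub_rev, norm_one] at h3
        linarith
      have hnum : ‖∑ ij ∈ Finset.HasAntidiagonal.antidiagonal n, linCoeff l ij.1 * linCoeff l ij.2‖ ≤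
          (1 - ‖l‖)⁻¹ ^ n * catalan (n + 1) := by
        rw [catalan_succ', Nat.cast_sum, Finset.mul_sum]
        refine (norm_sum_le _ _).trans (Finset.sum_le_sum fun ij hij => ?_)
        rw [Finset.HasAntidiagonal.mem_antidiagonal] at hij
        calc ‖linCoeff l ij.1 * linCoeff l ij.2‖
            = ‖linCoeff l ij.1‖ * ‖linCoeff l ij.2‖ := norm_mul _ _
          _ ≤ ((1 - ‖l‖)⁻¹ ^ ij.1 * catalan ij.1) * ((1 - ‖l‖)⁻¹ ^ ij.2 * catalan ij.2) := by
              gcongr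
              · exact ih _ (by omega)
              · exact ih _ (by omega)
          _ = _ := by rw [← hij, pow_add]; push_cast; ring
      rw [linCoeff_succ, norm_div, pow_succ (1 - ‖l‖)⁻¹]
      calc _ ≤ ((1 - ‖l‖)⁻¹ ^ n * catalan (n + 1)) / (1 - ‖l‖) := by gcongr
        _ = _ := by rw [div_eq_mul_inv]; ring

theorem catalan_le_four_pow (n : ℕ) : catalan n ≤ 4 ^ n := by
  rw [catalan_eq_centralBinom_div]
  exact (Nat.div_le_self _ _).trans (Nat.centralBinom_le_four_pow n)

theorem continuousAt_linCoeff {l : ℂ} (hl : ∀ n : ℕ, l ^ (n + 1) ≠ 1) (n : ℕ) :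
    ContinuousAt (fun l => linCoeff l n) l := by
  induction n using Nat.strong_induction_on with
  | _ n ih =>
    cases n with
    | zero => simpa only [linCoeff_zero] using continuousAt_const
    | succ n =>
      simp only [linCoeff_succ]
      refine ContinuousAt.div (tendsto_finsetSum _ fun ij hij => ?_) (by fun_prop)
        (sub_ne_zero.2 (hl n))
      rw [Finset.HasAntidiagonal.mem_antidiagonal] at hij
      exact (ih _ (by omega)).mul (ih _ (by omega))

/-- The power series with coefficients `linCoeff l`. -/
noncomputable def linSeries (l : ℂ) : FormalMultilinearSeries ℂ ℂ ℂ :=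
  FormalMultilinearSeries.ofScalars ℂ (linCoeff l)

/-- The sum of the power series with coefficients `linCoeff l`. -/
noncomputable def linSum (l : ℂ) (w : ℂ) : ℂ := ∑' n, linCoeff l n * w ^ n

theorem norm_linSeries (l : ℂ) (n : ℕ) : ‖linSeries l n‖ = ‖linCoeff l n‖ := by
  rw [linSeries, FormalMultilinearSeries.ofScalars_norm]

theorem linSum_zero (l : ℂ) : linSum l 0 = 1 := by
  rw [linSum, tsum_eq_single 0 (fun n hn => by simp [hn])]
  simp [linCoeff_zero]

theorem hasFPowerSeriesOnBall_linSum {l : ℂ} (h : 0 < (linSeries l).radius) :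
    HasFPowerSeriesOnBall (linSum l) (linSeries l) 0 (linSeries l).radius := by
  convert (linSeries l).hasFPowerSeriesOnBall h using 1
  ext w
  simp [FormalMultilinearSeries.sum, linSum, linSeries, mul_comm]

theorem radius_linSeries_pos {l : ℂ} (hl : ‖l‖ < 1) : 0 < (linSeries l).radius := by
  have h1 : 0 < 1 - ‖l‖ := by linarith
  have := (linSeries l).le_radius_of_bound (r := ((1 - ‖l‖) / 4).toNNReal) 1 fun n => by
    rw [norm_linSeries, Real.coe_toNNReal _ (by positivity)]
    have h4 : (catalan n : ℝ) ≤ 4 ^ n := by exact_mod_cast catalan_le_four_pow n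
    calc ‖linCoeff l n‖ * ((1 - ‖l‖) / 4) ^ n
        ≤ ((1 - ‖l‖)⁻¹ ^ n * 4 ^ n) * ((1 - ‖l‖) / 4) ^ n := by
          gcongr; exact (norm_linCoeff_le hl n).trans (by gcongr)
      _ = 1 := by rw [← mul_pow, ← mul_pow]; field_simp; simp
  refine lt_of_lt_of_le ?_ this
  rw [ENNReal.coe_pos, Real.toNNReal_pos]
  exact div_pos h1 (by norm_num)

theorem summable_norm_linCoeff {l w : ℂ} (h : ENNReal.ofReal ‖w‖ < (linSeries l).radius) :
    Summable fun n => ‖linCoeff l n * w ^ n‖ := by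
  have := (linSeries l).summable_norm_mul_pow (r := ‖w‖₊) (by
    simpa [ENNReal.ofReal, norm_toNNReal] using h)
  simpa only [norm_linSeries, coe_nnnorm, norm_mul, norm_pow] using this

theorem linSum_mul {l w : ℂ} (hl1 : ‖l‖ ≤ 1) (hl : ∀ n : ℕ, l ^ (n + 1) ≠ 1)
    (h : ENNReal.ofReal ‖w‖ < (linSeries l).radius) :
    linSum l (l * w) = linSum l w + w * linSum l w ^ 2 := by
  have hs := summable_norm_linCoeff h
  have hs' : Summable fun n => ‖linCoeff l n * (l * w) ^ n‖ := by
    refine hs.of_nonneg_of_le (fun _ => norm_nonneg _) fun n => ?_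
    rw [mul_pow, norm_mul, norm_mul, norm_mul, norm_pow]
    have := pow_le_one₀ (norm_nonneg l) hl1 (n := n)
    gcongr
    exact mul_le_of_le_one_left (norm_nonneg _) this
  have hsq : linSum l w ^ 2 = ∑' n, (l ^ (n + 1) - 1) * linCoeff l (n + 1) * w ^ n := by
    rw [sq, linSum, tsum_mul_tsum_eq_tsum_sum_antidiagonal_of_summable_norm hs hs]
    refine tsum_congr fun n => ?_
    rw [linCoeff_succ, mul_div_cancel₀ _ (sub_ne_zero.2 (hl n)), Finset.sum_mul]
    refine Finset.sum_congr rfl fun ij hij => ?_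
    rw [Finset.HasAntidiagonal.mem_antidiagonal] at hij
    rw [← hij, pow_add]; ring
  rw [hsq, ← tsum_mul_left, linSum, linSum, hs.of_norm.tsum_eq_zero_add,
    hs'.of_norm.tsum_eq_zero_add, add_assoc,
    ← ((summable_nat_add_iff 1).2 hs.of_norm).tsum_add]
  · simp only [pow_zero]
    congr 1
    refine tsum_congr fun n => ?_
    ring
  · refine (((summable_nat_add_iff 1).2 hs'.of_norm).sub
      ((summable_nat_add_iff 1).2 hs.of_norm)).congr fun n => ?_
    ring

theorem pow_succ_ne_one_of_norm_lt_one {l : ℂ} (hl : ‖l‖ < 1) (n : ℕ) : l ^ (n + 1) ≠ 1 := by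
  intro h
  have h1 := congrArg norm h
  rw [norm_pow, norm_one] at h1
  exact (pow_lt_one₀ (norm_nonneg l) hl (by omega)).ne h1

theorem differentiableOn_linSum {l : ℂ} {R : ℝ} (hR : 0 < R)
    (h : ENNReal.ofReal R ≤ (linSeries l).radius) :
    DifferentiableOn ℂ (linSum l) (Metric.ball 0 R) := by
  have hpos : 0 < (linSeries l).radius := (ENNReal.ofReal_pos.2 hR).trans_le h
  refine (hasFPowerSeriesOnBall_linSum hpos).differentiableOn.mono ?_
  rw [← Metric.eball_ofReal]
  exact Metric.eball_subset_eball h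

theorem norm_mul_linSum_le {l w : ℂ} (hl : 1 / 2 ≤ ‖l‖) (hl1 : ‖l‖ < 1)
    (hw : ENNReal.ofReal ‖w‖ < (linSeries l).radius) : ‖w * linSum l w‖ ≤ 3 := by
  by_contra! hcon
  set u : ℕ → ℂ := fun n => (l ^ n * w) * linSum l (l ^ n * w) with hu
  have hlt (n : ℕ) : ENNReal.ofReal ‖l ^ n * w‖ < (linSeries l).radius := by
    refine lt_of_le_of_lt (ENNReal.ofReal_le_ofReal ?_) hw
    rw [norm_mul, norm_pow]
    exact mul_le_of_le_one_left (norm_nonneg _) (pow_le_one₀ (norm_nonneg _) hl1.le)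
  have hrec (n : ℕ) : u (n + 1) = l * (u n * (1 + u n)) := by
    simp only [hu]
    rw [pow_succ', mul_assoc l, linSum_mul hl1.le (pow_succ_ne_one_of_norm_lt_one hl1) (hlt n)]
    ring
  have hbig (n : ℕ) : 3 < ‖u n‖ := by
    induction n with
    | zero => simpa [hu] using hcon
    | succ n ih =>
      have h1 : 2 ≤ ‖1 + u n‖ := by
        have := norm_sub_le (1 + u n) 1
        rw [add_sub_cancel_left, norm_one] at this
        linarith
      rw [hrec, norm_mul, norm_mul]
      nlinarith [norm_nonneg (u n), mul_le_mul hl h1 (by norm_num) (norm_nonneg l)]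
  have hl0 : Tendsto (fun n => l ^ n * w) atTop (𝓝 0) := by
    simpa using (tendsto_pow_atTop_nhds_zero_of_norm_lt_one hl1).mul_const w
  have hc : ContinuousAt (linSum l) 0 :=
    (hasFPowerSeriesOnBall_linSum (radius_linSeries_pos hl1)).hasFPowerSeriesAt.continuousAt
  have hu0 : Tendsto u atTop (𝓝 0) := by
    simpa using hl0.mul (hc.tendsto.comp hl0)
  obtain ⟨n, hn⟩ := ((hu0.norm).eventually (gt_mem_nhds (by simp : ‖(0 : ℂ)‖ < 3))).exists
  exact absurd hn (hbig n).not_gt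

theorem deriv_mul_linSum_zero {l : ℂ} (h : 0 < (linSeries l).radius) :
    deriv (fun w => w * linSum l w) 0 = 1 := by
  have hd : DifferentiableAt ℂ (linSum l) 0 :=
    (hasFPowerSeriesOnBall_linSum h).hasFPowerSeriesAt.differentiableAt
  have := (hasDerivAt_id (0 : ℂ)).mul hd.hasDerivAt
  simp only [id, linSum_zero, mul_one, zero_mul, add_zero] at this
  exact this.deriv

theorem mapsTo_mul_linSum {l : ℂ} {R : ℝ} (hl : 1 / 2 ≤ ‖l‖) (hl1 : ‖l‖ < 1)
    (hR : 0 < R) (h : ENNReal.ofReal R ≤ (linSeries l).radius) :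
    MapsTo (fun w => w * linSum l w) (Metric.ball 0 R)
      (Metric.closedBall ((fun w => w * linSum l w) 0) 3) := by
  intro w hw
  rw [mem_ball_zero_iff] at hw
  simp only [zero_mul, mem_closedBall_zero_iff]
  exact norm_mul_linSum_le hl hl1 (((ENNReal.ofReal_lt_ofReal_iff hR).2 hw).trans_le h)

theorem exists_radius_linSeries {l : ℂ} (hl : 1 / 2 ≤ ‖l‖) (hl1 : ‖l‖ < 1) :
    ∃ R : ℝ, 0 < R ∧ (linSeries l).radius = ENNReal.ofReal R := by
  have hpos := radius_linSeries_pos hl1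
  have hle : (linSeries l).radius ≤ 3 := by
    refine le_of_forall_lt fun c hc => ?_
    obtain ⟨d, hcd, hd⟩ := ENNReal.lt_iff_exists_nnreal_btwn.1 hc
    refine hcd.trans_le ?_
    have hd0 : (0 : ℝ) < d := by
      have := zero_le.trans_lt hcd
      exact_mod_cast this
    have hd' : ENNReal.ofReal (d : ℝ) ≤ (linSeries l).radius := by simpa using hd.le
    have := Complex.norm_deriv_le_div_of_mapsTo_ball
      ((differentiableOn_id.mul (differentiableOn_linSum hd0 hd')))
      (mapsTo_mul_linSum hl hl1 hd0 hd') hd0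
    rw [show deriv ((fun w => w) * linSum l) 0 = 1 from deriv_mul_linSum_zero hpos, norm_one,
      le_div_iff₀ hd0, one_mul] at this
    exact_mod_cast this
  have hne : (linSeries l).radius ≠ ⊤ := (hle.trans_lt (by simp)).ne
  exact ⟨_, ENNReal.toReal_pos hpos.ne' hne, (ENNReal.ofReal_toReal hne).symm⟩

theorem norm_linSum_le {l w : ℂ} {R : ℝ} (hl : 1 / 2 ≤ ‖l‖) (hl1 : ‖l‖ < 1)
    (h : ENNReal.ofReal R ≤ (linSeries l).radius) (hw : ‖w‖ < R) : ‖linSum l w‖ ≤ 3 / R := by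
  have hR : 0 < R := (norm_nonneg w).trans_lt hw
  have hd := differentiableOn_linSum hR h
  rcases eq_or_ne w 0 with rfl | hw0
  · have := Complex.norm_deriv_le_div_of_mapsTo_ball (differentiableOn_id.mul hd)
      (mapsTo_mul_linSum hl hl1 hR h) hR
    rw [show deriv ((fun w => w) * linSum l) 0 = 1 from
      deriv_mul_linSum_zero (radius_linSeries_pos hl1)] at this
    rwa [linSum_zero]
  · have := Complex.dist_le_div_mul_dist_of_mapsTo_ball (differentiableOn_id.mul hd)
      (mapsTo_mul_linSum hl hl1 hR h) (z := w) (by simpa using hw)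
    simp only [Pi.mul_apply, zero_mul, dist_zero_right, norm_mul] at this
    exact le_of_mul_le_mul_left (by linarith) (norm_pos_iff.2 hw0)

theorem norm_linCoeff_le_of_radius {l : ℂ} {R : ℝ} (hR : 0 < R) (hl : 1 / 2 ≤ ‖l‖) (hl1 : ‖l‖ < 1)
    (h : ENNReal.ofReal R ≤ (linSeries l).radius) (n : ℕ) : ‖linCoeff l n‖ ≤ 3 / R ^ (n + 1) := by
  have hd := differentiableOn_linSum hR h
  have key : ∀ r : ℝ, 0 < r → r < R → ‖linCoeff l n‖ ≤ 3 / R / r ^ n := by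
    intro r hr hrR
    have hs := (hasFPowerSeriesOnBall_linSum (radius_linSeries_pos hl1)).factorial_smul 1 n
    have h1 := Complex.norm_iteratedDeriv_le_of_forall_mem_sphere_norm_le n hr
      ((hd.mono (Metric.closedBall_subset_ball hrR)).mono
        Metric.closure_ball_subset_closedBall).diffContOnCl
      (C := 3 / R) fun z hz => norm_linSum_le hl hl1 h (by
        rw [mem_sphere_zero_iff_norm] at hz; rwa [hz])
    rw [iteratedDeriv_eq_iteratedFDeriv] at h1
    have h2 : (n.factorial : ℂ) * linCoeff l n = iteratedFDeriv ℂ n (linSum l) 0 fun _ => 1 := by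
      rw [← hs]
      simp [linSeries]
    rw [← h2, norm_mul, Complex.norm_natCast, mul_div_assoc] at h1
    exact le_of_mul_le_mul_left h1 (by positivity)
  have hlim : Tendsto (fun r : ℝ => 3 / R / r ^ n) (𝓝[<] R) (𝓝 (3 / R / R ^ n)) := by
    refine (ContinuousAt.tendsto ?_).mono_left nhdsWithin_le_nhds
    exact continuousAt_const.div (by fun_prop) (by positivity)
  rw [pow_succ', ← div_div]
  refine ge_of_tendsto hlim ?_
  filter_upwards [Ioo_mem_nhdsLT hR] with r hr using key r hr.1 hr.2

theorem DifferentiableOn.exists_sq_eq_of_ne_zero {f : ℂ → ℂ} {r : ℝ} {a : ℂ}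
    (hf : DifferentiableOn ℂ f (Metric.ball 0 r)) (hf0 : ∀ z ∈ Metric.ball 0 r, f z ≠ 0)
    (ha : a ^ 2 = f 0) :
    ∃ S : ℂ → ℂ, DifferentiableOn ℂ S (Metric.ball 0 r) ∧ S 0 = a ∧
      ∀ z ∈ Metric.ball 0 r, S z ^ 2 = f z := by
  have hopen : IsOpen (Metric.ball (0 : ℂ) r) := Metric.isOpen_ball
  obtain ⟨g, hg0, hg⟩ := Complex.IsExactOn.with_val_at
    ((hf.deriv hopen).div hf hf0).isExactOn_ball (0 : ℂ) (0 : ℂ)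
  have hgd : DifferentiableOn ℂ g (Metric.ball 0 r) := fun z hz =>
    (hg z hz).differentiableAt.differentiableWithinAt
  refine ⟨fun z => a * Complex.exp (g z / 2), ?_, by simp [hg0], fun z hz => ?_⟩
  · exact (Complex.differentiable_exp.comp_differentiableOn (hgd.div_const 2)).const_mul a
  · have h0 : (0 : ℂ) ∈ Metric.ball 0 r := by
      rw [Metric.mem_ball, dist_self]
      exact Metric.pos_of_mem_ball hz
    have hder : ∀ w ∈ Metric.ball 0 r, HasDerivAt (fun w => Complex.exp (-g w) * f w) 0 w := by
      intro w hw
      have hfw := (hf.differentiableAt (hopen.mem_nhds hw)).hasDerivAt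
      have hfw0 := hf0 w hw
      convert! (hg w hw).neg.cexp.mul hfw using 1
      simp only [Pi.neg_apply, Pi.div_apply]
      field_simp
      ring
    have hconst := hopen.is_const_of_deriv_eq_zero (convex_ball _ _).isPreconnected
      (fun w hw => (hder w hw).differentiableAt.differentiableWithinAt)
      (fun w hw => (hder w hw).deriv) hz h0
    simp only [hg0, neg_zero, Complex.exp_zero, one_mul] at hconst
    rw [mul_pow, ← Complex.exp_nat_mul, ha, ← hconst, Complex.exp_neg]
    have := Complex.exp_ne_zero (g z)
    rw [Nat.cast_ofNat, mul_div_cancel₀ _ two_ne_zero]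
    field_simp

theorem linSum_critical_ne_zero {l w : ℂ} {R : ℝ} (hl0 : l ≠ 0) (hl1 : ‖l‖ < 1)
    (h : ENNReal.ofReal R ≤ (linSeries l).radius) (hw : ‖w‖ < R) :
    1 / 4 + w * linSum l (l * w) ≠ 0 := by
  intro hcon
  have hR : 0 < R := (norm_nonneg w).trans_lt hw
  have hd := differentiableOn_linSum hR h
  have hfe (z : ℂ) (hz : z ∈ Metric.ball 0 R) :
      linSum l (l * z) = linSum l z + z * linSum l z ^ 2 :=
    linSum_mul hl1.le (pow_succ_ne_one_of_norm_lt_one hl1)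
      (((ENNReal.ofReal_lt_ofReal_iff hR).2 (mem_ball_zero_iff.1 hz)).trans_le h)
  set p : ℂ → ℂ := fun z => z * linSum l z with hp
  have hpd : DifferentiableOn ℂ p (Metric.ball 0 R) := differentiableOn_id.mul hd
  have hmem {z : ℂ} (hz : z ∈ Metric.ball 0 R) : l * z ∈ Metric.ball 0 R := by
    rw [mem_ball_zero_iff] at hz ⊢
    rw [norm_mul]
    exact (mul_le_of_le_one_left (norm_nonneg _) hl1.le).trans_lt hz
  have hpder {z : ℂ} (hz : z ∈ Metric.ball 0 R) : HasDerivAt p (deriv p z) z :=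
    (hpd.differentiableAt (Metric.isOpen_ball.mem_nhds hz)).hasDerivAt
  have hder {z : ℂ} (hz : z ∈ Metric.ball 0 R) :
      deriv p (l * z) = (1 + 2 * p z) * deriv p z := by
    have h1 : HasDerivAt (fun z => p (l * z)) (deriv p (l * z) * l) z := by
      simpa [Function.comp_def] using! (hpder (hmem hz)).comp z ((hasDerivAt_id z).const_mul l)
    have h2 : HasDerivAt (fun z => l * (p z + p z ^ 2)) (l * (deriv p z + 2 * p z * deriv p z)) z := by
      simpa using ((hpder hz).add ((hpder hz).pow 2)).const_mul l
    have heq : (fun z => p (l * z)) =ᶠ[𝓝 z] fun z => l * (p z + p z ^ 2) := by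
      filter_upwards [Metric.isOpen_ball.mem_nhds hz] with y hy
      simp only [hp, hfe y hy]
      ring
    have := h1.unique (h2.congr_of_eventuallyEq heq)
    refine mul_left_cancel₀ hl0 ?_
    rw [mul_comm, this]; ring
  have hwm : w ∈ Metric.ball 0 R := mem_ball_zero_iff.2 hw
  have hpw : 1 + 2 * p w = 0 := by
    have h1 : (1 + 2 * p w) ^ 2 = 0 := by
      rw [hfe w hwm] at hcon
      simp only [hp]
      linear_combination 4 * hcon
    exact pow_eq_zero_iff two_ne_zero |>.1 h1
  have hz (n : ℕ) : l ^ (n + 1) * w ∈ Metric.ball 0 R ∧ deriv p (l ^ (n + 1) * w) = 0 := by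
    induction n with
    | zero =>
      rw [zero_add, pow_one]
      exact ⟨hmem hwm, by rw [hder hwm, hpw, zero_mul]⟩
    | succ n ih =>
      rw [pow_succ', mul_assoc]
      exact ⟨hmem ih.1, by rw [hder ih.1, ih.2, mul_zero]⟩
  have hl : Tendsto (fun n : ℕ => l ^ (n + 1) * w) atTop (𝓝 0) := by
    simpa using (((tendsto_pow_atTop_nhds_zero_of_norm_lt_one hl1).comp
      (tendsto_add_atTop_nat 1)).mul_const w)
  have hc : ContinuousAt (deriv p) 0 :=
    ((hpd.deriv Metric.isOpen_ball).differentiableAt (Metric.ball_mem_nhds 0 hR)).continuousAt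
  have h1 := hc.tendsto.comp hl
  simp only [Function.comp_def, (hz _).2] at h1
  have h2 := tendsto_nhds_unique h1 tendsto_const_nhds
  rw [deriv_mul_linSum_zero (radius_linSeries_pos hl1)] at h2
  exact one_ne_zero h2

theorem exists_critical_preimage {l : ℂ} {R : ℝ} (hl0 : l ≠ 0) (hl1 : ‖l‖ < 1) (hR : 0 < R)
    (h : (linSeries l).radius = ENNReal.ofReal R) :
    ∃ w : ℂ, ‖w‖ = R ∧ 1 / 4 + w * linSum l (l * w) = 0 := by
  by_contra! hcon
  have hlpos : 0 < ‖l‖ := norm_pos_iff.2 hl0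
  have hd := differentiableOn_linSum hR h.ge
  set H : ℂ → ℂ := fun w => 1 / 4 + w * linSum l (l * w) with hH
  have hmaps : MapsTo (fun w => l * w) (Metric.ball 0 (R / ‖l‖)) (Metric.ball 0 R) := by
    intro w hw
    rw [mem_ball_zero_iff] at hw ⊢
    rw [norm_mul, mul_comm]
    exact (lt_div_iff₀ hlpos).1 hw
  have hHd : DifferentiableOn ℂ H (Metric.ball 0 (R / ‖l‖)) :=
    (differentiableOn_id.mul (hd.comp (differentiableOn_id.const_mul l) hmaps)).const_add _
  have hU : IsOpen (Metric.ball 0 (R / ‖l‖) ∩ H ⁻¹' {0}ᶜ) :=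
    hHd.continuousOn.isOpen_inter_preimage Metric.isOpen_ball isOpen_compl_singleton
  have hsub : Metric.closedBall 0 R ⊆ Metric.ball 0 (R / ‖l‖) ∩ H ⁻¹' {0}ᶜ := by
    intro w hw
    rw [mem_closedBall_zero_iff] at hw
    refine ⟨mem_ball_zero_iff.2 (hw.trans_lt ?_), ?_⟩
    · rw [lt_div_iff₀ hlpos]; nlinarith
    · rcases hw.lt_or_eq with hw | hw
      · exact linSum_critical_ne_zero hl0 hl1 h.ge hw
      · exact hcon w hw
  obtain ⟨δ, hδ, hδU⟩ := (isCompact_closedBall (0 : ℂ) R).exists_thickening_subset_open hU hsub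
  rw [thickening_closedBall hδ hR.le] at hδU
  obtain ⟨S, hSd, hS0, hS⟩ := (hHd.mono (hδU.trans inter_subset_left)).exists_sq_eq_of_ne_zero
    (fun z hz => (hδU hz).2) (a := 1 / 2) (by simp [hH]; norm_num)
  have hpos := radius_linSeries_pos hl1
  have hball : Metric.ball (0 : ℂ) R ∈ 𝓝 0 := Metric.ball_mem_nhds 0 hR
  have hball' : Metric.ball (0 : ℂ) (δ + R) ∈ 𝓝 0 := Metric.ball_mem_nhds 0 (by positivity)
  have hBc : ContinuousAt (linSum l) 0 := hd.continuousOn.continuousAt hball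
  have hSc : ContinuousAt S 0 := hSd.continuousOn.continuousAt hball'
  have hne : ∀ᶠ w in 𝓝 (0 : ℂ), S w + (1 / 2 + w * linSum l w) ≠ 0 := by
    have : ContinuousAt (fun w => S w + (1 / 2 + w * linSum l w)) 0 := by fun_prop
    refine this.eventually_ne ?_
    rw [hS0]; norm_num
  have hSeq : ∀ᶠ w in 𝓝 (0 : ℂ), S w - 1 / 2 = w * linSum l w := by
    filter_upwards [hne, hball, hball'] with w h1 h2 h3
    have h4 := hS w h3
    have h5 := linSum_mul hl1.le (pow_succ_ne_one_of_norm_lt_one hl1) (w := w)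
      (by rw [h]; exact (ENNReal.ofReal_lt_ofReal_iff hR).2 (mem_ball_zero_iff.1 h2))
    simp only [hH, h5] at h4
    have h6 : (S w - (1 / 2 + w * linSum l w)) * (S w + (1 / 2 + w * linSum l w)) = 0 := by
      linear_combination h4
    have h7 := (mul_eq_zero.1 h6).resolve_right h1
    linear_combination h7
  set T : ℂ → ℂ := fun w => S w - 1 / 2 with hT
  have hTd : DifferentiableOn ℂ (dslope T 0) (Metric.ball 0 (δ + R)) :=
    (Complex.differentiableOn_dslope hball').2 (hSd.sub_const _)
  have hTeq : dslope T 0 =ᶠ[𝓝 0] linSum l := by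
    filter_upwards [hSeq.eventually_nhds] with w hw
    rcases eq_or_ne w 0 with rfl | hw0
    · rw [dslope_same, linSum_zero, ← deriv_mul_linSum_zero hpos]
      exact Filter.EventuallyEq.deriv_eq hw
    · rw [dslope_of_ne _ hw0, slope_def_field, sub_zero]
      simp only [hT, hw.self_of_nhds, hS0, sub_self, sub_zero]
      rw [mul_div_cancel_left₀ _ hw0]
  set r : NNReal := (R + δ / 2).toNNReal with hr
  have hrv : (r : ℝ) = R + δ / 2 := Real.coe_toNNReal _ (by positivity)
  have hps := (hTd.mono (Metric.closedBall_subset_ball (by rw [hrv]; linarith :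
    (r : ℝ) < δ + R))).hasFPowerSeriesOnBall (by rw [← NNReal.coe_pos, hrv]; positivity)
  have heq := (hps.hasFPowerSeriesAt.congr hTeq).eq_formalMultilinearSeries
    (hasFPowerSeriesOnBall_linSum hpos).hasFPowerSeriesAt
  have hle := hps.r_le
  rw [heq, h, hr] at hle
  have := (ENNReal.ofReal_le_ofReal_iff hR.le).1 hle
  linarith

/-- The rescaled orbit of the critical value of `z ↦ l * (z + z ^ 2)`: the `(n + 1)`-st iterate of
the critical point `-1/2` is `l ^ (n + 1) * critOrbit l n`. -/
noncomputable def critOrbit (l : ℂ) : ℕ → ℂ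
  | 0 => -1 / 4
  | n + 1 => critOrbit l n + l ^ (n + 1) * critOrbit l n ^ 2

theorem differentiable_critOrbit (n : ℕ) : Differentiable ℂ fun l => critOrbit l n := by
  induction n with
  | zero => simp [critOrbit]
  | succ n ih => simp only [critOrbit]; fun_prop

theorem critOrbit_zero_left (n : ℕ) : critOrbit 0 n = -1 / 4 := by
  induction n with
  | zero => rfl
  | succ n ih => simp [critOrbit, ih]

theorem exists_tendsto_critOrbit {l : ℂ} (hl : 1 / 2 ≤ ‖l‖) (hl1 : ‖l‖ < 1) :
    ∃ R : ℝ, 0 < R ∧ Tendsto (fun n => ‖critOrbit l n‖) atTop (𝓝 R) ∧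
      (∀ n, ‖critOrbit l n‖ ≤ 3) ∧ ∀ n, ‖linCoeff l n‖ ≤ 3 / R ^ (n + 1) := by
  have hl0 : l ≠ 0 := norm_pos_iff.1 (by linarith)
  obtain ⟨R, hR, h⟩ := exists_radius_linSeries hl hl1
  obtain ⟨w, hwR, hw⟩ := exists_critical_preimage hl0 hl1 hR h
  have hlt (n : ℕ) : ‖l ^ (n + 1) * w‖ < R := by
    rw [norm_mul, norm_pow, hwR]
    exact mul_lt_of_lt_one_left hR (pow_lt_one₀ (norm_nonneg _) hl1 (by omega))
  have heq (n : ℕ) : critOrbit l n = w * linSum l (l ^ (n + 1) * w) := by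
    induction n with
    | zero =>
      rw [critOrbit, zero_add, pow_one]
      linear_combination -hw
    | succ n ih =>
      rw [pow_succ' l (n + 1), mul_assoc l, linSum_mul hl1.le (pow_succ_ne_one_of_norm_lt_one hl1)
        (by rw [h]; exact (ENNReal.ofReal_lt_ofReal_iff hR).2 (hlt n)), critOrbit, ih]
      ring
  refine ⟨R, hR, ?_, fun n => ?_, norm_linCoeff_le_of_radius hR hl hl1 h.ge⟩
  · have hc : ContinuousAt (linSum l) 0 :=
      (hasFPowerSeriesOnBall_linSum (radius_linSeries_pos hl1)).hasFPowerSeriesAt.continuousAt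
    have h0 : Tendsto (fun n : ℕ => l ^ (n + 1) * w) atTop (𝓝 0) := by
      simpa using (((tendsto_pow_atTop_nhds_zero_of_norm_lt_one hl1).comp
        (tendsto_add_atTop_nat 1)).mul_const w)
    have := ((hc.tendsto.comp h0).const_mul w).norm
    simpa [linSum_zero, hwR, Function.comp_def, heq] using this
  · rw [heq, norm_mul, hwR]
    have := norm_linSum_le hl hl1 h.ge (hlt n)
    rw [le_div_iff₀ hR] at this
    linarith

theorem le_circleAverage_log_norm {f : ℂ → ℂ} (hf : Differentiable ℂ f) (h0 : f 0 ≠ 0) {r : ℝ}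
    (hr : 0 < r) :
    Real.log ‖f 0‖ ≤ Real.circleAverage (fun z => Real.log ‖f z‖) 0 r := by
  have hfa : AnalyticOnNhd ℂ f (Metric.closedBall 0 |r|) := fun z _ => hf.analyticAt z
  rw [hfa.circleAverage_log_norm hr.ne' h0]
  refine le_add_of_nonneg_left (finsum_nonneg fun u => ?_)
  by_cases hu : u ∈ Metric.closedBall 0 |r|
  · refine mul_nonneg ?_ ?_
    · exact_mod_cast MeromorphicOn.AnalyticOnNhd.divisor_nonneg hfa u
    · rw [zero_sub, norm_neg]
      rw [mem_closedBall_zero_iff, abs_of_pos hr] at hu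
      rcases eq_or_ne u 0 with rfl | hu0
      · simp
      · refine Real.log_nonneg ?_
        rw [← div_eq_mul_inv, one_le_div (norm_pos_iff.2 hu0)]
        exact hu
  · simp [hu]

theorem lintegral_log_critOrbit_le {r : ℝ} (hr : 1 / 2 ≤ r) (hr1 : r < 1) (n : ℕ) :
    ∫⁻ t in Ioc 0 (2 * Real.pi),
      ENNReal.ofReal (Real.log 3 - Real.log ‖critOrbit (circleMap 0 r t) n‖) ≤
      ENNReal.ofReal (2 * Real.pi * (Real.log 3 - Real.log (1 / 4))) := by
  have hr0 : 0 < r := by linarith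
  have hnorm (t : ℝ) : ‖circleMap 0 r t‖ = r := by simp [abs_of_pos hr0]
  have hci : CircleIntegrable (fun z => Real.log ‖critOrbit z n‖) 0 r :=
    MeromorphicOn.circleIntegrable_log_norm fun z _ =>
      ((differentiable_critOrbit n).analyticAt z).meromorphicAt
  have hii : IntervalIntegrable (fun t => Real.log ‖critOrbit (circleMap 0 r t) n‖) volume
    0 (2 * Real.pi) := hci
  have hJ := le_circleAverage_log_norm (differentiable_critOrbit n)
    (by rw [critOrbit_zero_left]; norm_num) hr0
  have hnn (t : ℝ) : 0 ≤ Real.log 3 - Real.log ‖critOrbit (circleMap 0 r t) n‖ := by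
    obtain ⟨-, -, -, hb, -⟩ := exists_tendsto_critOrbit (by rwa [hnorm t]) (by rwa [hnorm t])
    rcases (norm_nonneg (critOrbit (circleMap 0 r t) n)).eq_or_lt with h | h
    · rw [← h, Real.log_zero, sub_zero]; exact Real.log_nonneg (by norm_num)
    · exact sub_nonneg.2 (Real.log_le_log h (hb n))
  rw [← ofReal_integral_eq_lintegral_ofReal]
  · refine ENNReal.ofReal_le_ofReal ?_
    rw [← intervalIntegral.integral_of_le Real.two_pi_pos.le,
      intervalIntegral.integral_sub (by simp) hii, intervalIntegral.integral_const]
    rw [critOrbit_zero_left, Real.circleAverage_def, smul_eq_mul,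
      ← div_eq_inv_mul, le_div_iff₀ Real.two_pi_pos] at hJ
    have h4 : ‖(-1 / 4 : ℂ)‖ = 1 / 4 := by norm_num
    rw [h4] at hJ
    simp only [smul_eq_mul, sub_zero]
    linarith
  · exact ((intervalIntegrable_const (c := Real.log 3)).sub hii).1
  · exact Filter.Eventually.of_forall hnn

theorem ae_exists_frequently_norm_linCoeff_le {r : ℕ → ℝ} (hr : ∀ m, 1 / 2 ≤ r m)
    (hr1 : ∀ m, r m < 1) :
    ∀ᵐ t ∂volume.restrict (Ioc 0 (2 * Real.pi)), ∃ δ : ℝ, 0 < δ ∧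
      ∃ᶠ m in atTop, ∀ n, ‖linCoeff (circleMap 0 (r m) t) n‖ ≤ 3 / δ ^ (n + 1) := by
  set F : ℕ → ℕ → ℝ → ENNReal := fun m n t =>
    ENNReal.ofReal (Real.log 3 - Real.log ‖critOrbit (circleMap 0 (r m) t) n‖) with hF
  have hFm (m n : ℕ) : Measurable (F m n) := by
    have h1 : Continuous fun t => critOrbit (circleMap 0 (r m) t) n :=
      (differentiable_critOrbit n).continuous.comp (continuous_circleMap 0 (r m))
    exact (measurable_const.sub (Real.measurable_log.comp h1.norm.measurable)).ennreal_ofReal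
  set G : ℕ → ℝ → ENNReal := fun m t => liminf (fun n => F m n t) atTop with hG
  have hGm (m : ℕ) : Measurable (G m) := .liminf (hFm m)
  set C := ENNReal.ofReal (2 * Real.pi * (Real.log 3 - Real.log (1 / 4)))
  have hGi (m : ℕ) : ∫⁻ t in Ioc 0 (2 * Real.pi), G m t ≤ C := by
    refine (lintegral_liminf_le (hFm m)).trans ?_
    refine (liminf_le_liminf (Filter.Eventually.of_forall fun n =>
      lintegral_log_critOrbit_le (hr m) (hr1 m) n)).trans ?_
    rw [liminf_const]
  have hGint : ∫⁻ t in Ioc 0 (2 * Real.pi), liminf (fun m => G m t) atTop ≤ C := by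
    refine (lintegral_liminf_le hGm).trans ?_
    refine (liminf_le_liminf (Filter.Eventually.of_forall hGi)).trans ?_
    rw [liminf_const]
  filter_upwards [ae_lt_top (.liminf hGm) (hGint.trans_lt ENNReal.ofReal_lt_top).ne] with t ht
  obtain ⟨K, hK, hK'⟩ := ENNReal.lt_iff_exists_nnreal_btwn.1 ht
  refine ⟨3 * Real.exp (-K), by positivity,
    (frequently_lt_of_liminf_lt (by isBoundedDefault) hK).mono fun m hm n => ?_⟩
  have hnorm : ‖circleMap 0 (r m) t‖ = r m := by
    simp [abs_of_pos (by linarith [hr m] : 0 < r m)]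
  obtain ⟨R, hR, hlim, -, hco⟩ := exists_tendsto_critOrbit (by rw [hnorm]; exact hr m)
    (by rw [hnorm]; exact hr1 m)
  have hGt : G m t = ENNReal.ofReal (Real.log 3 - Real.log R) := by
    refine Tendsto.liminf_eq ?_
    exact ENNReal.tendsto_ofReal ((hlim.log hR.ne').const_sub _)
  rw [hGt, ← ENNReal.ofReal_coe_nnreal] at hm
  have hlt : Real.log 3 - Real.log R < K :=
    lt_of_not_ge fun h => hm.not_ge (ENNReal.ofReal_le_ofReal h)
  have hδR : 3 * Real.exp (-K) ≤ R := by
    rw [← Real.log_le_log_iff (by positivity) hR, Real.log_mul (by norm_num) (Real.exp_ne_zero _),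
      Real.log_exp]
    linarith
  refine (hco n).trans ?_
  gcongr

theorem holLocallyConj_of_semiconj {f p : ℂ → ℂ} {l : ℂ} {r : ℝ} (hr : 0 < r) (hl : ‖l‖ = 1)
    (hp : DifferentiableOn ℂ p (Metric.ball 0 r)) (hp0 : p 0 = 0) (hp' : deriv p 0 ≠ 0)
    (hfp : ∀ w ∈ Metric.ball 0 r, f (p w) = p (l * w)) :
    HolLocallyConj f univ (fun z => l * z) univ := by
  have hball : Metric.ball (0 : ℂ) r ∈ 𝓝 0 := Metric.ball_mem_nhds 0 hr
  have hs : HasStrictDerivAt p (deriv p 0) 0 :=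
    (hp.analyticAt hball).hasStrictDerivAt
  set e := (hs.hasStrictFDerivAt_equiv hp').toOpenPartialHomeomorph p
  have h0s : (0 : ℂ) ∈ e.source := HasStrictFDerivAt.mem_toOpenPartialHomeomorph_source _
  have hdc : ContinuousAt (deriv p) 0 :=
    (hp.deriv Metric.isOpen_ball).continuousOn.continuousAt hball
  obtain ⟨ε, hε, hεs⟩ := Metric.mem_nhds_iff.1
    (Filter.inter_mem hball (Filter.inter_mem (e.open_source.mem_nhds h0s) (hdc.eventually_ne hp')))
  set W := Metric.ball (0 : ℂ) ε with hW
  have hWs : W ⊆ e.source := fun w hw => (hεs hw).2.1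
  have hsymm {w : ℂ} (hw : w ∈ W) : e.symm (p w) = w := e.left_inv (hWs hw)
  have h0W : (0 : ℂ) ∈ W := Metric.mem_ball_self hε
  refine ⟨e.symm, p '' W, W, ?_, Metric.isOpen_ball, ⟨0, h0W, hp0⟩, h0W, subset_univ _,
    subset_univ _, ?_, ⟨?_, ?_, ?_⟩, ⟨p, ?_, ?_⟩, ?_, ?_⟩
  · exact e.isOpen_image_of_subset_source Metric.isOpen_ball hWs
  · rintro _ ⟨w, hw, rfl⟩
    refine (e.hasDerivAt_symm (e.map_source (hWs hw)) (hεs hw).2.2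
      ?_).differentiableAt.differentiableWithinAt
    rw [e.left_inv (hWs hw)]
    exact (hp.differentiableAt (Metric.isOpen_ball.mem_nhds (hεs hw).1)).hasDerivAt
  · rintro _ ⟨w, hw, rfl⟩
    rwa [hsymm hw]
  · rintro _ ⟨w, hw, rfl⟩ _ ⟨w', hw', rfl⟩ h
    rw [hsymm hw, hsymm hw'] at h
    rw [h]
  · intro w hw
    exact ⟨p w, ⟨w, hw, rfl⟩, hsymm hw⟩
  · exact hp.mono fun w hw => (hεs hw).1
  · rintro _ ⟨w, hw, rfl⟩
    simp [hsymm hw]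
  · rw [← hp0, hsymm h0W, hp0]
  · rintro _ ⟨w, hw, rfl⟩ -
    have hlw : l * w ∈ W := by
      rw [hW, mem_ball_zero_iff] at hw ⊢
      rwa [norm_mul, hl, one_mul]
    rw [hfp w (hεs hw).1, hsymm hw, hsymm hlw]

theorem holLocallyConj_quadratic_of_linCoeff_le {l : ℂ} {δ C : ℝ} (hδ : 0 < δ) (hl1 : ‖l‖ = 1)
    (hl : ∀ n : ℕ, l ^ (n + 1) ≠ 1) (h : ∀ n, ‖linCoeff l n‖ ≤ C / δ ^ (n + 1)) :
    HolLocallyConj (fun z => l * z + z ^ 2) univ (fun z => l * z) univ := by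
  have hrad : ENNReal.ofReal δ ≤ (linSeries l).radius := by
    refine (linSeries l).le_radius_of_bound (C / δ) fun n => ?_
    rw [norm_linSeries, Real.coe_toNNReal _ hδ.le]
    have := h n
    rw [pow_succ', ← div_div, le_div_iff₀ (by positivity)] at this
    exact this
  have hpos : 0 < (linSeries l).radius := (ENNReal.ofReal_pos.2 hδ).trans_le hrad
  have hl0 : l ≠ 0 := norm_ne_zero_iff.1 (by rw [hl1]; exact one_ne_zero)
  have hd := differentiableOn_linSum hδ hrad
  have hpd : DifferentiableOn ℂ (fun w => w * linSum l w) (Metric.ball 0 δ) :=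
    differentiableOn_id.mul hd
  refine holLocallyConj_of_semiconj (p := fun w => l * (w * linSum l w)) hδ hl1
    (hpd.const_mul l) (by simp) ?_ fun w hw => ?_
  · rw [deriv_const_mul _ (hpd.differentiableAt (Metric.ball_mem_nhds 0 hδ)),
      deriv_mul_linSum_zero hpos, mul_one]
    exact hl0
  · rw [linSum_mul hl1.le hl
      (((ENNReal.ofReal_lt_ofReal_iff hδ).2 (mem_ball_zero_iff.1 hw)).trans_le hrad)]
    ring

theorem ae_of_periodic_of_ae_restrict_Ioc {P : ℝ → Prop} {T : ℝ} (hT : 0 < T)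
    (hP : Function.Periodic P T) (h : ∀ᵐ t ∂volume.restrict (Ioc 0 T), P t) : ∀ᵐ t, P t := by
  have hfd := isAddFundamentalDomain_Ioc hT 0
  rw [zero_add] at hfd
  refine hfd.measure_zero_of_invariant {t | ¬ P t} ?_ ?_
  · rintro ⟨g, hg⟩
    obtain ⟨k, rfl⟩ := AddSubgroup.mem_zmultiples_iff.1 hg
    ext t
    rw [Set.mem_vadd_set_iff_neg_vadd_mem]
    have : P (-(k • T) + t) = P t := by
      rw [← neg_smul, add_comm]
      exact hP.zsmul (-k) t
    change ¬ P (-(k • T) + t) ↔ ¬ P t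
    rw [this]
  · rw [ae_restrict_iff' measurableSet_Ioc, ae_iff] at h
    convert! h using 2
    ext t
    simp only [mem_inter_iff, mem_ofPred_eq, Classical.not_imp]
    tauto

theorem exp_two_pi_mul_I_pow_ne_one {θ : ℝ} (hθ : Irrational θ) (n : ℕ) :
    Complex.exp (2 * (Real.pi : ℂ) * Complex.I * (θ : ℂ)) ^ (n + 1) ≠ 1 := by
  intro h
  rw [← Complex.exp_nat_mul, Complex.exp_eq_one_iff] at h
  obtain ⟨k, hk⟩ := h
  have h1 : ((n + 1 : ℕ) : ℂ) * θ = k := by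
    refine mul_right_cancel₀ Complex.two_pi_I_ne_zero ?_
    rw [← hk]; ring
  have h2 : ((n + 1 : ℕ) : ℝ) * θ = k := by exact_mod_cast h1
  exact (hθ.natCast_mul (Nat.succ_ne_zero n)).ne_int k h2

theorem ae_irrational : ∀ᵐ θ : ℝ, Irrational θ := by
  have h : (range ((↑) : ℚ → ℝ)).Countable := countable_range _
  exact h.ae_notMem volume

/-- **Yoccoz's positive result.** For almost every `λ = e^{2πiθ}` on the unit circle (i.e. for
Lebesgue-almost every `θ ∈ ℝ`), the origin is a Siegel point for the quadratic polynomial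
`f_λ(z) = λ z + z²`: `f_λ` is holomorphically linearizable at `0`. -/
theorem yoccoz_ae_siegel_quadratic :
    ∀ᵐ θ : ℝ ∂(volume : Measure ℝ),
      HolLocallyConj
        (fun z : ℂ => Complex.exp (2 * (Real.pi : ℂ) * Complex.I * (θ : ℂ)) * z + z ^ 2)
        Set.univ
        (fun z : ℂ => Complex.exp (2 * (Real.pi : ℂ) * Complex.I * (θ : ℂ)) * z)
        Set.univ := by
  set r : ℕ → ℝ := fun m => 1 - 1 / ((m + 1 : ℕ) + 1 : ℝ) with hr
  have hr1 (m : ℕ) : r m < 1 := sub_lt_self _ (by positivity)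
  have hr2 (m : ℕ) : 1 / 2 ≤ r m := by
    have : 1 / ((m + 1 : ℕ) + 1 : ℝ) ≤ 1 / 2 := by
      refine one_div_le_one_div_of_le two_pos ?_
      push_cast
      linarith [(Nat.cast_nonneg m : (0 : ℝ) ≤ m)]
    simp only [hr]
    linarith
  have hrlim : Tendsto r atTop (𝓝 1) := by
    have h := ((tendsto_one_div_add_atTop_nhds_zero_nat (𝕜 := ℝ)).comp
      (tendsto_add_atTop_nat 1)).const_sub 1
    rwa [sub_zero] at h
  have hae := ae_of_periodic_of_ae_restrict_Ioc Real.two_pi_pos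
    (fun t => by simp only [periodic_circleMap 0 _ t])
    (ae_exists_frequently_norm_linCoeff_le hr2 hr1)
  have hae' : ∀ᵐ θ : ℝ, ∃ δ : ℝ, 0 < δ ∧ ∃ᶠ m in atTop,
      ∀ n, ‖linCoeff (circleMap 0 (r m) (2 * Real.pi * θ)) n‖ ≤ 3 / δ ^ (n + 1) := by
    rw [ae_iff] at hae ⊢
    have h := Real.volume_preimage_mul_left Real.two_pi_pos.ne'
      {t | ¬ ∃ δ : ℝ, 0 < δ ∧ ∃ᶠ m in atTop, ∀ n,
        ‖linCoeff (circleMap 0 (r m) t) n‖ ≤ 3 / δ ^ (n + 1)}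
    rw [hae, mul_zero] at h
    exact h
  filter_upwards [hae', ae_irrational] with θ ⟨δ, hδ, hfreq⟩ hθ
  set l := Complex.exp (2 * (Real.pi : ℂ) * Complex.I * (θ : ℂ)) with hl
  have hroot := exp_two_pi_mul_I_pow_ne_one hθ
  have hl1 : ‖l‖ = 1 := by
    rw [hl, show 2 * (Real.pi : ℂ) * Complex.I * θ = ((2 * Real.pi * θ : ℝ) : ℂ) * Complex.I by
      push_cast; ring, Complex.norm_exp_ofReal_mul_I]
  have hlim : Tendsto (fun m => circleMap 0 (r m) (2 * Real.pi * θ)) atTop (𝓝 l) := by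
    have h1 : l = ((1 : ℝ) : ℂ) * Complex.exp (((2 * Real.pi * θ : ℝ) : ℂ) * Complex.I) := by
      rw [hl, Complex.ofReal_one, one_mul]
      congr 1
      push_cast; ring
    rw [h1]
    simp only [circleMap, zero_add]
    exact ((Complex.continuous_ofReal.tendsto 1).comp hrlim).mul_const _
  refine holLocallyConj_quadratic_of_linCoeff_le (C := 3) hδ hl1 hroot fun n => ?_
  exact le_of_tendsto_of_frequently ((continuousAt_linCoeff hroot n).tendsto.comp hlim).norm
    (hfreq.mono fun m hm => hm n)
end

section
/- (Yoccoz) Let λ ∈ S¹ be such that the origin is a Siegel point for the quadratic polynomial f_λ(z) = λz + z², i.e. f_λ is holomorphically linearizable at 0. Then the origin is a Siegel point for every holomorphic local dynamical system at 0 ∈ ℂ with multiplier λ: every such system is holomorphically linearizable. -/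
open Set Filter Topology

namespace QuadraticSiegel

open Metric

/-- A nonvanishing holomorphic function on a disc has a holomorphic logarithm. -/
theorem exists_differentiableOn_exp_eq {f : ℂ → ℂ} {r : ℝ} (hr : 0 < r)
    (hf : DifferentiableOn ℂ f (ball 0 r)) (h0 : ∀ z ∈ ball (0 : ℂ) r, f z ≠ 0) :
    ∃ l : ℂ → ℂ, DifferentiableOn ℂ l (ball 0 r) ∧
      ∀ z ∈ ball (0 : ℂ) r, Complex.exp (l z) = f z := by
  have hd : DifferentiableOn ℂ (fun z => deriv f z / f z) (ball 0 r) :=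
    (hf.deriv isOpen_ball).fun_div hf h0
  obtain ⟨g, hg0, hg⟩ := hd.isExactOn_ball.with_val_at 0 (Complex.log (f 0))
  refine ⟨g, fun z hz => (hg z hz).differentiableAt.differentiableWithinAt, ?_⟩
  have h0r : (0 : ℂ) ∈ ball (0 : ℂ) r := mem_ball_self hr
  have key : ∀ z ∈ ball (0 : ℂ) r, HasDerivAt (fun z => Complex.exp (-g z) * f z) 0 z := by
    intro z hz
    have h1 := ((hg z hz).neg.cexp).mul
      (hf.differentiableAt (isOpen_ball.mem_nhds hz)).hasDerivAt
    refine h1.congr_deriv ?_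
    have := h0 z hz
    simp only [Pi.neg_apply]
    field_simp
    ring
  intro z hz
  have hc : Complex.exp (-g z) * f z = Complex.exp (-g 0) * f 0 := by
    refine (convex_ball (0 : ℂ) r).is_const_of_fderivWithin_eq_zero (𝕜 := ℂ)
      (fun x hx => (key x hx).differentiableAt.differentiableWithinAt) ?_ hz h0r
    intro x hx
    rw [fderivWithin_of_isOpen isOpen_ball hx]
    simpa using (key x hx).hasFDerivAt.fderiv
  rw [hg0, Complex.exp_neg, Complex.exp_neg, Complex.exp_log (h0 0 h0r),
    inv_mul_cancel₀ (h0 0 h0r)] at hc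
  exact ((inv_mul_eq_one₀ (Complex.exp_ne_zero _)).mp hc)

/-- Quantitative inverse function theorem for functions with derivative close to `1` on a disc. -/
theorem exists_inverse_of_deriv_near_one {g : ℂ → ℂ} {r : ℝ}
    (hg : DifferentiableOn ℂ g (ball 0 r)) (hd : ∀ w ∈ ball (0 : ℂ) r, ‖deriv g w - 1‖ ≤ 1 / 2) :
    InjOn g (ball 0 r) ∧ ∃ h : ℂ → ℂ, DifferentiableOn ℂ h (ball (g 0) (r / 2)) ∧
      ∀ z ∈ ball (g 0) (r / 2), h z ∈ ball (0 : ℂ) r ∧ g (h z) = z := by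
  have happ : ApproximatesLinearOn g ((ContinuousLinearEquiv.refl ℂ ℂ : ℂ ≃L[ℂ] ℂ) : ℂ →L[ℂ] ℂ)
      (ball 0 r) (1 / 2 : NNReal) := by
    intro x hx y hy
    have := (convex_ball (0 : ℂ) r).norm_image_sub_le_of_norm_deriv_le (f := fun z => g z - z)
      (C := 1 / 2) (fun z hz => ((hg.differentiableAt (isOpen_ball.mem_nhds hz)).sub
        differentiableAt_id)) (fun z hz => by
          have h := ((hg.differentiableAt (isOpen_ball.mem_nhds hz)).hasDerivAt.sub
            (hasDerivAt_id z)).deriv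
          have h' : deriv (fun z => g z - z) z = deriv g z - 1 := h
          rw [h']; exact hd z hz) hy hx
    calc _ = ‖g x - x - (g y - y)‖ := by congr 1; simp; abel
      _ ≤ _ := by simpa using this
  have hN : Subsingleton ℂ ∨ (1 / 2 : NNReal) <
      ‖((ContinuousLinearEquiv.refl ℂ ℂ).symm : ℂ →L[ℂ] ℂ)‖₊⁻¹ := by
    right
    have : ‖((ContinuousLinearEquiv.refl ℂ ℂ).symm : ℂ →L[ℂ] ℂ)‖₊ = 1 := by
      ext; simp
    rw [this]
    norm_num
  have hinj := happ.injOn hN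
  refine ⟨hinj, ?_⟩
  set e := happ.toOpenPartialHomeomorph g (ball 0 r) hN isOpen_ball with he
  have htgt : ball (g 0) (r / 2) ⊆ e.target := by
    intro z hz
    rw [mem_ball] at hz
    have h1 : ‖((ContinuousLinearEquiv.refl ℂ ℂ).symm : ℂ →L[ℂ] ℂ)‖₊ = 1 := by
      ext; simp
    refine happ.closedBall_subset_target hN isOpen_ball (b := 0)
      (ε := 2 * dist z (g 0)) (by positivity)
      (closedBall_subset_ball (by linarith)) ?_
    rw [h1, mem_closedBall]
    norm_num
    apply le_of_eq
    ring
  have hsrc : ∀ z ∈ ball (g 0) (r / 2), e.symm z ∈ ball (0 : ℂ) r := fun z hz =>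
    e.map_target (htgt hz)
  have hr' : ∀ z ∈ ball (g 0) (r / 2), g (e.symm z) = z := fun z hz => e.right_inv (htgt hz)
  refine ⟨e.symm, fun z hz => ?_, fun z hz => ⟨hsrc z hz, hr' z hz⟩⟩
  have hne : deriv g (e.symm z) ≠ 0 := by
    intro h
    have := hd _ (hsrc z hz)
    rw [h] at this
    norm_num at this
  exact (e.hasDerivAt_symm (htgt hz) hne (hg.differentiableAt
    (isOpen_ball.mem_nhds (hsrc z hz))).hasDerivAt).differentiableAt.differentiableWithinAt

/-- Normalized orbits of maps close to `z ↦ μ z` converge, holomorphically in parameters. -/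
theorem exists_limit_orbit_div_pow {U : Set ℂ} (hU : IsOpen U) {μ : ℂ} (h1 : 1 / 2 ≤ ‖μ‖)
    (h2 : ‖μ‖ < 1) {κ r : ℝ} (hκ : 0 ≤ κ) (hκr : κ * r ≤ 1 / 100) (w : ℕ → ℂ → ℂ)
    (hw : ∀ n, DifferentiableOn ℂ (w n) U) (h0 : ∀ t ∈ U, ‖w 0 t‖ ≤ r)
    (hs : ∀ n, ∀ t ∈ U, ‖w n t‖ ≤ r →
      ‖w (n + 1) t - μ * w n t‖ ≤ κ * (1 - ‖μ‖) * ‖w n t‖ ^ 2) :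
    ∃ L : ℂ → ℂ, DifferentiableOn ℂ L U ∧ ∀ t ∈ U,
      Tendsto (fun n => w n t / μ ^ n) atTop (𝓝 (L t)) ∧ ‖L t - w 0 t‖ ≤ 3 * κ * ‖w 0 t‖ ^ 2 := by
  set d := 1 - ‖μ‖ with hd
  have hdpos : 0 < d := by linarith
  have hd2 : d ≤ 1 / 2 := by linarith
  have hμ : ‖μ‖ = 1 - d := by linarith
  have hμ0 : μ ≠ 0 := norm_pos_iff.mp (by linarith)
  set q := 1 - 99 / 100 * d with hq
  set p := 1 - 97 / 100 * d with hp
  have hq0 : 0 ≤ q := by linarith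
  have hq1 : q ≤ 1 := by linarith
  have hp0 : 0 ≤ p := by linarith
  have hp1 : p < 1 := by linarith
  have hqp : q ^ 2 ≤ p * ‖μ‖ := by
    rw [hμ, hq, hp]
    nlinarith [mul_nonneg hdpos.le (sub_nonneg.2 hd2)]
  have hb : ∀ n, ∀ t ∈ U, ‖w n t‖ ≤ q ^ n * ‖w 0 t‖ := by
    intro n t ht
    induction n with
    | zero => simp
    | succ n ih =>
      have hle : ‖w n t‖ ≤ r := ih.trans <| by
        have := h0 t ht
        have h3 : q ^ n ≤ 1 := pow_le_one₀ hq0 hq1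
        nlinarith [norm_nonneg (w 0 t)]
      have h4 := hs n t ht hle
      have h5 : ‖w (n + 1) t‖ ≤ ‖w (n + 1) t - μ * w n t‖ + ‖μ‖ * ‖w n t‖ := by
        rw [← norm_mul]
        simpa using norm_add_le (w (n + 1) t - μ * w n t) (μ * w n t)
      have h6 : κ * ‖w n t‖ ≤ 1 / 100 := (mul_le_mul_of_nonneg_left hle hκ).trans hκr
      have h7 : κ * d * ‖w n t‖ ^ 2 ≤ 1 / 100 * d * ‖w n t‖ := by
        have := mul_le_mul_of_nonneg_right h6 (mul_nonneg hdpos.le (norm_nonneg (w n t)))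
        nlinarith
      calc ‖w (n + 1) t‖ ≤ q * ‖w n t‖ := by rw [hq]; rw [hμ] at h5; nlinarith
        _ ≤ q * (q ^ n * ‖w 0 t‖) := by gcongr
        _ = _ := by ring
  have hle : ∀ n, ∀ t ∈ U, ‖w n t‖ ≤ r := fun n t ht => (hb n t ht).trans <| by
    have := h0 t ht
    have h3 : q ^ n ≤ 1 := pow_le_one₀ hq0 hq1
    nlinarith [norm_nonneg (w 0 t)]
  set F : ℕ → ℂ → ℂ := fun n t => w (n + 1) t / μ ^ (n + 1) - w n t / μ ^ n with hF
  have hFb : ∀ n, ∀ t ∈ U, ‖F n t‖ ≤ 2 * κ * d * ‖w 0 t‖ ^ 2 * p ^ n := by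
    intro n t ht
    have e1 : F n t = (w (n + 1) t - μ * w n t) / μ ^ (n + 1) := by
      rw [hF]; simp only [pow_succ]; field_simp
    rw [e1, norm_div, norm_pow, div_le_iff₀ (by positivity)]
    have h3 := hb n t ht
    have h4 : ‖w n t‖ ^ 2 ≤ (p * ‖μ‖) ^ n * ‖w 0 t‖ ^ 2 := by
      calc ‖w n t‖ ^ 2 ≤ (q ^ n * ‖w 0 t‖) ^ 2 := by gcongr
        _ = (q ^ 2) ^ n * ‖w 0 t‖ ^ 2 := by
          rw [mul_pow, ← pow_mul, ← pow_mul, mul_comm n 2]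
        _ ≤ _ := by gcongr
    calc _ ≤ κ * d * ‖w n t‖ ^ 2 := hs n t ht (hle n t ht)
      _ ≤ κ * d * ((p * ‖μ‖) ^ n * ‖w 0 t‖ ^ 2) := by gcongr
      _ = (κ * d * (p * ‖μ‖) ^ n * ‖w 0 t‖ ^ 2) * 1 := by ring
      _ ≤ (κ * d * (p * ‖μ‖) ^ n * ‖w 0 t‖ ^ 2) * (2 * ‖μ‖) := by
          gcongr; linarith
      _ = _ := by rw [mul_pow, pow_succ]; ring
  have hgeo : HasSum (fun n => p ^ n) (1 - p)⁻¹ := hasSum_geometric_of_lt_one hp0 hp1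
  have hFr : ∀ n, ∀ t ∈ U, ‖F n t‖ ≤ 2 * κ * d * r ^ 2 * p ^ n := fun n t ht =>
    (hFb n t ht).trans (by have := h0 t ht; gcongr)
  refine ⟨fun t => w 0 t + ∑' n, F n t, ?_, fun t ht => ⟨?_, ?_⟩⟩
  · refine (hw 0).add (Complex.differentiableOn_tsum_of_summable_norm
      (u := fun n => 2 * κ * d * r ^ 2 * p ^ n) (hgeo.summable.mul_left _) (fun n => ?_) hU hFr)
    exact ((hw (n + 1)).div_const _).sub ((hw n).div_const _)
  · have hsum : Summable (fun n => F n t) :=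
      Summable.of_norm_bounded (hgeo.summable.mul_left _) (fun n => hFr n t ht)
    have := hsum.hasSum.tendsto_sum_nat.const_add (w 0 t)
    refine this.congr fun n => ?_
    rw [hF]
    simp only
    rw [Finset.sum_range_sub (fun n => w n t / μ ^ n)]
    simp
  · rw [add_sub_cancel_left]
    refine (tsum_of_norm_bounded (hgeo.mul_left _) (fun n => hFb n t ht)).trans ?_
    have : (1 - p)⁻¹ = 100 / 97 / d := by rw [hp]; field_simp; ring
    rw [this]
    have e : 2 * κ * d * ‖w 0 t‖ ^ 2 * (100 / 97 / d) = 200 / 97 * (κ * ‖w 0 t‖ ^ 2) := by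
      field_simp; ring
    rw [e]
    nlinarith [mul_nonneg hκ (sq_nonneg ‖w 0 t‖)]

section Coefficients

open Polynomial

theorem coeff_eq_zero_of_eval_eq_pow_mul (m : ℕ) :
    ∀ (P : ℂ[X]) (g : ℂ → ℂ), ContinuousAt g 0 → (∀ᶠ z in 𝓝[≠] (0 : ℂ), P.eval z = z ^ m * g z) →
      ∀ k < m, P.coeff k = 0 := by
  induction m with
  | zero => intro P g _ _ k hk; omega
  | succ m ih =>
    intro P g hg h k hk
    have hP0 : P.coeff 0 = 0 := by
      have t1 : Tendsto (fun z => P.eval z) (𝓝[≠] 0) (𝓝 (P.eval 0)) :=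
        P.continuous.continuousAt.tendsto.mono_left nhdsWithin_le_nhds
      have t2 : Tendsto (fun z => z ^ (m + 1) * g z) (𝓝[≠] 0) (𝓝 ((0 : ℂ) ^ (m + 1) * g 0)) :=
        (((continuous_pow (m + 1)).continuousAt).mul hg).tendsto.mono_left nhdsWithin_le_nhds
      have := tendsto_nhds_unique (t1.congr' h) t2
      rw [coeff_zero_eq_eval_zero, this]; simp
    cases k with
    | zero => exact hP0
    | succ k =>
      rw [← coeff_divX]
      refine ih P.divX g hg ?_ k (by omega)
      filter_upwards [h, self_mem_nhdsWithin] with z hz hz0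
      have hz0 : z ≠ 0 := hz0
      have e := congrArg (Polynomial.eval z) (divX_mul_X_add P)
      rw [hP0] at e
      simp only [map_zero, add_zero, eval_mul, eval_X] at e
      rw [hz] at e
      refine mul_right_cancel₀ hz0 (e.trans ?_)
      ring

/-- A family of germs at `0` agrees modulo `z ^ n` with a polynomial in `z` whose coefficients are
polynomials in the parameter `β i`. -/
def PolyJet {ι : Type*} (β : ι → ℂ) (n : ℕ) (h : ι → ℂ → ℂ) : Prop :=
  ∃ q : ℂ[X][X], ∀ i, ∃ g : ℂ → ℂ, AnalyticAt ℂ g 0 ∧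
    ∀ᶠ z in 𝓝 0, h i z = (q.map (evalRingHom (β i))).eval z + z ^ n * g z

namespace PolyJet

variable {ι : Type*} {β : ι → ℂ} {n : ℕ} {h k : ι → ℂ → ℂ}

theorem of_pow_mul (H : ∀ i, ∃ g : ℂ → ℂ, AnalyticAt ℂ g 0 ∧ ∀ᶠ z in 𝓝 0, h i z = z ^ n * g z) :
    PolyJet β n h :=
  ⟨0, fun i => by simpa using H i⟩

theorem const (c : ℂ) : PolyJet β n (fun _ _ => c) :=
  ⟨C (C c), fun i => ⟨0, analyticAt_const, by simp⟩⟩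

theorem param : PolyJet β n (fun i _ => β i) :=
  ⟨C X, fun i => ⟨0, analyticAt_const, by simp⟩⟩

theorem id_mul (hh : PolyJet β n h) : PolyJet β (n + 1) (fun i z => z * h i z) := by
  obtain ⟨q, hq⟩ := hh
  refine ⟨X * q, fun i => ?_⟩
  obtain ⟨g, hg, hgz⟩ := hq i
  refine ⟨g, hg, ?_⟩
  filter_upwards [hgz] with z hz
  rw [hz]; simp; ring

theorem mono {m : ℕ} (hh : PolyJet β (n + m) h) : PolyJet β n h := by
  obtain ⟨q, hq⟩ := hh
  refine ⟨q, fun i => ?_⟩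
  obtain ⟨g, hg, hgz⟩ := hq i
  refine ⟨fun z => z ^ m * g z, by fun_prop, ?_⟩
  filter_upwards [hgz] with z hz
  rw [hz]; ring

theorem add (hh : PolyJet β n h) (hk : PolyJet β n k) :
    PolyJet β n (fun i z => h i z + k i z) := by
  obtain ⟨q, hq⟩ := hh
  obtain ⟨p, hp⟩ := hk
  refine ⟨q + p, fun i => ?_⟩
  obtain ⟨g, hg, hgz⟩ := hq i
  obtain ⟨f, hf, hfz⟩ := hp i
  refine ⟨fun z => g z + f z, by fun_prop, ?_⟩
  filter_upwards [hgz, hfz] with z hz hz'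
  rw [hz, hz']; simp; ring

theorem mul (hh : PolyJet β n h) (hk : PolyJet β n k) :
    PolyJet β n (fun i z => h i z * k i z) := by
  obtain ⟨q, hq⟩ := hh
  obtain ⟨p, hp⟩ := hk
  refine ⟨q * p, fun i => ?_⟩
  obtain ⟨g, hg, hgz⟩ := hq i
  obtain ⟨f, hf, hfz⟩ := hp i
  refine ⟨fun z => g z * (p.map (evalRingHom (β i))).eval z +
    f z * (q.map (evalRingHom (β i))).eval z + z ^ n * (f z * g z), ?_, ?_⟩
  · have hev (r : ℂ[X]) : AnalyticAt ℂ (fun z => r.eval z) 0 :=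
      r.differentiable.analyticAt 0
    have h1 := hev (p.map (evalRingHom (β i)))
    have h2 := hev (q.map (evalRingHom (β i)))
    fun_prop
  filter_upwards [hgz, hfz] with z hz hz'
  rw [hz, hz', Polynomial.map_mul, eval_mul]; ring

theorem pow (hh : PolyJet β n h) (m : ℕ) : PolyJet β n (fun i z => h i z ^ m) := by
  induction m with
  | zero => simpa using const (β := β) (n := n) 1
  | succ m ih => simpa only [pow_succ] using ih.mul hh

theorem finset_sum (s : Finset ℕ) (H : ℕ → ι → ℂ → ℂ) (hH : ∀ j ∈ s, PolyJet β n (H j)) :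
    PolyJet β n (fun i z => ∑ j ∈ s, H j i z) := by
  induction s using Finset.induction_on with
  | empty => simpa using const (β := β) (n := n) 0
  | insert a s ha ih =>
    simp only [Finset.sum_insert ha]
    exact (hH a (by simp)).add (ih fun j hj => hH j (by simp [hj]))

/-- Composition of a fixed analytic germ with a family vanishing at `0`. -/
theorem comp {E : ℂ → ℂ} (hE : AnalyticAt ℂ E 0) {χ : ι → ℂ → ℂ}
    (hχ : ∀ i, AnalyticAt ℂ (χ i) 0) (hh : PolyJet β n (fun i z => z * χ i z)) :
    PolyJet β n (fun i z => E (z * χ i z)) := by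
  obtain ⟨F, hF, hEF⟩ := hE.exists_eventuallyEq_sum_add_pow_mul n
  have h1 : PolyJet β n (fun i z => ∑ j ∈ Finset.range n,
      iteratedDeriv j E 0 * (j.factorial : ℂ)⁻¹ * (z * χ i z) ^ j) :=
    finset_sum _ _ fun j _ => (const _).mul (hh.pow j)
  have h2 : PolyJet β n (fun i z => (z * χ i z) ^ n * F (z * χ i z)) := by
    refine of_pow_mul fun i => ⟨fun z => χ i z ^ n * F (z * χ i z), ?_, ?_⟩
    · have := hχ i
      have h3 : AnalyticAt ℂ (fun z => F (z * χ i z)) 0 :=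
        AnalyticAt.fun_comp (by simpa using hF) (by fun_prop)
      exact (this.fun_pow n).fun_mul h3
    · exact .of_forall fun z => by ring
  obtain ⟨q, hq⟩ := h1.add h2
  refine ⟨q, fun i => ?_⟩
  obtain ⟨g, hg, hgz⟩ := hq i
  refine ⟨g, hg, ?_⟩
  have ht : Tendsto (fun z => z * χ i z) (𝓝 0) (𝓝 0) := by
    have : ContinuousAt (fun z => z * χ i z) 0 := continuousAt_id.mul (hχ i).continuousAt
    simpa [ContinuousAt] using this
  filter_upwards [hgz, ht.eventually hEF] with z hz hz'
  rw [← hz, hz']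
  congr 1
  refine Finset.sum_congr rfl fun j _ => ?_
  rw [smul_eq_mul]; ring

/-- The coefficients of the polynomial of a jet are the Taylor coefficients. -/
theorem exists_iteratedDeriv (hh : PolyJet β (n + 1) h) (ha : ∀ i, AnalyticAt ℂ (h i) 0) :
    ∃ p : ℂ[X], ∀ i, iteratedDeriv n (h i) 0 = p.eval (β i) := by
  obtain ⟨q, hq⟩ := hh
  refine ⟨C (n.factorial : ℂ) * q.coeff n, fun i => ?_⟩
  obtain ⟨g, hg, hgz⟩ := hq i
  obtain ⟨F, hF, hEF⟩ := (ha i).exists_eventuallyEq_sum_add_pow_mul (n + 1)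
  have := coeff_eq_zero_of_eval_eq_pow_mul (n + 1)
    ((∑ j ∈ Finset.range (n + 1), C (iteratedDeriv j (h i) 0 * (j.factorial : ℂ)⁻¹) * X ^ j) -
      q.map (evalRingHom (β i))) (fun z => g z - F z) (by
        exact (hg.continuousAt.sub hF.continuousAt)) (by
        filter_upwards [nhdsWithin_le_nhds hgz, nhdsWithin_le_nhds hEF] with z h1 h2
        rw [h1] at h2
        have h3 : eval z (∑ j ∈ Finset.range (n + 1),
            C (iteratedDeriv j (h i) 0 * (j.factorial : ℂ)⁻¹) * X ^ j) =
            ∑ j ∈ Finset.range (n + 1), (z ^ j / j.factorial) • iteratedDeriv j (h i) 0 := by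
          rw [eval_finsetSum]
          refine Finset.sum_congr rfl fun j _ => ?_
          simp; ring
        rw [eval_sub, h3]
        rw [smul_eq_mul] at h2
        linear_combination -h2) n (by omega)
  rw [coeff_sub, finsetSum_coeff] at this
  simp only [coeff_C_mul_X_pow, coeff_map, coe_evalRingHom] at this
  rw [Finset.sum_eq_single n (fun j _ hj => by simp [Ne.symm hj]) (by simp)] at this
  simp only [if_true] at this
  have hn : (n.factorial : ℂ) ≠ 0 := by exact_mod_cast n.factorial_ne_zero
  rw [eval_mul, eval_C, ← sub_eq_zero.mp this]
  field_simp

end PolyJet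

end Coefficients

/-- An analytic germ vanishing at `0` is `z` times an analytic germ. -/
theorem exists_eventuallyEq_mul_of_zero {f : ℂ → ℂ} (hf : AnalyticAt ℂ f 0) (h0 : f 0 = 0) :
    ∃ g : ℂ → ℂ, AnalyticAt ℂ g 0 ∧ g 0 = deriv f 0 ∧ ∀ᶠ z in 𝓝 0, f z = z * g z := by
  obtain ⟨g, hg, hfg⟩ := hf.exists_eventuallyEq_sum_add_pow_mul 1
  have hfg' : ∀ᶠ z in 𝓝 0, f z = z * g z := by
    filter_upwards [hfg] with z hz
    simpa [h0] using hz
  refine ⟨g, hg, ?_, hfg'⟩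
  have : f =ᶠ[𝓝 0] fun z => z * g z := hfg'
  rw [this.deriv_eq]
  have h := ((hasDerivAt_id (0 : ℂ)).mul hg.differentiableAt.hasDerivAt).deriv
  simp only [id, one_mul, zero_mul, add_zero] at h
  exact h.symm

/-- The Taylor coefficients of the normalized inverse linearization of
`w ↦ μ w + b w ^ 2 + e w` are polynomials in `b`. -/
theorem exists_polynomial_iteratedDeriv {μ : ℂ} (h0 : μ ≠ 0) (h1 : ‖μ‖ < 1) {e : ℂ → ℂ}
    (he : AnalyticAt ℂ e 0) (he0 : e 0 = 0) (he1 : deriv e 0 = 0) :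
    ∃ p : ℕ → Polynomial ℂ, ∀ (b : ℂ) (ψ : ℂ → ℂ), AnalyticAt ℂ ψ 0 → ψ 0 = 0 → deriv ψ 0 = 1 →
      (∀ᶠ z in 𝓝 0, μ * ψ z + b * ψ z ^ 2 + e (ψ z) = ψ (μ * z)) →
      ∀ n, iteratedDeriv n ψ 0 = (p n).eval b := by
  let ι := {x : ℂ × (ℂ → ℂ) // AnalyticAt ℂ x.2 0 ∧ x.2 0 = 0 ∧ deriv x.2 0 = 1 ∧
    ∀ᶠ z in 𝓝 0, μ * x.2 z + x.1 * x.2 z ^ 2 + e (x.2 z) = x.2 (μ * z)}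
  let β : ι → ℂ := fun i => i.1.1
  let Ψ : ι → ℂ → ℂ := fun i => i.1.2
  obtain ⟨e₁, he₁, he₁0, hee₁⟩ := exists_eventuallyEq_mul_of_zero he he0
  obtain ⟨E, hE, -, heE⟩ := exists_eventuallyEq_mul_of_zero he₁ (he₁0.trans he1)
  have hex : ∀ i : ι, ∃ χ : ℂ → ℂ, AnalyticAt ℂ χ 0 ∧ χ 0 = 1 ∧ ∀ᶠ z in 𝓝 0, Ψ i z = z * χ z := by
    intro i
    obtain ⟨χ, h2, h3, h4⟩ := exists_eventuallyEq_mul_of_zero i.2.1 i.2.2.1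
    exact ⟨χ, h2, h3.trans i.2.2.2.1, h4⟩
  choose χ hχ hχ0 hΨχ using hex
  have hμt : Tendsto (fun z : ℂ => μ * z) (𝓝 0) (𝓝 0) := by
    have : ContinuousAt (fun z : ℂ => μ * z) 0 := by fun_prop
    simpa [ContinuousAt] using this
  have hχt : ∀ i, Tendsto (fun z => z * χ i z) (𝓝 0) (𝓝 0) := by
    intro i
    have : ContinuousAt (fun z => z * χ i z) 0 := continuousAt_id.mul (hχ i).continuousAt
    simpa [ContinuousAt] using this
  have hfun : ∀ i, ∀ᶠ z in 𝓝 0, μ * χ i (μ * z) - μ * χ i z =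
      z * (χ i z ^ 2 * (β i + E (z * χ i z))) := by
    intro i
    filter_upwards [i.2.2.2.2, hΨχ i, hμt.eventually (hΨχ i), (hχt i).eventually hee₁,
      (hχt i).eventually heE] with z a1 a2 a3 a4 a5
    by_cases hz : z = 0
    · subst hz; simp
    · change μ * Ψ i z + β i * Ψ i z ^ 2 + e (Ψ i z) = Ψ i (μ * z) at a1
      rw [a2, a3, a4, a5] at a1
      apply mul_left_cancel₀ hz
      linear_combination -a1
  have hne : ∀ k : ℕ, k ≠ 0 → μ ^ (k + 1) - μ ≠ 0 := by
    intro k hk h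
    have h2 : μ * (μ ^ k - 1) = 0 := by rw [← h]; ring
    have h3 : μ ^ k = 1 := by
      rcases mul_eq_zero.mp h2 with h3 | h3
      · exact absurd h3 h0
      · exact sub_eq_zero.mp h3
    have h4 : ‖μ‖ ^ k < 1 := pow_lt_one₀ (norm_nonneg _) h1 hk
    rw [← norm_pow, h3, norm_one] at h4
    exact lt_irrefl _ h4
  have hjet : ∀ n, PolyJet β (n + 1) χ := by
    intro n
    induction n with
    | zero =>
      refine ⟨1, fun i => ?_⟩
      obtain ⟨g, hg, hgz⟩ := (hχ i).exists_eventuallyEq_sum_add_pow_mul 1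
      refine ⟨g, hg, ?_⟩
      filter_upwards [hgz] with z hz
      rw [hz]; simp [hχ0 i]
    | succ n ih =>
      have hz := ih.id_mul
      obtain ⟨q, hq⟩ := ((ih.pow 2).mul (PolyJet.param.add
        (PolyJet.comp hE hχ (PolyJet.mono (m := 1) hz)))).id_mul
      refine ⟨∑ k ∈ Finset.range (n + 2), (if k = 0 then 1 else
        Polynomial.C (Polynomial.C ((μ ^ (k + 1) - μ)⁻¹) * q.coeff k)) * Polynomial.X ^ k,
        fun i => ?_⟩
      obtain ⟨g, hg, hgz⟩ := hq i
      obtain ⟨F, hF, hFz⟩ := (hχ i).exists_eventuallyEq_sum_add_pow_mul (n + 2)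
      refine ⟨F, hF, ?_⟩
      have hco := coeff_eq_zero_of_eval_eq_pow_mul (n + 2)
        ((∑ j ∈ Finset.range (n + 2), Polynomial.C ((μ ^ (j + 1) - μ) *
          (iteratedDeriv j (χ i) 0 * (j.factorial : ℂ)⁻¹)) * Polynomial.X ^ j) -
          q.map (Polynomial.evalRingHom (β i)))
        (fun z => g z - (μ * (μ ^ (n + 2) * F (μ * z)) - μ * F z))
        (by
          have h3 : ContinuousAt (fun z => F (μ * z)) 0 :=
            ContinuousAt.comp' (by simpa using hF.continuousAt) (by fun_prop)
          have h4 := hF.continuousAt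
          exact hg.continuousAt.sub ((continuousAt_const.mul (continuousAt_const.mul h3)).sub
            (continuousAt_const.mul h4)))
        (by
          filter_upwards [nhdsWithin_le_nhds hgz, nhdsWithin_le_nhds hFz,
            nhdsWithin_le_nhds (hμt.eventually hFz), nhdsWithin_le_nhds (hfun i)] with z a1 a2 a3 a4
          rw [← a4, a2, a3] at a1
          rw [Polynomial.eval_sub, Polynomial.eval_finsetSum]
          have h3 : (∑ j ∈ Finset.range (n + 2), Polynomial.eval z
              (Polynomial.C ((μ ^ (j + 1) - μ) *
                (iteratedDeriv j (χ i) 0 * (j.factorial : ℂ)⁻¹)) * Polynomial.X ^ j)) =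
              μ * (∑ j ∈ Finset.range (n + 2), ((μ * z) ^ j / j.factorial) •
                iteratedDeriv j (χ i) 0) -
              μ * (∑ j ∈ Finset.range (n + 2), (z ^ j / j.factorial) •
                iteratedDeriv j (χ i) 0) := by
            rw [Finset.mul_sum, Finset.mul_sum, ← Finset.sum_sub_distrib]
            refine Finset.sum_congr rfl fun j _ => ?_
            simp [mul_pow]; ring
          rw [h3]
          simp only [smul_eq_mul] at a1 ⊢
          linear_combination a1)
      filter_upwards [hFz] with z hz
      rw [hz, Polynomial.map_sum, Polynomial.eval_finsetSum, smul_eq_mul]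
      congr 1
      refine Finset.sum_congr rfl fun k hk => ?_
      by_cases hk0 : k = 0
      · subst hk0; simp [hχ0 i]
      have := hco k (Finset.mem_range.mp hk)
      rw [Polynomial.coeff_sub, Polynomial.finsetSum_coeff] at this
      simp only [Polynomial.coeff_C_mul_X_pow, Polynomial.coeff_map,
        Polynomial.coe_evalRingHom] at this
      rw [Finset.sum_eq_single k (fun j _ hj => by simp [Ne.symm hj])
        (fun h => absurd hk h)] at this
      simp only [if_true] at this
      have h5 := hne k hk0
      simp only [hk0, if_false, Polynomial.map_mul, Polynomial.map_pow, Polynomial.map_X,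
        Polynomial.map_C, Polynomial.eval_mul, Polynomial.eval_C, Polynomial.eval_pow,
        Polynomial.eval_X, Polynomial.coe_evalRingHom]
      rw [← sub_eq_zero.mp this, smul_eq_mul]
      field_simp
  have hΨ : ∀ n, PolyJet β n Ψ := by
    intro n
    obtain ⟨q, hq⟩ := PolyJet.mono (m := 2) (hjet n).id_mul
    refine ⟨q, fun i => ?_⟩
    obtain ⟨g, hg, hgz⟩ := hq i
    refine ⟨g, hg, ?_⟩
    filter_upwards [hgz, hΨχ i] with z a1 a2
    rw [a2, a1]
  choose p hp using fun n => (hΨ (n + 1)).exists_iteratedDeriv fun i => i.2.1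
  exact ⟨p, fun b ψ a1 a2 a3 a4 n => hp n ⟨(b, ψ), a1, a2, a3, a4⟩⟩

/-- `ψ` is a normalized inverse linearization of `F` on the disc of radius `r`, with values in the
disc of radius `R`. -/
structure IsInvLin (F ψ : ℂ → ℂ) (μ : ℂ) (r R : ℝ) : Prop where
  diff : DifferentiableOn ℂ ψ (ball 0 r)
  maps : ∀ z ∈ ball (0 : ℂ) r, ψ z ∈ ball (0 : ℂ) R
  zero : ψ 0 = 0
  deriv_zero : deriv ψ 0 = 1
  eq : ∀ z ∈ ball (0 : ℂ) r, F (ψ z) = ψ (μ * z)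

theorem IsInvLin.mono {F ψ : ℂ → ℂ} {μ : ℂ} {r R r' R' : ℝ} (h : IsInvLin F ψ μ r R) (hr : r' ≤ r)
    (hR : R ≤ R') : IsInvLin F ψ μ r' R' where
  diff := h.diff.mono (ball_subset_ball hr)
  maps z hz := ball_subset_ball hR (h.maps z (ball_subset_ball hr hz))
  zero := h.zero
  deriv_zero := h.deriv_zero
  eq z hz := h.eq z (ball_subset_ball hr hz)

theorem IsInvLin.analyticAt {F ψ : ℂ → ℂ} {μ : ℂ} {r R : ℝ} (h : IsInvLin F ψ μ r R) (hr : 0 < r) :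
    AnalyticAt ℂ ψ 0 :=
  h.diff.analyticAt (ball_mem_nhds 0 hr)

theorem hasDerivAt_of_norm_sub_le_sq {f : ℂ → ℂ} {a : ℂ} {C : ℝ}
    (h : ∀ᶠ w in 𝓝 0, ‖f w - a * w‖ ≤ C * ‖w‖ ^ 2) : f 0 = 0 ∧ HasDerivAt f a 0 := by
  have h0 : f 0 = 0 := by simpa using h.self_of_nhds
  refine ⟨h0, ?_⟩
  rw [hasDerivAt_iff_isLittleO_nhds_zero]
  have : (fun w : ℂ => ‖w‖ ^ 2) =o[𝓝 0] (fun w : ℂ => w) := by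
    have := (Asymptotics.isLittleO_pow_id (𝕜 := ℂ) (n := 2) (by norm_num))
    exact (this.norm_left).congr_left (fun w => by simp)
  refine (Asymptotics.IsBigO.of_bound C ?_).trans_isLittleO this
  filter_upwards [h] with w hw
  simpa [h0, mul_comm w a] using hw

/-- **Koenigs' theorem**, with a disc of linearization that depends only on `κ`. -/
theorem exists_isInvLin {G : ℂ → ℂ} {μ : ℂ} {κ r : ℝ} (hr : 0 < r) (h1 : 1 / 2 ≤ ‖μ‖)
    (h2 : ‖μ‖ < 1) (hκ : 0 ≤ κ) (hκr : κ * r ≤ 1 / 100) (hG : DifferentiableOn ℂ G (ball 0 r))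
    (hb : ∀ w ∈ ball (0 : ℂ) r, ‖G w - μ * w‖ ≤ κ * (1 - ‖μ‖) * ‖w‖ ^ 2) :
    ∃ ψ, IsInvLin G ψ μ (r / 4) (r / 2) := by
  have hlt : ∀ w ∈ ball (0 : ℂ) r, ‖G w‖ ≤ ‖w‖ := by
    intro w hw
    have hw' := mem_ball_zero_iff.mp hw
    have h3 := hb w hw
    have h4 : ‖G w‖ ≤ ‖G w - μ * w‖ + ‖μ‖ * ‖w‖ := by
      rw [← norm_mul]; simpa using norm_add_le (G w - μ * w) (μ * w)
    have h5 : κ * ‖w‖ ≤ 1 / 100 := (mul_le_mul_of_nonneg_left hw'.le hκ).trans hκr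
    have h6 := mul_le_mul_of_nonneg_right h5
      (mul_nonneg (sub_nonneg.2 h2.le) (norm_nonneg w))
    nlinarith [mul_nonneg (sub_nonneg.2 h2.le) (norm_nonneg w)]
  have hmaps : MapsTo G (ball 0 r) (ball 0 r) := fun w hw =>
    mem_ball_zero_iff.mpr ((hlt w hw).trans_lt (mem_ball_zero_iff.mp hw))
  have hμ0 : μ ≠ 0 := norm_pos_iff.mp (by linarith)
  obtain ⟨L, hL, hLt⟩ := exists_limit_orbit_div_pow isOpen_ball h1 h2 hκ hκr (fun n => G^[n])
    (fun n => hG.iterate hmaps n) (fun t ht => (mem_ball_zero_iff.mp ht).le)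
    (fun n t ht _ => by
      simp only [Function.iterate_succ_apply']
      exact hb _ (hmaps.iterate n ht))
  simp only [Function.iterate_zero, id] at hLt
  have hLG : ∀ w ∈ ball (0 : ℂ) r, L (G w) = μ * L w := by
    intro w hw
    have t1 := ((hLt w hw).1.comp (tendsto_add_atTop_nat 1)).const_mul μ
    refine tendsto_nhds_unique (hLt _ (hmaps hw)).1 (t1.congr fun n => ?_)
    simp only [Function.comp, Function.iterate_succ_apply, pow_succ]
    field_simp
  obtain ⟨hL0, hL1⟩ := hasDerivAt_of_norm_sub_le_sq (f := L) (a := 1) (C := 3 * κ) (by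
    filter_upwards [ball_mem_nhds (0 : ℂ) hr] with w hw
    simpa using (hLt w hw).2)
  have hsub : ball (0 : ℂ) (r / 2) ⊆ ball 0 r := ball_subset_ball (by linarith)
  have hLd : ∀ w ∈ ball (0 : ℂ) (r / 2), ‖deriv L w - 1‖ ≤ 1 / 2 := by
    intro w hw
    have hwd := hL.differentiableAt (isOpen_ball.mem_nhds (hsub hw))
    have e1 : deriv L w - 1 = deriv (fun z => L z - z) w := by
      rw [deriv_fun_sub hwd differentiableAt_fun_id]; simp
    have hcb : closedBall w (r / 2) ⊆ ball 0 r := by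
      apply closedBall_subset_ball'
      rw [mem_ball] at hw; linarith
    rw [e1]
    refine (Complex.norm_deriv_le_of_forall_mem_sphere_norm_le (C := r / 4) (half_pos hr)
      ?_ ?_).trans ?_
    · apply DifferentiableOn.diffContOnCl_ball (U := ball 0 r) _ hcb
      exact hL.sub differentiableOn_id
    · intro z hz
      have hz' := hcb (sphere_subset_closedBall hz)
      have hz2 := mem_ball_zero_iff.mp hz'
      refine (hLt z hz').2.trans ?_
      have h5 : κ * ‖z‖ ≤ 1 / 100 := (mul_le_mul_of_nonneg_left hz2.le hκ).trans hκr
      nlinarith [norm_nonneg z]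
    · apply le_of_eq; field_simp; norm_num
  obtain ⟨hinj, ψ, hψ, hψL⟩ := exists_inverse_of_deriv_near_one (hL.mono hsub) hLd
  rw [hL0, show r / 2 / 2 = r / 4 by ring] at hψ hψL
  have h00 : (0 : ℂ) ∈ ball (0 : ℂ) (r / 4) := mem_ball_self (by linarith)
  have hψ0 : ψ 0 = 0 :=
    hinj (hψL 0 h00).1 (mem_ball_self (half_pos hr)) ((hψL 0 h00).2.trans hL0.symm)
  refine ⟨ψ, hψ, fun z hz => (hψL z hz).1, hψ0, ?_, ?_⟩
  · have d1 := (hψ.differentiableAt (isOpen_ball.mem_nhds h00)).hasDerivAt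
    have d2 : HasDerivAt L 1 (ψ 0) := by rw [hψ0]; exact hL1
    have d3 := d2.comp 0 d1
    have d4 : HasDerivAt (L ∘ ψ) 1 0 := (hasDerivAt_id (0 : ℂ)).congr_of_eventuallyEq (by
      filter_upwards [isOpen_ball.mem_nhds h00] with z hz using (hψL z hz).2)
    simpa using d3.unique d4
  · intro z hz
    have hz' := mem_ball_zero_iff.mp hz
    have hμz : μ * z ∈ ball (0 : ℂ) (r / 4) := by
      rw [mem_ball_zero_iff, norm_mul]
      nlinarith [norm_nonneg z]
    have hw := hsub (hψL z hz).1
    refine hinj (mem_ball_zero_iff.mpr ((hlt _ hw).trans_lt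
      (mem_ball_zero_iff.mp (hψL z hz).1))) (hψL _ hμz).1 ?_
    rw [hLG _ hw, (hψL z hz).2, (hψL _ hμz).2]

/-- Normalized inverse linearizations are unique. -/
theorem IsInvLin.eqOn {F ψ₁ ψ₂ : ℂ → ℂ} {μ : ℂ} {r r' R R' : ℝ} (h0 : μ ≠ 0) (h1 : ‖μ‖ < 1)
    (hF : AnalyticAt ℂ F 0) (hF0 : F 0 = 0) (hF1 : HasDerivAt F μ 0) (hr : 0 < r)
    (hrr' : r ≤ r') (hψ₁ : IsInvLin F ψ₁ μ r R) (hψ₂ : IsInvLin F ψ₂ μ r' R') :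
    EqOn ψ₁ ψ₂ (ball 0 r) := by
  replace hψ₂ := hψ₂.mono hrr' le_rfl
  have hd : HasDerivAt (fun w => F w - μ * w) 0 0 := by
    simpa using hF1.fun_sub ((hasDerivAt_id (0 : ℂ)).const_mul μ)
  obtain ⟨p, hp⟩ := exists_polynomial_iteratedDeriv h0 h1 (e := fun w => F w - μ * w)
    (by fun_prop) (by simp [hF0]) hd.deriv
  have key : ∀ {ψ : ℂ → ℂ} {R : ℝ}, IsInvLin F ψ μ r R →
      ∀ n, iteratedDeriv n ψ 0 = (p n).eval 0 := by
    intro ψ R hψ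
    refine hp 0 ψ (hψ.analyticAt hr) hψ.zero hψ.deriv_zero ?_
    filter_upwards [ball_mem_nhds (0 : ℂ) hr] with z hz
    rw [← hψ.eq z hz]; ring
  intro z hz
  rw [← Complex.taylorSeries_eq_on_ball' hz hψ₁.diff,
    ← Complex.taylorSeries_eq_on_ball' hz hψ₂.diff]
  simp only [key hψ₁, key hψ₂]

theorem exists_norm_sub_le_sq {F : ℂ → ℂ} {μ : ℂ} (hF : AnalyticAt ℂ F 0) (h0 : F 0 = 0)
    (h1 : deriv F 0 = μ) : ∃ K > 0, ∃ r > 0, DifferentiableOn ℂ F (ball 0 r) ∧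
      ∀ w ∈ ball (0 : ℂ) r, ‖F w - μ * w‖ ≤ K * ‖w‖ ^ 2 := by
  obtain ⟨F₁, hF₁, hF₁0, hFF₁⟩ := exists_eventuallyEq_mul_of_zero hF h0
  obtain ⟨E, hE, -, hFE⟩ := exists_eventuallyEq_mul_of_zero
    (f := fun w => F₁ w - μ) (by fun_prop) (by simp [hF₁0, h1])
  have hb : ∀ᶠ w in 𝓝 (0 : ℂ), ‖E w‖ < ‖E 0‖ + 1 :=
    hE.continuousAt.norm.eventually_lt_const (lt_add_one _)
  obtain ⟨r, hr, hrr⟩ := Metric.eventually_nhds_iff_ball.mp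
    ((hF.eventually_analyticAt.and hb).and (hFF₁.and hFE))
  refine ⟨‖E 0‖ + 1, by positivity, r, hr,
    fun w hw => (hrr w hw).1.1.differentiableAt.differentiableWithinAt, fun w hw => ?_⟩
  obtain ⟨⟨-, h2⟩, h3, h4⟩ := hrr w hw
  have h5 : F w - μ * w = E w * w ^ 2 := by
    rw [h3]; linear_combination w * h4
  rw [h5, norm_mul, norm_pow]
  gcongr

theorem exists_isInvLin_of_analyticAt {F : ℂ → ℂ} {μ : ℂ} (h1 : 1 / 2 ≤ ‖μ‖) (h2 : ‖μ‖ < 1)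
    (hF : AnalyticAt ℂ F 0) (hF0 : F 0 = 0) (hF1 : deriv F 0 = μ) {R : ℝ} (hR : 0 < R) :
    ∃ r > 0, ∃ ψ, IsInvLin F ψ μ r R := by
  obtain ⟨K, hK, r, hr, hd, hb⟩ := exists_norm_sub_le_sq hF hF0 hF1
  have h3 : 0 < 1 - ‖μ‖ := sub_pos.2 h2
  set κ := K / (1 - ‖μ‖) with hκ
  have hκ0 : 0 < κ := div_pos hK h3
  set r₁ := min (min r R) (1 / (100 * κ)) with hr₁
  have hr₁0 : 0 < r₁ := by positivity
  have hr₁r : r₁ ≤ r := (min_le_left _ _).trans (min_le_left _ _)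
  have hr₁R : r₁ ≤ R := (min_le_left _ _).trans (min_le_right _ _)
  obtain ⟨ψ, hψ⟩ := exists_isInvLin (G := F) hr₁0 h1 h2 hκ0.le
    (by
      calc κ * r₁ ≤ κ * (1 / (100 * κ)) := by gcongr; exact min_le_right _ _
        _ = 1 / 100 := by field_simp)
    (hd.mono (ball_subset_ball hr₁r))
    (fun w hw => by
      have := hb w (ball_subset_ball hr₁r hw)
      rwa [hκ, div_mul_cancel₀ _ h3.ne'])
  exact ⟨r₁ / 4, by positivity, ψ, hψ.mono le_rfl (by linarith)⟩

/-- `G` is a holomorphic perturbation of `w ↦ μ (w - w ^ 2 / 2)` of size `ε` on a large disc, with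
the same multiplier at `0` and the same critical point `1`. -/
structure IsNearQuadratic (G : ℂ → ℂ) (μ : ℂ) (ε : ℝ) : Prop where
  diff : DifferentiableOn ℂ G (ball 0 100)
  zero : G 0 = 0
  deriv_zero : deriv G 0 = μ
  deriv_one : deriv G 1 = 0
  bound : ∀ w ∈ ball (0 : ℂ) 100, ‖G w - μ * (w - w ^ 2 / 2)‖ ≤ ε

theorem IsNearQuadratic.analyticAt {G : ℂ → ℂ} {μ : ℂ} {ε : ℝ} (h : IsNearQuadratic G μ ε) :
    AnalyticAt ℂ G 0 :=
  h.diff.analyticAt (ball_mem_nhds 0 (by norm_num))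

/-- `G` is a quadratic polynomial in an almost linear coordinate vanishing at the critical
point. -/
theorem IsNearQuadratic.exists_sq_form {G : ℂ → ℂ} {μ : ℂ} (hG : IsNearQuadratic G μ 2)
    (h1 : 1 / 2 ≤ ‖μ‖) :
    ∃ g : ℂ → ℂ, DifferentiableOn ℂ g (ball 0 40) ∧
      (∀ w ∈ ball (0 : ℂ) 40, ‖deriv g w - 1‖ ≤ 1 / 2) ∧
      g 1 = 0 ∧ ‖g 0 + 1‖ ≤ 1 / 10 ∧ ∀ w ∈ ball (0 : ℂ) 40, G w = G 1 - μ / 2 * g w ^ 2 := by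
  have hμ0 : μ ≠ 0 := norm_pos_iff.mp (by linarith)
  set η : ℂ → ℂ := fun w => G w - μ * (w - w ^ 2 / 2) with hη
  have hηd : DifferentiableOn ℂ η (ball 0 100) := by
    have := hG.diff
    fun_prop
  have h1mem : ball (0 : ℂ) 100 ∈ 𝓝 (1 : ℂ) := isOpen_ball.mem_nhds (by simp)
  have hη1 : deriv η 1 = 0 := by
    have a1 := (hG.diff.differentiableAt h1mem).hasDerivAt
    rw [hG.deriv_one] at a1
    have a2 := ((hasDerivAt_id (1 : ℂ)).fun_sub
      (((hasDerivAt_id (1 : ℂ)).fun_pow 2).div_const 2)).const_mul μ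
    have a3 := (a1.fun_sub a2).deriv
    simpa using a3
  set κ := dslope (dslope η 1) 1 with hκ
  have hκd : DifferentiableOn ℂ κ (ball 0 100) := by
    rw [hκ, Complex.differentiableOn_dslope h1mem, Complex.differentiableOn_dslope h1mem]
    exact hηd
  have hηκ : ∀ w, η w - η 1 = (w - 1) ^ 2 * κ w := by
    intro w
    have a1 := sub_smul_dslope η 1 w
    have a2 := sub_smul_dslope (dslope η 1) 1 w
    rw [dslope_same, hη1, sub_zero] at a2
    rw [← a1, ← a2, smul_eq_mul, smul_eq_mul, hκ]; ring
  have hcb : closedBall (1 : ℂ) 90 ⊆ ball 0 100 :=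
    closedBall_subset_ball' (by simp; norm_num)
  have hκb : ∀ w ∈ closedBall (1 : ℂ) 90, ‖κ w‖ ≤ 4 / 8100 := by
    intro w hw
    refine Complex.norm_le_of_forall_mem_frontier_norm_le (U := ball (1 : ℂ) 90) isBounded_ball
      (hκd.diffContOnCl_ball hcb) ?_ (by rwa [closure_ball _ (by norm_num)])
    intro z hz
    rw [frontier_ball _ (by norm_num)] at hz
    have hz' : ‖z - 1‖ = 90 := by simpa [dist_eq_norm] using hz
    have a1 := hηκ z
    have a2 : ‖η z - η 1‖ ≤ 2 + 2 :=
      (norm_sub_le _ _).trans (add_le_add (hG.bound z (hcb (sphere_subset_closedBall hz)))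
        (hG.bound 1 (by simp)))
    rw [a1, norm_mul, norm_pow, hz'] at a2
    linarith
  have hsub : ball (0 : ℂ) 89 ⊆ closedBall 1 90 := by
    refine ball_subset_closedBall.trans (closedBall_subset_closedBall' ?_)
    simp; norm_num
  set u : ℂ → ℂ := fun w => 1 - 2 * κ w / μ with hu
  have hub : ∀ w ∈ ball (0 : ℂ) 89, ‖1 - u w‖ ≤ 1 / 500 := by
    intro w hw
    have a1 := hκb w (hsub hw)
    have a2 : 1 - u w = 2 * κ w / μ := by simp [hu]
    rw [a2, norm_div, norm_mul, div_le_iff₀ (by linarith)]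
    simp only [Complex.norm_ofNat]
    linarith
  have hud : DifferentiableOn ℂ u (ball 0 89) := by
    have := hκd.mono (ball_subset_ball (show (89 : ℝ) ≤ 100 by norm_num))
    fun_prop
  have hus : ∀ w ∈ ball (0 : ℂ) 89, u w ∈ Complex.slitPlane := by
    intro w hw
    left
    have a1 := (Complex.abs_re_le_norm (1 - u w)).trans (hub w hw)
    rw [Complex.sub_re, Complex.one_re, abs_le] at a1
    linarith
  set m : ℂ → ℂ := fun w => Complex.exp (Complex.log (u w) / 2) with hm
  have hmd : DifferentiableOn ℂ m (ball 0 89) := ((hud.clog hus).div_const 2).cexp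
  have hm2 : ∀ w ∈ ball (0 : ℂ) 89, m w ^ 2 = u w := by
    intro w hw
    rw [hm, ← Complex.exp_nat_mul]
    have : ((2 : ℕ) : ℂ) * (Complex.log (u w) / 2) = Complex.log (u w) := by push_cast; ring
    rw [this, Complex.exp_log (Complex.slitPlane_ne_zero (hus w hw))]
  have hmb : ∀ w ∈ ball (0 : ℂ) 89, ‖m w - 1‖ ≤ 1 / 500 := by
    intro w hw
    have a1 : 0 ≤ (m w).re := by
      rw [hm, Complex.exp_re]
      refine mul_nonneg (Real.exp_pos _).le (Real.cos_nonneg_of_mem_Icc ?_)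
      have b1 := Complex.neg_pi_lt_log_im (u w)
      have b2 := Complex.log_im_le_pi (u w)
      have b3 : (Complex.log (u w) / 2).im = (Complex.log (u w)).im / 2 := by
        simp
      rw [b3]
      constructor <;> linarith
    have a2 : 1 ≤ ‖m w + 1‖ := by
      have := Complex.abs_re_le_norm (m w + 1)
      rw [Complex.add_re, Complex.one_re, abs_of_nonneg (by linarith)] at this
      linarith
    have a3 : (m w - 1) * (m w + 1) = -(1 - u w) := by
      rw [← hm2 w hw]; ring
    have a4 : ‖m w - 1‖ * ‖m w + 1‖ ≤ 1 / 500 := by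
      rw [← norm_mul, a3, norm_neg]; exact hub w hw
    nlinarith [norm_nonneg (m w - 1)]
  have hm' : ∀ w ∈ ball (0 : ℂ) 40, ‖deriv m w‖ ≤ (1 / 500) / 40 := by
    intro w hw
    have hcb : closedBall w 40 ⊆ ball 0 89 :=
      closedBall_subset_ball' (by rw [mem_ball] at hw; linarith)
    have e1 : deriv m w = deriv (fun z => m z - 1) w := by simp
    rw [e1]
    exact Complex.norm_deriv_le_of_forall_mem_sphere_norm_le (by norm_num)
      ((hmd.sub_const 1).diffContOnCl_ball hcb)
      fun z hz => hmb z (hcb (sphere_subset_closedBall hz))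
  have h4089 : ball (0 : ℂ) 40 ⊆ ball 0 89 := ball_subset_ball (by norm_num)
  refine ⟨fun w => (w - 1) * m w, ?_, ?_, by simp, ?_, ?_⟩
  · have := hmd.mono h4089
    fun_prop
  · intro w hw
    have a1 := (hmd.differentiableAt (isOpen_ball.mem_nhds (h4089 hw))).hasDerivAt
    have a2 := (((hasDerivAt_id w).sub_const 1).fun_mul a1).deriv
    simp only [id, one_mul] at a2
    rw [a2]
    have a3 : m w + (w - 1) * deriv m w - 1 = (m w - 1) + (w - 1) * deriv m w := by ring
    rw [a3]
    have a4 : ‖w - 1‖ ≤ 41 := by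
      refine (norm_sub_le _ _).trans ?_
      have := mem_ball_zero_iff.mp hw
      rw [norm_one]; linarith
    calc _ ≤ ‖m w - 1‖ + ‖w - 1‖ * ‖deriv m w‖ := by
          rw [← norm_mul]; exact norm_add_le _ _
      _ ≤ 1 / 500 + 41 * ((1 / 500) / 40) := by
          gcongr
          · exact hmb w (h4089 hw)
          · exact hm' w hw
      _ ≤ 1 / 2 := by norm_num
  · have := hmb 0 (by simp)
    have a1 : (0 - 1) * m 0 + 1 = -(m 0 - 1) := by ring
    rw [a1, norm_neg]; linarith
  · intro w hw
    have a1 := hηκ w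
    have a2 := hm2 w (h4089 hw)
    simp only [hη] at a1
    rw [mul_pow, a2, hu]
    field_simp
    linear_combination 2 * a1

theorem IsInvLin.radius_le {F ψ : ℂ → ℂ} {μ : ℂ} {r R : ℝ} (h : IsInvLin F ψ μ r R) (hR : 0 ≤ R) :
    r ≤ R := by
  rcases le_or_gt r 0 with hr | hr
  · linarith
  have := Complex.norm_deriv_le_div_of_mapsTo_ball h.diff (R₂ := R)
    (fun z hz => by rw [h.zero]; exact ball_subset_closedBall (h.maps z hz)) hr
  rwa [h.deriv_zero, norm_one, le_div_iff₀ hr, one_mul] at this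

/-- There is a normalized inverse linearization on a disc of maximal radius. -/
theorem exists_isInvLin_sSup {F : ℂ → ℂ} {μ : ℂ} (h0 : μ ≠ 0) (h1 : ‖μ‖ < 1)
    (hF : AnalyticAt ℂ F 0) (hF0 : F 0 = 0) (hF1 : HasDerivAt F μ 0) {R : ℝ} (hR : 0 ≤ R)
    (hex : ∃ r > 0, ∃ ψ, IsInvLin F ψ μ r R) :
    ∃ r > 0, ∃ ψ, IsInvLin F ψ μ r R ∧ ∀ r' ψ', IsInvLin F ψ' μ r' R → r' ≤ r := by
  set S : Set ℝ := {r | 0 < r ∧ ∃ ψ, IsInvLin F ψ μ r R} with hS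
  obtain ⟨r₀, hr₀, hψ₀⟩ := hex
  have hne : S.Nonempty := ⟨r₀, hr₀, hψ₀⟩
  have hbdd : BddAbove S := ⟨R, fun r hr => hr.2.elim fun ψ hψ => hψ.radius_le hR⟩
  have hr₀' : r₀ ≤ sSup S := le_csSup hbdd ⟨hr₀, hψ₀⟩
  have hchoose : ∀ r : ℝ, ∃ ψ, r ∈ S → IsInvLin F ψ μ r R := by
    intro r
    by_cases h : r ∈ S
    · exact ⟨h.2.choose, fun _ => h.2.choose_spec⟩
    · exact ⟨id, fun h' => absurd h' h⟩
  choose Ψ hΨ using hchoose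
  have hagree : ∀ r ∈ S, ∀ r' ∈ S, ∀ z : ℂ, ‖z‖ < r → ‖z‖ < r' → Ψ r z = Ψ r' z := by
    intro r hr r' hr' z hz hz'
    rcases le_total r r' with h | h
    · exact (hΨ r hr).eqOn h0 h1 hF hF0 hF1 hr.1 h (hΨ r' hr') (mem_ball_zero_iff.mpr hz)
    · exact ((hΨ r' hr').eqOn h0 h1 hF hF0 hF1 hr'.1 h (hΨ r hr) (mem_ball_zero_iff.mpr hz')).symm
  have hrad : ∀ z : ℂ, ∃ r : ℝ, ‖z‖ < sSup S → r ∈ S ∧ ‖z‖ < r := by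
    intro z
    by_cases h : ‖z‖ < sSup S
    · obtain ⟨r, hr, hzr⟩ := exists_lt_of_lt_csSup hne h
      exact ⟨r, fun _ => ⟨hr, hzr⟩⟩
    · exact ⟨0, fun h' => absurd h' h⟩
  choose ρ hρ using hrad
  set ψ : ℂ → ℂ := fun z => Ψ (ρ z) z with hψ
  have hψΨ : ∀ r ∈ S, EqOn ψ (Ψ r) (ball 0 r) := by
    intro r hr z hz
    have hz' := mem_ball_zero_iff.mp hz
    have h2 := hρ z (hz'.trans_le (le_csSup hbdd hr))
    exact hagree _ h2.1 _ hr z h2.2 hz'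
  have hloc : ∀ r ∈ S, ∀ z ∈ ball (0 : ℂ) r, ψ =ᶠ[𝓝 z] Ψ r := fun r hr z hz =>
    (hψΨ r hr).eventuallyEq_of_mem (isOpen_ball.mem_nhds hz)
  have h00 : (0 : ℂ) ∈ ball (0 : ℂ) r₀ := mem_ball_self hr₀
  have hS₀ : r₀ ∈ S := ⟨hr₀, hψ₀⟩
  refine ⟨sSup S, hr₀.trans_le hr₀', ψ, ⟨?_, ?_, ?_, ?_, ?_⟩, ?_⟩
  · intro z hz
    obtain ⟨h2, h3⟩ := hρ z (mem_ball_zero_iff.mp hz)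
    have h4 := mem_ball_zero_iff.mpr h3
    exact (((hΨ _ h2).diff.differentiableAt (isOpen_ball.mem_nhds h4)).congr_of_eventuallyEq
      (hloc _ h2 z h4)).differentiableWithinAt
  · intro z hz
    obtain ⟨h2, h3⟩ := hρ z (mem_ball_zero_iff.mp hz)
    exact (hΨ _ h2).maps z (mem_ball_zero_iff.mpr h3)
  · rw [hψΨ r₀ hS₀ h00, (hΨ _ hS₀).zero]
  · rw [(hloc r₀ hS₀ 0 h00).deriv_eq, (hΨ _ hS₀).deriv_zero]
  · intro z hz
    obtain ⟨h2, h3⟩ := hρ z (mem_ball_zero_iff.mp hz)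
    have h5 : μ * z ∈ ball (0 : ℂ) (ρ z) := by
      rw [mem_ball_zero_iff, norm_mul]
      exact (mul_le_of_le_one_left (norm_nonneg z) h1.le).trans_lt h3
    rw [hψΨ _ h2 h5]
    exact (hΨ _ h2).eq z (mem_ball_zero_iff.mpr h3)
  · intro r' ψ' h
    rcases le_or_gt r' 0 with h2 | h2
    · linarith
    · exact le_csSup hbdd ⟨h2, ψ', h⟩

/-- If `ψ` takes the value `1` at a point where `G` is critical there, then the derivative of `ψ`
vanishes along an orbit accumulating at `0`, which is absurd. -/
theorem IsInvLin.apply_ne_of_deriv_eq_zero {F ψ : ℂ → ℂ} {μ : ℂ} {r R : ℝ} (h0 : μ ≠ 0)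
    (h1 : ‖μ‖ < 1) (h : IsInvLin F ψ μ r R) (hF : DifferentiableOn ℂ F (ball 0 R)) {z c : ℂ}
    (hz : z ∈ ball (0 : ℂ) r) (hc : deriv F c = 0) : ψ z ≠ c := by
  intro hzc
  have hmem : ∀ n : ℕ, μ ^ n * z ∈ ball (0 : ℂ) r := by
    intro n
    rw [mem_ball_zero_iff, norm_mul, norm_pow]
    exact (mul_le_of_le_one_left (norm_nonneg z) (pow_le_one₀ (norm_nonneg _) h1.le)).trans_lt
      (mem_ball_zero_iff.mp hz)
  have hstep : ∀ y ∈ ball (0 : ℂ) r, μ * y ∈ ball (0 : ℂ) r →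
      deriv F (ψ y) * deriv ψ y = μ * deriv ψ (μ * y) := by
    intro y hy hμy
    have a1 := (h.diff.differentiableAt (isOpen_ball.mem_nhds hy)).hasDerivAt
    have a2 := (hF.differentiableAt (isOpen_ball.mem_nhds (h.maps y hy))).hasDerivAt
    have a3 := a2.comp y a1
    have a4 := (h.diff.differentiableAt (isOpen_ball.mem_nhds hμy)).hasDerivAt
    have a5 := a4.comp y ((hasDerivAt_id y).const_mul μ)
    have a6 : (F ∘ ψ) =ᶠ[𝓝 y] (ψ ∘ fun y => μ * y) := by
      filter_upwards [isOpen_ball.mem_nhds hy] with x hx using h.eq x hx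
    have a7 := a3.unique (a5.congr_of_eventuallyEq a6)
    rw [a7]; ring
  have hzero : ∀ n : ℕ, deriv ψ (μ ^ (n + 1) * z) = 0 := by
    have hsucc : ∀ n : ℕ, deriv F (ψ (μ ^ n * z)) * deriv ψ (μ ^ n * z) = 0 →
        deriv ψ (μ ^ (n + 1) * z) = 0 := by
      intro n hn
      have e : μ ^ (n + 1) * z = μ * (μ ^ n * z) := by ring
      have a1 := hstep _ (hmem n) (by rw [← e]; exact hmem (n + 1))
      rw [e]
      rw [hn] at a1
      exact (mul_eq_zero.mp a1.symm).resolve_left h0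
    intro n
    induction n with
    | zero => exact hsucc 0 (by simp [hzc, hc])
    | succ n ih => exact hsucc (n + 1) (by rw [ih, mul_zero])
  have hr : 0 < r := pos_of_mem_ball hz
  have ht : Tendsto (fun n : ℕ => μ ^ (n + 1) * z) atTop (𝓝 0) := by
    simpa using ((tendsto_pow_atTop_nhds_zero_of_norm_lt_one h1).comp
      (tendsto_add_atTop_nat 1)).mul_const z
  have hcont : ContinuousAt (deriv ψ) 0 := (h.analyticAt hr).deriv.continuousAt
  have := tendsto_nhds_unique (hcont.tendsto.comp ht)
    (tendsto_const_nhds.congr fun n => (hzero n).symm)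
  rw [h.deriv_zero] at this
  exact one_ne_zero this

theorem IsNearQuadratic.exists_isInvLin_max {G : ℂ → ℂ} {μ : ℂ} (hG : IsNearQuadratic G μ 2)
    (h1 : 1 / 2 ≤ ‖μ‖) (h2 : ‖μ‖ < 1) :
    ∃ ψ z₀, z₀ ≠ 0 ∧ IsInvLin G ψ μ ‖z₀‖ 40 ∧ ψ (μ * z₀) = G 1 ∧
      ∀ r ψ', IsInvLin G ψ' μ r 40 → r ≤ ‖z₀‖ := by
  have h0 : μ ≠ 0 := norm_pos_iff.mp (by linarith)
  have hG' : HasDerivAt G μ 0 := hG.deriv_zero ▸ hG.analyticAt.differentiableAt.hasDerivAt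
  obtain ⟨R, hR, ψ, hψ, hmax⟩ := exists_isInvLin_sSup h0 h2 hG.analyticAt hG.zero hG'
    (by norm_num : (0 : ℝ) ≤ 40)
    (exists_isInvLin_of_analyticAt h1 h2 hG.analyticAt hG.zero hG.deriv_zero (by norm_num))
  obtain ⟨g, hgd, hgd1, hg1, hg0, hGg⟩ := hG.exists_sq_form h1
  obtain ⟨hginj, h, hhd, hhg⟩ := exists_inverse_of_deriv_near_one hgd hgd1
  have hg0' : g 0 ≠ 0 := by
    intro h3; rw [h3] at hg0; norm_num at hg0
  have hGg0 := hGg 0 (by simp)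
  rw [hG.zero] at hGg0
  have hGz : ∀ z ∈ ball (0 : ℂ) R, ψ (μ * z) = G 1 - μ / 2 * g (ψ z) ^ 2 := fun z hz => by
    rw [← hψ.eq z hz, hGg _ (hψ.maps z hz)]
  have hzero : ∃ z ∈ closedBall (0 : ℂ) R, ψ (μ * z) - G 1 = 0 := by
    by_contra! hno
    set O : Set ℂ := ball 0 (R / ‖μ‖) ∩ (fun z => ψ (μ * z) - G 1) ⁻¹' {0}ᶜ with hO
    have hmaps : MapsTo (fun z => μ * z) (ball (0 : ℂ) (R / ‖μ‖)) (ball 0 R) := by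
      intro z hz
      rw [mem_ball_zero_iff, lt_div_iff₀ (by linarith)] at hz
      rw [mem_ball_zero_iff, norm_mul, mul_comm]; exact hz
    have hTd : DifferentiableOn ℂ (fun z => ψ (μ * z) - G 1) (ball 0 (R / ‖μ‖)) :=
      (hψ.diff.comp (by fun_prop) hmaps).sub_const _
    have hOo : IsOpen O := hTd.continuousOn.isOpen_inter_preimage isOpen_ball
      isOpen_compl_singleton
    have hsub : closedBall 0 R ⊆ O := by
      intro z hz
      refine ⟨?_, hno z hz⟩
      rw [mem_closedBall_zero_iff] at hz
      rw [mem_ball_zero_iff, lt_div_iff₀ (by linarith)]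
      nlinarith [norm_nonneg z]
    obtain ⟨δ, hδ, hδO⟩ := (isCompact_closedBall (0 : ℂ) R).exists_thickening_subset_open hOo hsub
    rw [thickening_closedBall hδ hR.le] at hδO
    have hTδ := hTd.mono (fun z hz => (hδO hz).1)
    obtain ⟨l, hl, hexp⟩ := exists_differentiableOn_exp_eq
      (f := fun z => -(2 / μ) * (ψ (μ * z) - G 1)) (r := δ + R) (by positivity)
      (hTδ.const_mul _) (fun z hz => mul_ne_zero (by simp [h0]) (hδO hz).2)
    set s₀ : ℂ → ℂ := fun z => Complex.exp (l z / 2) with hs₀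
    have hs₀2 : ∀ z ∈ ball (0 : ℂ) (δ + R), s₀ z ^ 2 = -(2 / μ) * (ψ (μ * z) - G 1) := by
      intro z hz
      rw [hs₀, ← Complex.exp_nat_mul, ← hexp z hz]
      congr 1
      push_cast; ring
    have h0δ : (0 : ℂ) ∈ ball (0 : ℂ) (δ + R) := mem_ball_self (by positivity)
    have hsg : s₀ 0 ^ 2 = g 0 ^ 2 := by
      rw [hs₀2 0 h0δ, mul_zero, hψ.zero]
      field_simp
      linear_combination (-2) * hGg0
    obtain ⟨s, hsd, hs2, hs0⟩ : ∃ s : ℂ → ℂ, DifferentiableOn ℂ s (ball 0 (δ + R)) ∧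
        (∀ z ∈ ball (0 : ℂ) (δ + R), s z ^ 2 = -(2 / μ) * (ψ (μ * z) - G 1)) ∧ s 0 = g 0 := by
      have hd := (hl.div_const 2).cexp
      rcases sq_eq_sq_iff_eq_or_eq_neg.mp hsg with h3 | h3
      · exact ⟨s₀, hd, hs₀2, h3⟩
      · exact ⟨fun z => -s₀ z, hd.neg, fun z hz => by rw [neg_sq]; exact hs₀2 z hz,
          by simp only [h3, neg_neg]⟩
    have hG1 : ‖G 1‖ ≤ 5 / 2 := by
      have a1 := hG.bound 1 (by simp)
      have a2 : G 1 = (G 1 - μ * (1 - 1 ^ 2 / 2)) + μ * (1 / 2) := by ring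
      rw [a2]
      refine (norm_add_le _ _).trans ?_
      rw [norm_mul]
      norm_num at a1 ⊢
      linarith
    have hball : ∀ z ∈ ball (0 : ℂ) (δ + R), s z ∈ ball (g 0) (40 / 2) := by
      intro z hz
      have a1 := congrArg norm (hs2 z hz)
      have a2 : ‖ψ (μ * z)‖ ≤ 40 :=
        (mem_ball_zero_iff.mp (hψ.maps _ (hmaps (hδO hz).1))).le
      have a3 : ‖(2 : ℂ) / μ‖ ≤ 4 := by
        rw [norm_div, div_le_iff₀ (by linarith)]
        simp only [Complex.norm_ofNat]; linarith
      rw [norm_pow, norm_mul, norm_neg] at a1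
      have a4 : ‖s z‖ ^ 2 ≤ 4 * (40 + 5 / 2) := by
        rw [a1]
        gcongr
        exact (norm_sub_le _ _).trans (add_le_add a2 hG1)
      have a5 : ‖s z‖ ≤ 14 := by nlinarith [norm_nonneg (s z)]
      rw [mem_ball, dist_eq_norm]
      have a6 : s z - g 0 = s z - (g 0 + 1) + 1 := by ring
      rw [a6]
      have a7 := norm_add_le (s z - (g 0 + 1)) 1
      have a8 := norm_sub_le (s z) (g 0 + 1)
      rw [norm_one] at a7
      linarith
    have hsub' : ball (0 : ℂ) R ⊆ ball 0 (δ + R) := ball_subset_ball (by linarith)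
    have hgψs : EqOn (fun z => g (ψ z)) s (ball 0 R) := by
      refine (convex_ball (0 : ℂ) R).isPreconnected.eq_of_sq_eq
        (hgd.continuousOn.comp hψ.diff.continuousOn hψ.maps)
        (hsd.continuousOn.mono hsub') ?_ ?_ (mem_ball_self hR) (by simp [hψ.zero, hs0])
      · intro z hz
        simp only [Pi.pow_apply]
        rw [hs2 z (hsub' hz), hGz z hz]
        field_simp
        ring
      · intro z hz hz0
        have := hs2 z (hsub' hz)
        rw [hz0] at this
        have h3 := (hδO (hsub' hz)).2
        apply h3
        have h4 : (2 / μ : ℂ) ≠ 0 := by simp [h0]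
        simpa [h0] using this
    have hψh : EqOn (fun z => h (s z)) ψ (ball 0 R) := by
      intro z hz
      have a1 := hhg _ (hball z (hsub' hz))
      exact hginj a1.1 (hψ.maps z hz) (a1.2.trans (hgψs hz).symm)
    have hnew : IsInvLin G (fun z => h (s z)) μ (δ + R) 40 := by
      refine ⟨hhd.comp hsd hball, fun z hz => (hhg _ (hball z hz)).1, ?_, ?_, ?_⟩
      · have := hψh (mem_ball_self hR)
        simpa [hψ.zero] using this
      · have : (fun z => h (s z)) =ᶠ[𝓝 0] ψ := hψh.eventuallyEq_of_mem (ball_mem_nhds 0 hR)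
        rw [this.deriv_eq, hψ.deriv_zero]
      · intro z hz
        have a1 := hhg _ (hball z hz)
        have a2 := hψh (hmaps (hδO hz).1)
        simp only at a2 ⊢
        rw [a2, hGg _ a1.1, a1.2, hs2 z hz]
        field_simp
        ring
    have := hmax _ _ hnew
    linarith
  obtain ⟨z₀, hz₀, hz₀0⟩ := hzero
  have hz₀' : ‖z₀‖ = R := by
    refine le_antisymm (mem_closedBall_zero_iff.mp hz₀) (not_lt.mp fun hlt => ?_)
    have hzb := mem_ball_zero_iff.mpr hlt
    refine hψ.apply_ne_of_deriv_eq_zero h0 h2 (hG.diff.mono (ball_subset_ball (by norm_num)))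
      hzb hG.deriv_one ?_
    refine hginj (hψ.maps _ hzb) (by simp) ?_
    have a1 := hGz z₀ hzb
    rw [sub_eq_zero.mp hz₀0] at a1
    have a2 : μ / 2 * g (ψ z₀) ^ 2 = 0 := by linear_combination a1
    rw [hg1]
    simpa [h0] using a2
  refine ⟨ψ, z₀, ?_, hz₀' ▸ hψ, sub_eq_zero.mp hz₀0, hz₀' ▸ hmax⟩
  rw [← norm_pos_iff, hz₀']; exact hR

theorem IsInvLin.tendsto_div_pow {F ψ : ℂ → ℂ} {μ z : ℂ} {r R : ℝ} (h0 : μ ≠ 0)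
    (h1 : ‖μ‖ < 1) (h : IsInvLin F ψ μ r R) (hr : 0 < r) :
    Tendsto (fun n : ℕ => ψ (μ ^ n * z)) atTop (𝓝 0) ∧
      Tendsto (fun n : ℕ => ψ (μ ^ n * z) / μ ^ n) atTop (𝓝 z) := by
  have ht : Tendsto (fun n : ℕ => μ ^ n * z) atTop (𝓝 0) := by
    simpa using (tendsto_pow_atTop_nhds_zero_of_norm_lt_one h1).mul_const z
  obtain ⟨χ, hχ, hχ0, hψχ⟩ := exists_eventuallyEq_mul_of_zero (h.analyticAt hr) h.zero
  rw [h.deriv_zero] at hχ0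
  constructor
  · simpa [h.zero, Function.comp_def] using (h.analyticAt hr).continuousAt.tendsto.comp ht
  · have h2 : Tendsto (fun n : ℕ => z * χ (μ ^ n * z)) atTop (𝓝 z) := by
      simpa [hχ0] using (hχ.continuousAt.tendsto.comp ht).const_mul z
    refine h2.congr' ?_
    filter_upwards [ht.eventually hψχ] with n hn
    rw [hn]
    field_simp

theorem IsInvLin.iterate_apply {F ψ : ℂ → ℂ} {μ z c : ℂ} {R : ℝ}
    (h1 : ‖μ‖ < 1) (h : IsInvLin F ψ μ ‖z‖ R) (hz : z ≠ 0) (hc : ψ (μ * z) = F c) (n : ℕ) :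
    F^[n + 1] c = ψ (μ ^ (n + 1) * z) ∧ ‖F^[n + 1] c‖ < R := by
  have hmem : ∀ n : ℕ, μ ^ (n + 1) * z ∈ ball (0 : ℂ) ‖z‖ := by
    intro n
    rw [mem_ball_zero_iff, norm_mul, norm_pow]
    exact mul_lt_of_lt_one_left (norm_pos_iff.mpr hz) (pow_lt_one₀ (norm_nonneg _) h1 (by simp))
  have key : F^[n + 1] c = ψ (μ ^ (n + 1) * z) := by
    induction n with
    | zero => simp [hc]
    | succ n ih =>
      rw [Function.iterate_succ_apply', ih, h.eq _ (hmem n)]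
      congr 1; ring
  refine ⟨key, ?_⟩
  rw [key]
  exact mem_ball_zero_iff.mp (h.maps _ (hmem n))

/-- The segment of maps from the quadratic polynomial to `G`. -/
theorem IsNearQuadratic.family {G : ℂ → ℂ} {μ t : ℂ} (hG : IsNearQuadratic G μ 1)
    (ht : t ∈ ball (0 : ℂ) 2) :
    IsNearQuadratic (fun w => μ * (w - w ^ 2 / 2) + t * (G w - μ * (w - w ^ 2 / 2))) μ 2 := by
  have hP : ∀ w : ℂ, HasDerivAt (fun w : ℂ => μ * (w - w ^ 2 / 2)) (μ * (1 - w)) w := by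
    intro w
    have := ((hasDerivAt_id w).fun_sub (((hasDerivAt_id w).fun_pow 2).div_const 2)).const_mul μ
    refine this.congr_deriv ?_
    simp
  have hd : ∀ w ∈ ball (0 : ℂ) 100,
      deriv (fun w => μ * (w - w ^ 2 / 2) + t * (G w - μ * (w - w ^ 2 / 2))) w =
        μ * (1 - w) + t * (deriv G w - μ * (1 - w)) := by
    intro w hw
    exact ((hP w).fun_add (((hG.diff.differentiableAt (isOpen_ball.mem_nhds hw)).hasDerivAt.fun_sub
      (hP w)).const_mul t)).deriv
  refine ⟨?_, ?_, ?_, ?_, ?_⟩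
  · have := hG.diff
    fun_prop
  · simp [hG.zero]
  · rw [hd 0 (by simp), hG.deriv_zero]; ring
  · rw [hd 1 (by simp), hG.deriv_one]; ring
  · intro w hw
    rw [add_sub_cancel_left, norm_mul]
    have a1 := hG.bound w hw
    have a2 := (mem_ball_zero_iff.mp ht).le
    nlinarith [norm_nonneg t, norm_nonneg (G w - μ * (w - w ^ 2 / 2))]

/-- Up to its argument, the maximal radius of linearization is a nonvanishing holomorphic function
along the segment of maps from the quadratic polynomial to `G`. -/
theorem IsNearQuadratic.exists_holomorphic_radius {G : ℂ → ℂ} {μ : ℂ} (hG : IsNearQuadratic G μ 1)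
    (h1 : 1 / 2 ≤ ‖μ‖) (h2 : ‖μ‖ < 1) :
    ∃ v : ℂ → ℂ, DifferentiableOn ℂ v (ball 0 2) ∧ ∀ t ∈ ball (0 : ℂ) 2, v t ≠ 0 ∧
      (∃ ψ, IsInvLin (fun w => μ * (w - w ^ 2 / 2) + t * (G w - μ * (w - w ^ 2 / 2))) ψ μ
        ‖v t‖ 40) ∧
      ∀ r ψ, IsInvLin (fun w => μ * (w - w ^ 2 / 2) + t * (G w - μ * (w - w ^ 2 / 2))) ψ μ r 40 →
        r ≤ ‖v t‖ := by
  have h0 : μ ≠ 0 := norm_pos_iff.mp (by linarith)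
  set F : ℂ → ℂ → ℂ := fun t w => μ * (w - w ^ 2 / 2) + t * (G w - μ * (w - w ^ 2 / 2)) with hF
  have hmax : ∀ t : ℂ, ∃ ψ z₀, t ∈ ball (0 : ℂ) 2 → z₀ ≠ 0 ∧ IsInvLin (F t) ψ μ ‖z₀‖ 40 ∧
      ψ (μ * z₀) = F t 1 ∧ ∀ r ψ', IsInvLin (F t) ψ' μ r 40 → r ≤ ‖z₀‖ := by
    intro t
    by_cases ht : t ∈ ball (0 : ℂ) 2
    · obtain ⟨ψ, z₀, h⟩ := (hG.family ht).exists_isInvLin_max h1 h2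
      exact ⟨ψ, z₀, fun _ => h⟩
    · exact ⟨id, 0, fun h => absurd h ht⟩
  choose ψ v hψv using hmax
  refine ⟨v, ?_, fun t ht => ⟨(hψv t ht).1, ⟨ψ t, (hψv t ht).2.1⟩, (hψv t ht).2.2.2⟩⟩
  set w : ℕ → ℂ → ℂ := fun n t => (F t)^[n] 1 with hw
  have hwb : ∀ n, ∀ t ∈ ball (0 : ℂ) 2, w n t ∈ ball (0 : ℂ) 100 := by
    intro n t ht
    rw [mem_ball_zero_iff]
    cases n with
    | zero => simp [hw]
    | succ n =>
      have := ((hψv t ht).2.1.iterate_apply h2 (hψv t ht).1 (hψv t ht).2.2.1 n).2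
      exact this.trans (by norm_num)
  have hwd : ∀ n, DifferentiableOn ℂ (w n) (ball 0 2) := by
    intro n
    induction n with
    | zero => exact differentiableOn_const 1
    | succ n ih =>
      have a1 : DifferentiableOn ℂ (fun t => G (w n t)) (ball 0 2) := hG.diff.comp ih (hwb n)
      have a2 : w (n + 1) = fun t => μ * (w n t - w n t ^ 2 / 2) +
          t * (G (w n t) - μ * (w n t - w n t ^ 2 / 2)) := by
        funext t
        simp only [hw, Function.iterate_succ_apply', hF]
      have a3 : DifferentiableOn ℂ (fun t => μ * (w n t - w n t ^ 2 / 2)) (ball 0 2) :=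
        (ih.fun_sub ((ih.fun_pow 2).div_const 2)).const_mul μ
      rw [a2]
      exact a3.fun_add (differentiableOn_id.fun_mul (a1.fun_sub a3))
  have hwt : ∀ t ∈ ball (0 : ℂ) 2, Tendsto (fun n => w n t) atTop (𝓝 0) ∧
      Tendsto (fun n => w n t / μ ^ n) atTop (𝓝 (v t)) := by
    intro t ht
    obtain ⟨a1, a2, a3, -⟩ := hψv t ht
    have a4 : ∀ᶠ n in atTop, ψ t (μ ^ n * v t) = w n t := by
      filter_upwards [eventually_ge_atTop 1] with n hn
      obtain ⟨k, rfl⟩ := Nat.exists_eq_add_of_le' hn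
      exact (a2.iterate_apply h2 a1 a3 k).1.symm
    obtain ⟨b1, b2⟩ := a2.tendsto_div_pow (z := v t) h0 h2 (norm_pos_iff.mpr a1)
    exact ⟨b1.congr' a4, b2.congr' (a4.mono fun n hn => by rw [hn])⟩
  obtain ⟨K, hK, r, hr, -, hb⟩ := exists_norm_sub_le_sq hG.analyticAt hG.zero hG.deriv_zero
  have hFb : ∀ t ∈ ball (0 : ℂ) 2, ∀ y ∈ ball (0 : ℂ) r,
      ‖F t y - μ * y‖ ≤ (3 + 2 * K) * ‖y‖ ^ 2 := by
    intro t ht y hy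
    have a1 : F t y - μ * y = t * (G y - μ * y) + (t - 1) * (μ / 2) * y ^ 2 := by
      simp only [hF]; ring
    have a2 := (mem_ball_zero_iff.mp ht).le
    have a3 : ‖t - 1‖ ≤ 3 := by
      have := norm_sub_le t 1; rw [norm_one] at this; linarith
    have a4 : ‖μ / 2‖ ≤ 1 := by
      rw [norm_div, Complex.norm_ofNat]; linarith
    rw [a1]
    calc _ ≤ ‖t‖ * ‖G y - μ * y‖ + ‖t - 1‖ * ‖μ / 2‖ * ‖y‖ ^ 2 := by
          rw [← norm_pow, ← norm_mul, ← norm_mul, ← norm_mul]; exact norm_add_le _ _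
      _ ≤ 2 * (K * ‖y‖ ^ 2) + 3 * 1 * ‖y‖ ^ 2 := by
          gcongr
          exact hb y hy
      _ = _ := by ring
  have h3 : 0 < 1 - ‖μ‖ := sub_pos.2 h2
  set κ := (3 + 2 * K) / (1 - ‖μ‖) with hκ
  have hκ0 : 0 < κ := div_pos (by positivity) h3
  set r₁ := min (r / 2) (1 / (100 * κ)) with hr₁
  have hr₁0 : 0 < r₁ := by positivity
  intro t₁ ht₁
  obtain ⟨N, hN⟩ := ((hwt t₁ ht₁).1.norm.eventually_lt_const
    (by rw [norm_zero]; exact hr₁0 : ‖(0 : ℂ)‖ < r₁)).exists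
  set U : Set ℂ := ball 0 2 ∩ (fun t => ‖w N t‖) ⁻¹' Iio r₁ with hU
  have hUo : IsOpen U := (hwd N).continuousOn.norm.isOpen_inter_preimage isOpen_ball isOpen_Iio
  obtain ⟨L, hL, hLt⟩ := exists_limit_orbit_div_pow hUo h1 h2 hκ0.le
    (by
      calc κ * r₁ ≤ κ * (1 / (100 * κ)) := by gcongr; exact min_le_right _ _
        _ = 1 / 100 := by field_simp)
    (fun n t => w (n + N) t) (fun n => (hwd _).mono inter_subset_left)
    (fun t ht => by simpa using ht.2.le)
    (fun n t ht hwn => by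
      rw [hκ, div_mul_cancel₀ _ h3.ne', show n + 1 + N = n + N + 1 by ring]
      simp only [hw, Function.iterate_succ_apply']
      refine hFb t ht.1 _ (mem_ball_zero_iff.mpr (hwn.trans_lt ?_))
      exact (min_le_left _ _).trans_lt (by linarith))
  have hvL : ∀ t ∈ U, v t = L t / μ ^ N := by
    intro t ht
    have a1 := ((hwt t ht.1).2.comp (tendsto_add_atTop_nat N))
    have a2 := (hLt t ht).1.div_const (μ ^ N)
    refine tendsto_nhds_unique a1 (a2.congr fun n => ?_)
    simp only [Function.comp, pow_add]
    field_simp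
  have hUt : U ∈ 𝓝 t₁ := hUo.mem_nhds ⟨ht₁, hN⟩
  refine DifferentiableAt.differentiableWithinAt ?_
  exact ((hL.differentiableAt hUt).div_const (μ ^ N)).congr_of_eventuallyEq
    (eventually_of_mem hUt hvL)

/-- A Harnack inequality for nonvanishing holomorphic functions on the disc of radius `2`. -/
theorem norm_apply_one_ge_of_ne_zero {v : ℂ → ℂ} {R δ : ℝ} (hR : 0 < R)
    (hv : DifferentiableOn ℂ v (ball 0 2)) (hv0 : ∀ t ∈ ball (0 : ℂ) 2, v t ≠ 0)
    (hvR : ∀ t ∈ ball (0 : ℂ) 2, ‖v t‖ ≤ R) (hδ : 0 < δ) (hvδ : δ ≤ ‖v 0‖) :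
    R * Real.exp (-2 + 3 * Real.log (δ / R)) ≤ ‖v 1‖ := by
  obtain ⟨l, hl, hexp⟩ := exists_differentiableOn_exp_eq (f := fun t => v t / R) (r := 2)
    (by norm_num) (hv.div_const _) (fun t ht => div_ne_zero (hv0 t ht) (by exact_mod_cast hR.ne'))
  have hre : ∀ t ∈ ball (0 : ℂ) 2, Real.exp (l t).re = ‖v t‖ / R := by
    intro t ht
    rw [← Complex.norm_exp, hexp t ht, norm_div, Complex.norm_real, Real.norm_of_nonneg hR.le]
  have h0 : (0 : ℂ) ∈ ball (0 : ℂ) 2 := by simp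
  have h1 : (1 : ℂ) ∈ ball (0 : ℂ) 2 := by simp
  have hneg : ∀ t ∈ ball (0 : ℂ) 2, (l t).re ≤ 0 := by
    intro t ht
    rw [← Real.exp_le_one_iff, hre t ht, div_le_one hR]
    exact hvR t ht
  set f : ℂ → ℂ := fun t => l t - (l 0).im * Complex.I with hf
  have hfre : ∀ t, (f t).re = (l t).re := by intro t; simp [hf]
  have hbc := Complex.borelCaratheodory (f := f) (M := 1) (R := 2) (z := 1) one_pos
    (hl.sub_const _) (fun t ht => by
      show (f t).re ≤ 1
      rw [hfre]; linarith [hneg t ht]) (by norm_num) h1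
  have hf0 : f 0 = ((l 0).re : ℂ) := by
    apply Complex.ext <;> simp [hf]
  have hl0 : Real.log (δ / R) ≤ (l 0).re := by
    rw [Real.log_le_iff_le_exp (by positivity), hre 0 h0]
    gcongr
  rw [hf0, Complex.norm_real, Real.norm_eq_abs, abs_of_nonpos (hneg 0 h0)] at hbc
  have h2 := neg_le_of_abs_le ((Complex.abs_re_le_norm (f 1)).trans hbc)
  rw [hfre] at h2
  norm_num at h2
  calc R * Real.exp (-2 + 3 * Real.log (δ / R)) ≤ R * Real.exp (l 1).re := by
        gcongr; linarith
    _ = ‖v 1‖ := by rw [hre 1 h1]; field_simp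

/-- Among the maps close to the quadratic polynomial, the radius of linearization is bounded below
in terms of that of the quadratic polynomial only. -/
theorem IsNearQuadratic.exists_isInvLin_of_quadratic {G ψ₀ : ℂ → ℂ} {μ : ℂ} {δ : ℝ}
    (hG : IsNearQuadratic G μ 1) (h1 : 1 / 2 ≤ ‖μ‖) (h2 : ‖μ‖ < 1) (hδ : 0 < δ)
    (hψ₀ : IsInvLin (fun w => μ * (w - w ^ 2 / 2)) ψ₀ μ δ 40) :
    ∃ ψ, IsInvLin G ψ μ (40 * Real.exp (-2 + 3 * Real.log (δ / 40))) 40 := by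
  obtain ⟨v, hv, hvt⟩ := hG.exists_holomorphic_radius h1 h2
  obtain ⟨-, ⟨ψ, hψ⟩, -⟩ := hvt 1 (by simp)
  simp only [one_mul, add_sub_cancel] at hψ
  refine ⟨ψ, hψ.mono ?_ le_rfl⟩
  refine norm_apply_one_ge_of_ne_zero (by norm_num) hv (fun t ht => (hvt t ht).1)
    (fun t ht => ?_) hδ ((hvt 0 (by simp)).2.2 δ ψ₀ (by simpa using hψ₀))
  obtain ⟨-, ⟨χ, hχ⟩, -⟩ := hvt t ht
  exact hχ.radius_le (by norm_num)

theorem exists_norm_apply_mul_sub_le {τ : ℂ → ℂ} (hτ : AnalyticAt ℂ τ 0) (h0 : τ 0 = 0)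
    (h1 : deriv τ 0 = 1) : ∃ C > 0, ∃ r > 0, ∀ s ∈ Icc (0 : ℝ) 1, ∀ y ∈ ball (0 : ℂ) r,
      ‖τ (s * y) - s * τ y‖ ≤ C * (1 - s) * ‖y‖ ^ 2 := by
  obtain ⟨τ₁, hτ₁, hτ₁0, hττ₁⟩ := exists_eventuallyEq_mul_of_zero hτ h0
  obtain ⟨T, hT, -, hτT⟩ := exists_eventuallyEq_mul_of_zero
    (f := fun w => τ₁ w - 1) (by fun_prop) (by simp [hτ₁0, h1])
  have hb : ∀ᶠ w in 𝓝 (0 : ℂ), ‖T w‖ < ‖T 0‖ + 1 :=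
    hT.continuousAt.norm.eventually_lt_const (lt_add_one _)
  obtain ⟨L, V, hV, hL⟩ := (hT.contDiffAt (n := 1)).exists_lipschitzOnWith
  obtain ⟨r, hr, hrr⟩ := Metric.eventually_nhds_iff_ball.mp
    ((hb.and hV).and (hττ₁.and hτT))
  refine ⟨‖T 0‖ + 1 + L * r, by positivity, r, hr, fun s hs y hy => ?_⟩
  have hy' := mem_ball_zero_iff.mp hy
  have hsn : ‖(s : ℂ)‖ = s := by rw [Complex.norm_real, Real.norm_of_nonneg hs.1]
  have hs1 : ‖(1 : ℂ) - s‖ = 1 - s := by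
    rw [← Complex.ofReal_one, ← Complex.ofReal_sub, Complex.norm_real,
      Real.norm_of_nonneg (sub_nonneg.2 hs.2)]
  have hsy : (s : ℂ) * y ∈ ball (0 : ℂ) r := by
    rw [mem_ball_zero_iff, norm_mul, hsn]
    exact (mul_le_of_le_one_left (norm_nonneg y) hs.2).trans_lt hy'
  obtain ⟨⟨b1, b2⟩, b3, b4⟩ := hrr y hy
  obtain ⟨⟨c1, c2⟩, c3, c4⟩ := hrr _ hsy
  have e : τ (s * y) - s * τ y = s * y ^ 2 * ((T (s * y) - T y) - (1 - s) * T (s * y)) := by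
    rw [b3, c3]
    linear_combination s * y * c4 - s * y * b4
  have h2 : ‖T (s * y) - T y‖ ≤ L * ((1 - s) * r) := by
    rw [← dist_eq_norm]
    refine (hL.dist_le_mul _ c2 _ b2).trans ?_
    have h3 : (s : ℂ) * y - y = -((1 - s) * y) := by ring
    rw [dist_eq_norm, h3, norm_neg, norm_mul, hs1]
    gcongr
    linarith [hs.2]
  have h4 : 0 ≤ 1 - s := sub_nonneg.2 hs.2
  calc ‖τ (s * y) - s * τ y‖
      = s * ‖y‖ ^ 2 * ‖(T (s * y) - T y) - (1 - s) * T (s * y)‖ := by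
        rw [e, norm_mul, norm_mul, norm_pow, hsn]
    _ ≤ 1 * ‖y‖ ^ 2 * (L * ((1 - s) * r) + (1 - s) * (‖T 0‖ + 1)) := by
        have h5 : ‖(T (s * y) - T y) - (1 - s) * T (s * y)‖ ≤
            L * ((1 - s) * r) + (1 - s) * (‖T 0‖ + 1) := by
          refine (norm_sub_le _ _).trans ?_
          rw [norm_mul, hs1]
          gcongr
        gcongr
        exact hs.2
    _ = _ := by ring

/-- An analytic germ tangent to the identity has a local inverse. -/
theorem exists_local_inverse {τ : ℂ → ℂ} (hτ : AnalyticAt ℂ τ 0) (h0 : τ 0 = 0)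
    (h1 : deriv τ 0 = 1) : ∃ σ : ℂ → ℂ, AnalyticAt ℂ σ 0 ∧ σ 0 = 0 ∧ deriv σ 0 = 1 ∧
      ∃ r > 0, InjOn τ (ball 0 r) ∧ DifferentiableOn ℂ τ (ball 0 r) ∧
        DifferentiableOn ℂ σ (ball 0 (r / 2)) ∧
        ∀ z ∈ ball (0 : ℂ) (r / 2), σ z ∈ ball (0 : ℂ) r ∧ τ (σ z) = z := by
  have hd : ∀ᶠ w in 𝓝 (0 : ℂ), ‖deriv τ w - 1‖ < 1 / 2 :=
    (hτ.deriv.continuousAt.sub continuousAt_const).norm.eventually_lt_const (by simp [h1])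
  obtain ⟨r, hr, hrr⟩ := Metric.eventually_nhds_iff_ball.mp (hd.and hτ.eventually_analyticAt)
  have hτd : DifferentiableOn ℂ τ (ball 0 r) := fun w hw =>
    (hrr w hw).2.differentiableAt.differentiableWithinAt
  obtain ⟨hinj, σ, hσ, hσr⟩ := exists_inverse_of_deriv_near_one hτd
    fun w hw => (hrr w hw).1.le
  rw [h0] at hσ hσr
  have h00 : (0 : ℂ) ∈ ball (0 : ℂ) (r / 2) := mem_ball_self (by positivity)
  have hσ0 : σ 0 = 0 := hinj (hσr 0 h00).1 (mem_ball_self hr) ((hσr 0 h00).2.trans h0.symm)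
  have hσa : AnalyticAt ℂ σ 0 := hσ.analyticAt (isOpen_ball.mem_nhds h00)
  refine ⟨σ, hσa, hσ0, ?_, r, hr, hinj, hτd, hσ, hσr⟩
  have d1 := hσa.differentiableAt.hasDerivAt
  have d2 : HasDerivAt τ 1 (σ 0) := by
    rw [hσ0, ← h1]; exact hτ.differentiableAt.hasDerivAt
  have d3 := d2.comp 0 d1
  have d4 : HasDerivAt (τ ∘ σ) 1 0 := (hasDerivAt_id (0 : ℂ)).congr_of_eventuallyEq (by
    filter_upwards [isOpen_ball.mem_nhds h00] with z hz using (hσr z hz).2)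
  simpa using d3.unique d4

/-- If `P` is linearizable at a fixed point of multiplier `lam` of modulus one, then the radii of
linearization of `s P` for `s` close to `1` are bounded below. -/
theorem exists_isInvLin_smul_of_linearizable {P τ : ℂ → ℂ} {lam : ℂ} (hlam : ‖lam‖ = 1)
    (hP : AnalyticAt ℂ P 0) (hP0 : P 0 = 0) (hτ : AnalyticAt ℂ τ 0) (h0 : τ 0 = 0)
    (h1 : deriv τ 0 = 1) (hτP : ∀ᶠ w in 𝓝 0, τ (P w) = lam * τ w) {R : ℝ} (hR : 0 < R) :
    ∃ δ > 0, ∀ s ∈ Ico (1 / 2 : ℝ) 1, ∃ ψ, IsInvLin (fun w => s * P w) ψ (s * lam) δ R := by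
  obtain ⟨C, hC, r₀, hr₀, hCb⟩ := exists_norm_apply_mul_sub_le hτ h0 h1
  obtain ⟨σ, hσ, hσ0, hσ1, r₁, hr₁, hinj, hτd, hσd, hσr⟩ := exists_local_inverse hτ h0 h1
  obtain ⟨σ₁, hσ₁, hσ₁0, hσσ₁⟩ := exists_eventuallyEq_mul_of_zero hσ hσ0
  have hσb : ∀ᶠ z in 𝓝 (0 : ℂ), ‖σ₁ z‖ < 2 :=
    hσ₁.continuousAt.norm.eventually_lt_const (by simp [hσ₁0, hσ1])
  have hPσ : Tendsto (fun z => P (σ z)) (𝓝 0) (𝓝 0) := by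
    have := (ContinuousAt.comp (f := σ) (g := P) (x := 0)
      (by rw [hσ0]; exact hP.continuousAt) hσ.continuousAt)
    simpa [ContinuousAt, Function.comp_def, hσ0, hP0] using this
  have hσt : Tendsto σ (𝓝 0) (𝓝 0) := by simpa [ContinuousAt, hσ0] using hσ.continuousAt
  have hPd : ∀ᶠ z in 𝓝 (0 : ℂ), DifferentiableAt ℂ (fun z => P (σ z)) z := by
    filter_upwards [hσ.eventually_analyticAt, hσt.eventually hP.eventually_analyticAt] with z a1 a2
    exact a2.differentiableAt.comp z a1.differentiableAt
  have hlamz : ∀ z : ℂ, ‖lam * z‖ = ‖z‖ := fun z => by rw [norm_mul, hlam, one_mul]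
  have hconj : ∀ᶠ z in 𝓝 (0 : ℂ), P (σ z) = σ (lam * z) := by
    filter_upwards [hPσ.eventually (ball_mem_nhds 0 hr₁), hσt.eventually hτP,
      ball_mem_nhds (0 : ℂ) (half_pos hr₁)] with z a1 a2 a3
    have a4 := hσr (lam * z) (by
      rw [mem_ball_zero_iff, hlamz]; exact mem_ball_zero_iff.mp a3)
    refine hinj a1 a4.1 ?_
    rw [a2, a4.2, (hσr z a3).2]
  obtain ⟨r₂, hr₂, hrr⟩ := Metric.eventually_nhds_iff_ball.mp
    ((hσσ₁.and hσb).and (hconj.and hPd))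
  set r := min (min (min r₂ (r₀ / 2)) (min (r₁ / 2) (R / 2))) (1 / (100 * (4 * C))) with hr
  have hr0 : 0 < r := by positivity
  have hrr₂ : r ≤ r₂ := (min_le_left _ _).trans ((min_le_left _ _).trans (min_le_left _ _))
  have hrr₀ : r ≤ r₀ / 2 := (min_le_left _ _).trans ((min_le_left _ _).trans (min_le_right _ _))
  have hrr₁ : r ≤ r₁ / 2 := (min_le_left _ _).trans ((min_le_right _ _).trans (min_le_left _ _))
  have hrR : r ≤ R / 2 := (min_le_left _ _).trans ((min_le_right _ _).trans (min_le_right _ _))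
  have hσ2 : ∀ z ∈ ball (0 : ℂ) r, ‖σ z‖ ≤ 2 * ‖z‖ := by
    intro z hz
    obtain ⟨⟨a1, a2⟩, -⟩ := hrr z (ball_subset_ball hrr₂ hz)
    rw [a1, norm_mul, mul_comm]
    gcongr
  have hlamr : ∀ z ∈ ball (0 : ℂ) r, lam * z ∈ ball (0 : ℂ) r := by
    intro z hz
    rw [mem_ball_zero_iff, hlamz]; exact mem_ball_zero_iff.mp hz
  have hPσz : ∀ z ∈ ball (0 : ℂ) r, P (σ z) = σ (lam * z) := fun z hz =>
    (hrr z (ball_subset_ball hrr₂ hz)).2.1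
  have hPσb : ∀ z ∈ ball (0 : ℂ) r, ‖P (σ z)‖ ≤ 2 * ‖z‖ := by
    intro z hz
    rw [hPσz z hz, ← hlamz z]
    exact hσ2 _ (hlamr z hz)
  refine ⟨r / 4, by positivity, fun s hs => ?_⟩
  have hs0 : 0 ≤ s := by linarith [hs.1]
  have hsn : ‖(s : ℂ)‖ = s := by rw [Complex.norm_real, Real.norm_of_nonneg hs0]
  have hsl : ‖(s : ℂ) * lam‖ = s := by rw [norm_mul, hlam, hsn, mul_one]
  have hsP : ∀ z ∈ ball (0 : ℂ) r, (s : ℂ) * P (σ z) ∈ ball (0 : ℂ) r₁ := by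
    intro z hz
    rw [mem_ball_zero_iff, norm_mul, hsn]
    have a1 := hPσb z hz
    have a2 := mem_ball_zero_iff.mp hz
    have a3 := mul_le_of_le_one_left (norm_nonneg (P (σ z))) hs.2.le
    linarith
  obtain ⟨χ, hχ⟩ := exists_isInvLin (G := fun z => τ (s * P (σ z))) (μ := s * lam) (κ := 4 * C)
    hr0 (by rw [hsl]; exact hs.1) (by rw [hsl]; exact hs.2) (by positivity)
    (by
      calc 4 * C * r ≤ 4 * C * (1 / (100 * (4 * C))) := by gcongr; exact min_le_right _ _
        _ = 1 / 100 := by field_simp)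
    (hτd.comp (fun z hz => (((hrr z (ball_subset_ball hrr₂ hz)).2.2).const_mul
      (s : ℂ)).differentiableWithinAt) hsP)
    (fun z hz => by
      have hτσ : τ (P (σ z)) = lam * z := by
        rw [hPσz z hz]
        exact (hσr _ (ball_subset_ball hrr₁ (hlamr z hz))).2
      have a1 := hCb s ⟨hs0, hs.2.le⟩ (P (σ z)) (by
        have := hPσb z hz
        have a2 := mem_ball_zero_iff.mp hz
        rw [mem_ball_zero_iff]; linarith)
      rw [hτσ, ← mul_assoc] at a1
      refine a1.trans ?_
      rw [hsl]
      have h4 : 0 ≤ 1 - s := sub_nonneg.2 hs.2.le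
      calc C * (1 - s) * ‖P (σ z)‖ ^ 2 ≤ C * (1 - s) * (2 * ‖z‖) ^ 2 := by
            gcongr
            exact hPσb z hz
        _ = _ := by ring)
  have hχr : ∀ z ∈ ball (0 : ℂ) (r / 4), χ z ∈ ball (0 : ℂ) r := fun z hz =>
    ball_subset_ball (by linarith) (hχ.maps z hz)
  have hr2 : r ≤ r₁ / 2 := hrr₁
  refine ⟨fun z => σ (χ z), (hσd.mono (ball_subset_ball hrr₁)).comp hχ.diff hχr, fun z hz => ?_,
    by simp [hχ.zero, hσ0], ?_, fun z hz => ?_⟩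
  · have a1 := hσ2 _ (hχr z hz)
    have a2 := mem_ball_zero_iff.mp (hχr z hz)
    rw [mem_ball_zero_iff]; linarith
  · have d1 := (hχ.analyticAt (by positivity)).differentiableAt.hasDerivAt
    have d2 : HasDerivAt σ 1 (χ 0) := by
      rw [hχ.zero, ← hσ1]; exact hσ.differentiableAt.hasDerivAt
    have d3 := (d2.comp 0 d1).deriv
    rw [hχ.deriv_zero, mul_one] at d3
    exact d3
  · have hμz : (s : ℂ) * lam * z ∈ ball (0 : ℂ) (r / 4) := by
      rw [mem_ball_zero_iff, norm_mul, hsl]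
      exact (mul_le_of_le_one_left (norm_nonneg z) hs.2.le).trans_lt (mem_ball_zero_iff.mp hz)
    have a1 := hχ.eq z hz
    have a2 := hσr _ (ball_subset_ball hr2 (hχr _ hμz))
    exact hinj (hsP _ (hχr z hz)) a2.1 (a1.trans a2.2.symm)

theorem IsInvLin.rescale {F ψ : ℂ → ℂ} {μ c : ℂ} {r R : ℝ} (hc : c ≠ 0)
    (h : IsInvLin (fun w => F (c * w) / c) ψ μ r R) :
    IsInvLin F (fun z => c * ψ (z / c)) μ (‖c‖ * r) (‖c‖ * R) := by
  have hcn : 0 < ‖c‖ := norm_pos_iff.mpr hc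
  have hmem : ∀ z ∈ ball (0 : ℂ) (‖c‖ * r), z / c ∈ ball (0 : ℂ) r := by
    intro z hz
    rw [mem_ball_zero_iff] at hz ⊢
    rw [norm_div, div_lt_iff₀ hcn]; linarith
  refine ⟨(h.diff.comp (by fun_prop) hmem).const_mul c, fun z hz => ?_, by simp [h.zero], ?_,
    fun z hz => ?_⟩
  · have := mem_ball_zero_iff.mp (h.maps _ (hmem z hz))
    rw [mem_ball_zero_iff, norm_mul]
    gcongr
  · have hd : DifferentiableAt ℂ ψ (0 / c) := by
      rw [zero_div]
      exact differentiableAt_of_deriv_ne_zero (by rw [h.deriv_zero]; exact one_ne_zero)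
    have h1 := ((hd.hasDerivAt.comp (0 : ℂ) ((hasDerivAt_id (0 : ℂ)).div_const c)).const_mul
      c).deriv
    rw [zero_div, h.deriv_zero] at h1
    simp only [Function.comp_def, id] at h1
    rw [h1]; field_simp
  · have := h.eq _ (hmem z hz)
    rw [mul_div_assoc, ← this]
    field_simp

/-- A quadratic map with a large quadratic coefficient and a fixed perturbation is, after
rescaling, close to the normalized quadratic polynomial. -/
theorem exists_isNearQuadratic_rescale {e : ℂ → ℂ} (he : AnalyticAt ℂ e 0) (he0 : e 0 = 0)
    (he1 : deriv e 0 = 0) : ∃ B > 0, ∀ μ b : ℂ, 1 / 2 ≤ ‖μ‖ → ‖μ‖ < 1 → ‖b‖ = B →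
      ∃ c : ℂ, 1 / (8 * B) ≤ ‖c‖ ∧ ‖c‖ ≤ 2 / B ∧
        IsNearQuadratic (fun w => (μ * (c * w) + b * (c * w) ^ 2 + e (c * w)) / c) μ 1 := by
  obtain ⟨K₁, hK₁, r₁, hr₁, -, hb₁⟩ := exists_norm_sub_le_sq he he0 he1
  obtain ⟨e₁, he₁, -, hee₁⟩ := exists_eventuallyEq_mul_of_zero he.deriv he1
  obtain ⟨r₂, hr₂, hb₂⟩ := Metric.eventually_nhds_iff_ball.mp ((hee₁.and
    (he₁.continuousAt.norm.eventually_lt_const (lt_add_one _))).and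
    ((he.deriv.deriv.continuousAt.norm.eventually_lt_const (lt_add_one _)).and
      he.eventually_analyticAt))
  set K := K₁ + (‖e₁ 0‖ + 1) + (‖deriv (deriv e) 0‖ + 1) with hK
  have hK0 : 0 < K := by positivity
  set r := min r₁ r₂ with hr
  have hr0 : 0 < r := lt_min hr₁ hr₂
  have hea : ∀ w ∈ ball (0 : ℂ) r, AnalyticAt ℂ e w := fun w hw =>
    (hb₂ w (ball_subset_ball (min_le_right _ _) hw)).2.2
  have hk0 : ∀ w ∈ ball (0 : ℂ) r, ‖e w‖ ≤ K * ‖w‖ ^ 2 := by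
    intro w hw
    have := hb₁ w (ball_subset_ball (min_le_left _ _) hw)
    rw [zero_mul, sub_zero] at this
    refine this.trans ?_
    gcongr
    rw [hK]
    linarith [norm_nonneg (e₁ 0), norm_nonneg (deriv (deriv e) 0)]
  have hk1 : ∀ w ∈ ball (0 : ℂ) r, ‖deriv e w‖ ≤ K * ‖w‖ := by
    intro w hw
    obtain ⟨⟨a1, a2⟩, -⟩ := hb₂ w (ball_subset_ball (min_le_right _ _) hw)
    rw [a1, norm_mul, mul_comm]
    gcongr
    rw [hK]
    linarith [norm_nonneg (deriv (deriv e) 0)]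
  have hk2 : ∀ w ∈ ball (0 : ℂ) r, ‖deriv (deriv e) w‖ ≤ K := by
    intro w hw
    obtain ⟨-, a1, -⟩ := hb₂ w (ball_subset_ball (min_le_right _ _) hw)
    rw [hK]
    linarith [norm_nonneg (e₁ 0)]
  set B := 40000 * K + 200 / r with hB
  have hB0 : 0 < B := by positivity
  have hBK : 40000 * K ≤ B := le_add_of_nonneg_right (by positivity)
  have hBr : 200 / B ≤ r := by
    rw [div_le_iff₀ hB0, hB]
    have : 200 / r * r = 200 := by field_simp
    nlinarith [mul_pos hr0 hK0]
  refine ⟨B, hB0, fun μ b hμ hμ1 hbB => ?_⟩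
  have hμ0 : μ ≠ 0 := norm_pos_iff.mp (by linarith)
  have hb0 : b ≠ 0 := norm_pos_iff.mp (by rw [hbB]; exact hB0)
  have hmem : ∀ u ∈ ball (0 : ℂ) 4, ‖-μ * u / (2 * b)‖ ≤ 2 / B := by
    intro u hu
    rw [mem_ball_zero_iff] at hu
    rw [norm_div, norm_mul, norm_mul, norm_neg, hbB, Complex.norm_ofNat,
      div_le_div_iff₀ (by positivity) hB0]
    have : ‖μ‖ * ‖u‖ ≤ 1 * 4 := by gcongr
    nlinarith
  have hmem' : ∀ u ∈ ball (0 : ℂ) 4, -μ * u / (2 * b) ∈ ball (0 : ℂ) r := by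
    intro u hu
    rw [mem_ball_zero_iff]
    refine (hmem u hu).trans_lt (lt_of_lt_of_le ?_ hBr)
    gcongr; norm_num
  have hhd : ∀ u ∈ ball (0 : ℂ) 4, HasDerivAt (fun u => u - deriv e (-μ * u / (2 * b)) / μ)
      (1 - deriv (deriv e) (-μ * u / (2 * b)) * (-μ / (2 * b)) / μ) u := by
    intro u hu
    have a1 := (hea _ (hmem' u hu)).deriv.differentiableAt.hasDerivAt
    have a2 : HasDerivAt (fun u => -μ * u / (2 * b)) (-μ / (2 * b)) u := by
      simpa using ((hasDerivAt_id u).const_mul (-μ)).div_const (2 * b)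
    have a3 : HasDerivAt (fun u => deriv e (-μ * u / (2 * b)))
        (deriv (deriv e) (-μ * u / (2 * b)) * (-μ / (2 * b))) u :=
      HasDerivAt.comp (h₂ := deriv e) u a1 a2
    exact (hasDerivAt_id u).fun_sub (a3.div_const μ)
  obtain ⟨-, h, -, hh⟩ := exists_inverse_of_deriv_near_one (r := 4)
    (g := fun u => u - deriv e (-μ * u / (2 * b)) / μ)
    (fun u hu => (hhd u hu).differentiableAt.differentiableWithinAt)
    (fun u hu => by
      rw [(hhd u hu).deriv]
      have a1 : 1 - deriv (deriv e) (-μ * u / (2 * b)) * (-μ / (2 * b)) / μ - 1 =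
          deriv (deriv e) (-μ * u / (2 * b)) / (2 * b) := by field_simp; ring
      rw [a1, norm_div, norm_mul, hbB, Complex.norm_ofNat, div_le_iff₀ (by positivity)]
      have := hk2 _ (hmem' u hu)
      linarith)
  simp only [mul_zero, zero_div, he1, sub_zero] at hh
  obtain ⟨hu, hu1⟩ := hh 1 (by simp; norm_num)
  set u := h 1 with hu_def
  set c := -μ * u / (2 * b) with hc
  have hcB : ‖c‖ ≤ 2 / B := hmem u hu
  have hcr : c ∈ ball (0 : ℂ) r := hmem' u hu
  have hec : deriv e c = μ * (u - 1) := by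
    have : deriv e c / μ = u - 1 := by linear_combination -hu1
    rw [← this]; field_simp
  have hu_sub : ‖u - 1‖ ≤ 1 / 10000 := by
    have a1 := hk1 c hcr
    rw [hec, norm_mul] at a1
    have a2 : K * ‖c‖ ≤ 1 / 20000 := by
      calc K * ‖c‖ ≤ K * (2 / B) := by gcongr
        _ = 2 * K / B := by ring
        _ ≤ 1 / 20000 := by
          rw [div_le_div_iff₀ hB0 (by norm_num)]; linarith
    nlinarith [norm_nonneg (u - 1)]
  have hun : 1 / 2 ≤ ‖u‖ := by
    have := norm_sub_le u (u - 1)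
    rw [sub_sub_cancel, norm_one] at this
    linarith
  have hu0 : u ≠ 0 := norm_pos_iff.mp (by linarith)
  have hc0 : c ≠ 0 := by
    rw [hc]
    exact div_ne_zero (mul_ne_zero (neg_ne_zero.mpr hμ0) hu0) (mul_ne_zero two_ne_zero hb0)
  have hbc : b * c = -μ * u / 2 := by rw [hc]; field_simp
  have hcw : ∀ w ∈ ball (0 : ℂ) 100, c * w ∈ ball (0 : ℂ) r := by
    intro w hw
    rw [mem_ball_zero_iff] at hw ⊢
    rw [norm_mul]
    have a1 : ‖c‖ * ‖w‖ < ‖c‖ * 100 := by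
      have := norm_pos_iff.mpr hc0
      gcongr
    have a2 : 2 / B * 100 = 200 / B := by ring
    nlinarith
  have hder : ∀ w ∈ ball (0 : ℂ) 100,
      HasDerivAt (fun w => (μ * (c * w) + b * (c * w) ^ 2 + e (c * w)) / c)
        (μ + 2 * (b * c) * w + deriv e (c * w)) w := by
    intro w hw
    have a0 : HasDerivAt (fun w => c * w) c w := by simpa using (hasDerivAt_id w).const_mul c
    have a1 := (hea _ (hcw w hw)).differentiableAt.hasDerivAt.comp w a0
    refine (((a0.const_mul μ).fun_add ((a0.fun_pow 2).const_mul b)).fun_add a1 |>.div_const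
      c).congr_deriv ?_
    field_simp
    push_cast
    ring
  refine ⟨c, ?_, hcB, ?_, ?_, ?_, ?_, ?_⟩
  · rw [hc, norm_div, norm_mul, norm_mul, norm_neg, hbB, Complex.norm_ofNat,
      div_le_div_iff₀ (by positivity) (by positivity)]
    nlinarith [mul_le_mul hμ hun (by norm_num) (norm_nonneg μ)]
  · exact fun w hw => (hder w hw).differentiableAt.differentiableWithinAt
  · simp [he0]
  · rw [(hder 0 (by simp)).deriv]; simp [he1]
  · rw [(hder 1 (by simp)).deriv, mul_one, mul_one, hec, hbc]; ring
  · intro w hw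
    have hw' := (mem_ball_zero_iff.mp hw).le
    have a1 : (μ * (c * w) + b * (c * w) ^ 2 + e (c * w)) / c - μ * (w - w ^ 2 / 2) =
        -(μ * (u - 1) / 2 * w ^ 2) + e (c * w) / c := by
      have : (μ * (c * w) + b * (c * w) ^ 2 + e (c * w)) / c =
          μ * w + (b * c) * w ^ 2 + e (c * w) / c := by field_simp
      rw [this, hbc]; ring
    rw [a1]
    refine (norm_add_le _ _).trans ?_
    have a2 : ‖-(μ * (u - 1) / 2 * w ^ 2)‖ ≤ 1 * (1 / 10000) / 2 * 100 ^ 2 := by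
      rw [norm_neg, norm_mul, norm_div, norm_mul, norm_pow, Complex.norm_ofNat]
      gcongr
    have a3 : ‖e (c * w) / c‖ ≤ K * (2 / B) * 100 ^ 2 := by
      have hcn := norm_pos_iff.mpr hc0
      rw [norm_div, div_le_iff₀ hcn]
      refine (hk0 _ (hcw w hw)).trans ?_
      rw [norm_mul]
      calc K * (‖c‖ * ‖w‖) ^ 2 = K * ‖c‖ * ‖w‖ ^ 2 * ‖c‖ := by ring
        _ ≤ K * (2 / B) * 100 ^ 2 * ‖c‖ := by gcongr
    have a4 : K * (2 / B) * 100 ^ 2 ≤ 1 / 2 := by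
      have : K * (2 / B) * 100 ^ 2 = 20000 * K / B := by ring
      rw [this, div_le_iff₀ hB0]; linarith
    linarith

/-- Uniform Taylor bounds for the normalized inverse linearizations of the contractions
`w ↦ s λ w + e w`, obtained by the maximum principle in the quadratic coefficient. -/
theorem exists_uniform_taylor_bound {lam : ℂ} (hlam : ‖lam‖ = 1) {δ : ℝ} (hδ : 0 < δ)
    (hquad : ∀ s ∈ Ico (1 / 2 : ℝ) 1, ∃ ψ, IsInvLin (fun w => s * lam * (w - w ^ 2 / 2)) ψ
      (s * lam) δ 40) {e : ℂ → ℂ} (he : AnalyticAt ℂ e 0) (he0 : e 0 = 0) (he1 : deriv e 0 = 0) :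
    ∃ M > 0, ∃ ρ > 0, ∀ s ∈ Ico (1 / 2 : ℝ) 1, ∃ ψ : ℂ → ℂ, AnalyticAt ℂ ψ 0 ∧ ψ 0 = 0 ∧
      deriv ψ 0 = 1 ∧ (∀ᶠ z in 𝓝 0, s * lam * ψ z + e (ψ z) = ψ (s * lam * z)) ∧
      ∀ n, ‖iteratedDeriv n ψ 0‖ ≤ n.factorial * M / ρ ^ n := by
  obtain ⟨B, hB, hres⟩ := exists_isNearQuadratic_rescale he he0 he1
  set δ' := 40 * Real.exp (-2 + 3 * Real.log (δ / 40)) with hδ'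
  have hδ'0 : 0 < δ' := by positivity
  set ρ := 1 / (8 * B) * δ' / 2 with hρ
  have hρ0 : 0 < ρ := by positivity
  refine ⟨2 / B * 40, by positivity, ρ, hρ0, fun s hs => ?_⟩
  set μ : ℂ := s * lam with hμ
  have hμn : ‖μ‖ = s := by
    rw [hμ, norm_mul, hlam, Complex.norm_real, Real.norm_of_nonneg (by linarith [hs.1]), mul_one]
  have h1 : 1 / 2 ≤ ‖μ‖ := by rw [hμn]; exact hs.1
  have h2 : ‖μ‖ < 1 := by rw [hμn]; exact hs.2
  have h0 : μ ≠ 0 := norm_pos_iff.mp (by linarith)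
  obtain ⟨p, hp⟩ := exists_polynomial_iteratedDeriv h0 h2 he he0 he1
  have hF1 : deriv (fun z => μ * z + e z) 0 = μ := by
    have := (((hasDerivAt_id (0 : ℂ)).const_mul μ).fun_add he.differentiableAt.hasDerivAt).deriv
    simpa [he1] using this
  obtain ⟨r, hr, ψ, hψ⟩ := exists_isInvLin_of_analyticAt h1 h2 (F := fun z => μ * z + e z)
    (by fun_prop) (by simp [he0]) hF1 one_pos
  have hψe : ∀ᶠ z in 𝓝 0, μ * ψ z + e (ψ z) = ψ (μ * z) := by
    filter_upwards [ball_mem_nhds (0 : ℂ) hr] with z hz using hψ.eq z hz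
  refine ⟨ψ, hψ.analyticAt hr, hψ.zero, hψ.deriv_zero, hψe, fun n => ?_⟩
  rw [hp 0 ψ (hψ.analyticAt hr) hψ.zero hψ.deriv_zero (by simpa using hψe) n]
  refine Complex.norm_le_of_forall_mem_frontier_norm_le (U := ball (0 : ℂ) B)
    (f := fun b => (p n).eval b) isBounded_ball (p n).differentiable.diffContOnCl ?_
    (subset_closure (mem_ball_self hB))
  intro b hb
  rw [frontier_ball _ hB.ne', mem_sphere_zero_iff_norm] at hb
  obtain ⟨c, hc1, hc2, hG⟩ := hres μ b h1 h2 hb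
  have hc0 : c ≠ 0 := norm_pos_iff.mp (lt_of_lt_of_le (by positivity) hc1)
  obtain ⟨ψ₀, hψ₀⟩ := hquad s hs
  obtain ⟨χ, hχ⟩ := hG.exists_isInvLin_of_quadratic h1 h2 hδ hψ₀
  have hχ' := (IsInvLin.rescale (F := fun w => μ * w + b * w ^ 2 + e w) hc0 hχ).mono
    (r' := 1 / (8 * B) * δ') (R' := 2 / B * 40) (by gcongr) (by gcongr)
  set ω : ℂ → ℂ := fun z => c * χ (z / c) with hω
  have hr' : 0 < 1 / (8 * B) * δ' := by positivity
  have hpn := hp b ω (hχ'.analyticAt hr') hχ'.zero hχ'.deriv_zero (by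
    filter_upwards [ball_mem_nhds (0 : ℂ) hr'] with z hz using hχ'.eq z hz) n
  rw [← hpn]
  have hsub : closedBall (0 : ℂ) ρ ⊆ ball 0 (1 / (8 * B) * δ') :=
    closedBall_subset_ball (by rw [hρ]; linarith)
  exact Complex.norm_iteratedDeriv_le_of_forall_mem_sphere_norm_le n hρ0
    (hχ'.diff.diffContOnCl_ball hsub) fun z hz =>
      (mem_ball_zero_iff.mp (hχ'.maps z (hsub (sphere_subset_closedBall hz)))).le

theorem norm_coeff_mul_pow_le {a : ℕ → ℂ} {M ρ : ℝ} (hρ : 0 < ρ)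
    (ha : ∀ n, ‖a n‖ ≤ M / ρ ^ n) {z : ℂ} (hz : z ∈ ball (0 : ℂ) (ρ / 2)) (n : ℕ) :
    ‖a n * z ^ n‖ ≤ M * (1 / 2) ^ n := by
  rw [norm_mul, norm_pow]
  have hz' := (mem_ball_zero_iff.mp hz).le
  calc ‖a n‖ * ‖z‖ ^ n ≤ M / ρ ^ n * (ρ / 2) ^ n := by
        gcongr
        · exact (norm_nonneg _).trans (ha n)
        · exact ha n
    _ = M * (1 / 2) ^ n := by
        rw [div_pow, div_pow, one_pow]; field_simp

theorem differentiableOn_tsum_mul_pow {a : ℕ → ℂ} {M ρ : ℝ} (hρ : 0 < ρ)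
    (ha : ∀ n, ‖a n‖ ≤ M / ρ ^ n) :
    DifferentiableOn ℂ (fun z => ∑' n, a n * z ^ n) (ball 0 (ρ / 2)) :=
  Complex.differentiableOn_tsum_of_summable_norm (summable_geometric_two.mul_left M)
    (fun _ => by fun_prop) isOpen_ball fun n _ hz => norm_coeff_mul_pow_le hρ ha hz n

theorem norm_tsum_mul_pow_sub_le {a : ℕ → ℂ} {M ρ : ℝ} (hρ : 0 < ρ)
    (ha : ∀ n, ‖a n‖ ≤ M / ρ ^ n) (h0 : a 0 = 0) (h1 : a 1 = 1) {z : ℂ}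
    (hz : z ∈ ball (0 : ℂ) (ρ / 2)) :
    ‖∑' n, a n * z ^ n - z‖ ≤ 2 * M / ρ ^ 2 * ‖z‖ ^ 2 := by
  have hM : 0 ≤ M := by simpa using (norm_nonneg _).trans (ha 0)
  have hs : Summable fun n => a n * z ^ n :=
    Summable.of_norm_bounded (summable_geometric_two.mul_left M) (norm_coeff_mul_pow_le hρ ha hz)
  rw [← hs.sum_add_tsum_nat_add 2, Finset.sum_range_succ, Finset.sum_range_one, h0, h1]
  simp only [zero_mul, one_mul, pow_one, zero_add, add_sub_cancel_left]
  have hb : ∀ n, ‖a (n + 2) * z ^ (n + 2)‖ ≤ M / ρ ^ 2 * ‖z‖ ^ 2 * (1 / 2) ^ n := by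
    intro n
    rw [norm_mul, norm_pow]
    have hz' := (mem_ball_zero_iff.mp hz).le
    calc ‖a (n + 2)‖ * ‖z‖ ^ (n + 2) ≤ M / ρ ^ (n + 2) * ((ρ / 2) ^ n * ‖z‖ ^ 2) := by
          rw [pow_add]
          gcongr
          exact ha _
      _ = M / ρ ^ 2 * ‖z‖ ^ 2 * (1 / 2) ^ n := by
          rw [div_pow, div_pow, one_pow, pow_add]; field_simp
  refine (tsum_of_norm_bounded (hasSum_geometric_two.mul_left _) hb).trans (le_of_eq ?_)
  ring

theorem eventuallyEq_tsum_iteratedDeriv {ψ : ℂ → ℂ} (hψ : AnalyticAt ℂ ψ 0) :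
    (fun z => ∑' n : ℕ, (n.factorial : ℂ)⁻¹ * iteratedDeriv n ψ 0 * z ^ n) =ᶠ[𝓝 0] ψ := by
  obtain ⟨r, hr, hrr⟩ := Metric.eventually_nhds_iff_ball.mp hψ.eventually_analyticAt
  filter_upwards [ball_mem_nhds (0 : ℂ) hr] with z hz
  have := Complex.taylorSeries_eq_on_ball' hz
    (fun w hw => (hrr w hw).differentiableAt.differentiableWithinAt)
  simpa using this

/-- Local inverse linearizations of `w ↦ s λ w + e w` with uniformly bounded Taylor coefficients
accumulate, as `s → 1`, on an inverse linearization of `w ↦ λ w + e w`. -/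
theorem exists_inverse_linearization_of_uniform_bound {lam : ℂ} (hlam : ‖lam‖ = 1) {e : ℂ → ℂ}
    (he : AnalyticAt ℂ e 0) {M ρ : ℝ} (hM : 0 < M) (hρ : 0 < ρ)
    (H : ∀ s ∈ Ico (1 / 2 : ℝ) 1, ∃ ψ : ℂ → ℂ, AnalyticAt ℂ ψ 0 ∧ ψ 0 = 0 ∧
      deriv ψ 0 = 1 ∧ (∀ᶠ z in 𝓝 0, s * lam * ψ z + e (ψ z) = ψ (s * lam * z)) ∧
      ∀ n, ‖iteratedDeriv n ψ 0‖ ≤ n.factorial * M / ρ ^ n) :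
    ∃ S : ℂ → ℂ, AnalyticAt ℂ S 0 ∧ S 0 = 0 ∧ deriv S 0 = 1 ∧
      ∀ᶠ z in 𝓝 0, lam * S z + e (S z) = S (lam * z) := by
  set s : ℕ → ℝ := fun k => 1 - 1 / ((k : ℝ) + 2) with hs
  have hs_mem : ∀ k, s k ∈ Ico (1 / 2 : ℝ) 1 := by
    intro k
    have hk : (0 : ℝ) ≤ k := k.cast_nonneg
    have : 1 / ((k : ℝ) + 2) ≤ 1 / 2 := by gcongr; linarith
    have h' : 0 < 1 / ((k : ℝ) + 2) := by positivity
    exact ⟨by simp only [hs]; linarith, by simp only [hs]; linarith⟩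
  have hs_lim : Tendsto s atTop (𝓝 1) := by
    have := (tendsto_const_nhds (x := (1 : ℝ))).sub
      ((tendsto_const_nhds (x := (1 : ℝ))).div_atTop
        (tendsto_natCast_atTop_atTop.atTop_add (tendsto_const_nhds (x := (2 : ℝ)))))
    simpa [hs] using this
  choose ψ hψ hψ0 hψ1 hψe hψb using fun k => H (s k) (hs_mem k)
  set a : ℕ → ℕ → ℂ := fun k n => (n.factorial : ℂ)⁻¹ * iteratedDeriv n (ψ k) 0 with ha
  have ha0 : ∀ k, a k 0 = 0 := fun k => by simp [ha, hψ0]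
  have ha1 : ∀ k, a k 1 = 1 := fun k => by simp [ha, hψ1]
  have hab : ∀ k n, ‖a k n‖ ≤ M / ρ ^ n := by
    intro k n
    have hn : (0 : ℝ) < n.factorial := by exact_mod_cast n.factorial_pos
    rw [ha, norm_mul, norm_inv, Complex.norm_natCast, inv_mul_le_iff₀ hn, ← mul_div_assoc]
    exact hψb k n
  obtain ⟨b, hb, φ, hφ, hlim⟩ := (isCompact_univ_pi fun n : ℕ =>
    isCompact_closedBall (0 : ℂ) (M / ρ ^ n)).tendsto_subseq
      (fun k => show a k ∈ _ from fun n _ => mem_closedBall_zero_iff.mpr (hab k n))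
  have hlim' : ∀ n, Tendsto (fun k => a (φ k) n) atTop (𝓝 (b n)) := tendsto_pi_nhds.mp hlim
  have hbb : ∀ n, ‖b n‖ ≤ M / ρ ^ n := fun n => mem_closedBall_zero_iff.mp (hb n (mem_univ n))
  have hb0 : b 0 = 0 := tendsto_nhds_unique (hlim' 0) (by simp [ha0])
  have hb1 : b 1 = 1 := tendsto_nhds_unique (hlim' 1) (by simp [ha1])
  set S : ℕ → ℂ → ℂ := fun k z => ∑' n, a k n * z ^ n with hS
  set T : ℂ → ℂ := fun z => ∑' n, b n * z ^ n with hT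
  have hρ2 : 0 < ρ / 2 := by positivity
  have hnhds : ball (0 : ℂ) (ρ / 2) ∈ 𝓝 0 := ball_mem_nhds _ hρ2
  have hTd : DifferentiableOn ℂ T (ball 0 (ρ / 2)) := differentiableOn_tsum_mul_pow hρ hbb
  have hSd : ∀ k, DifferentiableOn ℂ (S k) (ball 0 (ρ / 2)) := fun k =>
    differentiableOn_tsum_mul_pow hρ (hab k)
  obtain ⟨hT0, hT1⟩ := hasDerivAt_of_norm_sub_le_sq (f := T) (a := 1) (C := 2 * M / ρ ^ 2) (by
    filter_upwards [hnhds] with z hz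
    rw [one_mul]
    exact norm_tsum_mul_pow_sub_le hρ hbb hb0 hb1 hz)
  obtain ⟨re, hre, here⟩ := Metric.eventually_nhds_iff_ball.mp he.eventually_analyticAt
  have hgrow : ∀ c : ℕ → ℂ, (∀ n, ‖c n‖ ≤ M / ρ ^ n) → c 0 = 0 → c 1 = 1 →
      ∀ z ∈ ball (0 : ℂ) (ρ / 2), ‖∑' n, c n * z ^ n‖ ≤ (1 + M / ρ) * ‖z‖ := by
    intro c hc hc0 hc1 z hz
    have h1 := norm_tsum_mul_pow_sub_le hρ hc hc0 hc1 hz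
    have h2 := norm_le_norm_sub_add (∑' n, c n * z ^ n) z
    have hz' := (mem_ball_zero_iff.mp hz).le
    have h3 : 2 * M / ρ ^ 2 * ‖z‖ ^ 2 ≤ M / ρ * ‖z‖ := by
      calc 2 * M / ρ ^ 2 * ‖z‖ ^ 2 = 2 * M / ρ ^ 2 * ‖z‖ * ‖z‖ := by ring
        _ ≤ 2 * M / ρ ^ 2 * (ρ / 2) * ‖z‖ := by gcongr
        _ = M / ρ * ‖z‖ := by field_simp
    linarith
  set r := min (ρ / 2) (re / (1 + M / ρ)) with hr
  have hr0 : 0 < r := lt_min hρ2 (by positivity)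
  have hsub : ball (0 : ℂ) r ⊆ ball 0 (ρ / 2) := ball_subset_ball (min_le_left _ _)
  have hmap : ∀ c : ℕ → ℂ, (∀ n, ‖c n‖ ≤ M / ρ ^ n) → c 0 = 0 → c 1 = 1 →
      ∀ z ∈ ball (0 : ℂ) r, ∑' n, c n * z ^ n ∈ ball (0 : ℂ) re := by
    intro c hc hc0 hc1 z hz
    rw [mem_ball_zero_iff]
    refine (hgrow c hc hc0 hc1 z (hsub hz)).trans_lt ?_
    have := (mem_ball_zero_iff.mp hz).trans_le (min_le_right _ _)
    rwa [lt_div_iff₀ (by positivity), mul_comm] at this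
  have hsl : ∀ k, ∀ z : ℂ, ‖s k * lam * z‖ ≤ ‖z‖ := by
    intro k z
    rw [norm_mul, norm_mul, hlam, Complex.norm_real, mul_one,
      Real.norm_of_nonneg (by linarith [(hs_mem k).1])]
    exact mul_le_of_le_one_left (norm_nonneg z) (hs_mem k).2.le
  have hsl_mem : ∀ k, ∀ z ∈ ball (0 : ℂ) r, s k * lam * z ∈ ball (0 : ℂ) r := fun k z hz =>
    mem_ball_zero_iff.mpr ((hsl k z).trans_lt (mem_ball_zero_iff.mp hz))
  have hSe : ∀ k, EqOn (fun z => s k * lam * S k z + e (S k z)) (fun z => S k (s k * lam * z))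
      (ball 0 r) := by
    intro k
    have hed : DifferentiableOn ℂ e (ball 0 re) := fun w hw =>
      (here w hw).differentiableAt.differentiableWithinAt
    have hSk := (hSd k).mono hsub
    refine AnalyticOnNhd.eqOn_of_preconnected_of_eventuallyEq (z₀ := 0)
      (DifferentiableOn.analyticOnNhd ?_ isOpen_ball)
      (DifferentiableOn.analyticOnNhd ?_ isOpen_ball)
      (convex_ball _ _).isPreconnected (mem_ball_self hr0) ?_
    · exact (hSk.const_mul _).add (hed.comp hSk (hmap _ (hab k) (ha0 k) (ha1 k)))
    · exact hSk.comp (by fun_prop) (hsl_mem k)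
    · have h1 : S k =ᶠ[𝓝 0] ψ k := eventuallyEq_tsum_iteratedDeriv (hψ k)
      have h2 : Tendsto (fun z : ℂ => s k * lam * z) (𝓝 0) (𝓝 0) :=
        Continuous.tendsto' (by fun_prop) _ _ (by simp)
      filter_upwards [h1, h2.eventually h1, hψe k] with z a1 a2 a3
      rw [a1, a2, a3]
  have hconv : ∀ (u : ℕ → ℂ) (v : ℂ), Tendsto u atTop (𝓝 v) → (∀ k, u k ∈ ball (0 : ℂ) r) →
      Tendsto (fun k => S (φ k) (u k)) atTop (𝓝 (T v)) := by
    intro u v huv hu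
    exact tendsto_tsum_of_dominated_convergence (summable_geometric_two.mul_left M)
      (fun n => (hlim' n).mul (huv.pow n))
      (Eventually.of_forall fun k n => norm_coeff_mul_pow_le hρ (hab _) (hsub (hu k)) n)
  refine ⟨T, hTd.analyticAt hnhds, hT0, hT1.deriv, ?_⟩
  filter_upwards [ball_mem_nhds (0 : ℂ) hr0] with z hz
  have hsφ : Tendsto (fun k => ((s (φ k) : ℝ) : ℂ) * lam) atTop (𝓝 lam) := by
    simpa using ((Complex.continuous_ofReal.tendsto 1).comp
      (hs_lim.comp hφ.tendsto_atTop)).mul_const lam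
  have l1 := hconv _ _ tendsto_const_nhds fun _ => hz
  have l2 := hconv _ _ (hsφ.mul_const z) fun k => hsl_mem (φ k) z hz
  have l3 := (hsφ.mul l1).add
    ((here _ (hmap b hbb hb0 hb1 z hz)).continuousAt.tendsto.comp l1)
  exact tendsto_nhds_unique (l3.congr fun k => hSe (φ k) hz) l2

theorem exists_normalized_linearization {lam : ℂ} (hlam : ‖lam‖ = 1)
    (h : HolLocallyConj (fun z : ℂ => lam * z + z ^ 2) univ (fun z : ℂ => lam * z) univ) :
    ∃ τ : ℂ → ℂ, AnalyticAt ℂ τ 0 ∧ τ 0 = 0 ∧ deriv τ 0 = 1 ∧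
      ∀ᶠ w in 𝓝 0, τ (lam * (w - w ^ 2 / 2)) = lam * τ w := by
  obtain ⟨φ, W₁, W₂, hW₁, hW₂, h1, h2, -, -, hφ, -, ⟨ψ, hψ, hψφ⟩, hφ0, heq⟩ := h
  have hlam0 : lam ≠ 0 := norm_pos_iff.mp (by rw [hlam]; exact one_pos)
  have hφa : AnalyticAt ℂ φ 0 := hφ.analyticAt (hW₁.mem_nhds h1)
  have hψd : HasDerivAt ψ (deriv ψ (φ 0)) (φ 0) := by
    rw [hφ0]
    exact (hψ.differentiableAt (hW₂.mem_nhds h2)).hasDerivAt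
  have hφd : deriv φ 0 ≠ 0 := by
    have a1 := (hψd.comp 0 hφa.differentiableAt.hasDerivAt).deriv
    have a2 : ψ ∘ φ =ᶠ[𝓝 0] id := hψφ.eventuallyEq_of_mem (hW₁.mem_nhds h1)
    rw [a2.deriv_eq, deriv_id] at a1
    exact right_ne_zero_of_mul_eq_one a1.symm
  have hc : -lam / 2 * deriv φ 0 ≠ 0 :=
    mul_ne_zero (div_ne_zero (neg_ne_zero.mpr hlam0) two_ne_zero) hφd
  have hφa' : AnalyticAt ℂ φ (-lam / 2 * 0) := by rwa [mul_zero]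
  have hlin : HasDerivAt (fun w : ℂ => -lam / 2 * w) (-lam / 2) 0 := by
    simpa using (hasDerivAt_id (0 : ℂ)).const_mul (-lam / 2)
  refine ⟨fun w => φ (-lam / 2 * w) / (-lam / 2 * deriv φ 0), ?_, by simp [hφ0], ?_, ?_⟩
  · exact (hφa'.comp (f := fun w : ℂ => -lam / 2 * w) (by fun_prop)).div_const
  · have := (HasDerivAt.comp (h₂ := φ) (0 : ℂ) hφa'.differentiableAt.hasDerivAt hlin).div_const
      (-lam / 2 * deriv φ 0)
    rw [mul_zero, mul_comm (deriv φ 0), div_self hc] at this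
    exact this.deriv
  · have t1 : Tendsto (fun w : ℂ => -lam / 2 * w) (𝓝 0) (𝓝 0) :=
      Continuous.tendsto' (by fun_prop) _ _ (by simp)
    have t2 : Tendsto (fun w : ℂ => lam * (-lam / 2 * w) + (-lam / 2 * w) ^ 2) (𝓝 0) (𝓝 0) :=
      Continuous.tendsto' (by fun_prop) _ _ (by simp)
    filter_upwards [t1 (hW₁.mem_nhds h1), t2 (hW₁.mem_nhds h1)] with w m1 m2
    have := heq _ m1 m2
    have harg : -lam / 2 * (lam * (w - w ^ 2 / 2)) =
        lam * (-lam / 2 * w) + (-lam / 2 * w) ^ 2 := by ring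
    rw [harg, this, mul_div_assoc]

/-- A local inverse linearization gives a holomorphic conjugacy with the rotation. -/
theorem holLocallyConj_of_inverse_linearization {f S : ℂ → ℂ} {U : Set ℂ} {lam : ℂ}
    (hlam : ‖lam‖ = 1) (hU : IsOpen U) (h0 : (0 : ℂ) ∈ U) (hS : AnalyticAt ℂ S 0)
    (hS0 : S 0 = 0) (hS1 : deriv S 0 = 1) (hfS : ∀ᶠ z in 𝓝 0, f (S z) = S (lam * z)) :
    HolLocallyConj f U (fun z => lam * z) univ := by
  obtain ⟨h, -, hh0, -, r, hr, hinj, hSd, hhd, hh⟩ := exists_local_inverse hS hS0 hS1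
  have hr2 : 0 < r / 2 := by positivity
  have hSU : ∀ᶠ z in 𝓝 0, S z ∈ ball (0 : ℂ) (r / 2) ∩ U := by
    refine hS.continuousAt (IsOpen.mem_nhds (isOpen_ball.inter hU) ?_)
    rw [hS0]
    exact ⟨mem_ball_self hr2, h0⟩
  obtain ⟨ε, hε, hεS⟩ := Metric.eventually_nhds_iff_ball.mp
    ((hSU.and hfS).and (ball_mem_nhds (0 : ℂ) hr))
  have hhS : ∀ z ∈ ball (0 : ℂ) ε, h (S z) = z := fun z hz =>
    hinj (hh _ (hεS z hz).1.1.1).1 (hεS z hz).2 (hh _ (hεS z hz).1.1.1).2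
  set W := ball (0 : ℂ) (r / 2) ∩ h ⁻¹' ball 0 ε with hW
  have hSh : ∀ w ∈ W, S (h w) = w := fun w hw => (hh w hw.1).2
  have hSW : ∀ z ∈ ball (0 : ℂ) ε, S z ∈ W := fun z hz =>
    ⟨(hεS z hz).1.1.1, by rw [mem_preimage, hhS z hz]; exact hz⟩
  have hrot : ∀ z ∈ ball (0 : ℂ) ε, lam * z ∈ ball (0 : ℂ) ε := fun z hz => by
    simpa [hlam] using hz
  refine ⟨h, W, ball 0 ε, hhd.continuousOn.isOpen_inter_preimage isOpen_ball isOpen_ball,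
    isOpen_ball, ⟨mem_ball_self hr2, by simp [hh0, hε]⟩, mem_ball_self hε, fun w hw => ?_,
    subset_univ _, hhd.mono inter_subset_left, ⟨fun w hw => hw.2, fun w hw w' hw' heq => ?_,
      fun z hz => ⟨S z, hSW z hz, hhS z hz⟩⟩, ⟨S, fun z hz => ?_, hSh⟩, hh0, fun w hw _ => ?_⟩
  · have := (hεS _ hw.2).1.1.2
    rwa [hSh w hw] at this
  · rw [← hSh w hw, heq, hSh w' hw']
  · exact (hSd.differentiableAt (isOpen_ball.mem_nhds (hεS z hz).2)).differentiableWithinAt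
  · have := (hεS _ hw.2).1.2
    rw [hSh w hw] at this
    rw [this, hhS _ (hrot _ hw.2)]

end QuadraticSiegel

/-- **Yoccoz's theorem.** If `λ ∈ S¹` is such that the origin is a Siegel point for the
quadratic polynomial `f_λ(z) = λ z + z²`, then the origin is a Siegel point for every
holomorphic local dynamical system at `0 ∈ ℂ` with multiplier `λ`. -/
theorem yoccoz_quadratic_implies_all
    (lam : ℂ) (hmod : ‖lam‖ = 1)
    (hquad : HolLocallyConj (fun z : ℂ => lam * z + z ^ 2) Set.univ
      (fun z : ℂ => lam * z) Set.univ) :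
    ∀ (f : ℂ → ℂ) (U : Set ℂ), IsOpen U → (0 : ℂ) ∈ U → DifferentiableOn ℂ f U →
      f 0 = 0 → (∃ z ∈ U, f z ≠ z) → deriv f 0 = lam →
      HolLocallyConj f U (fun z => lam * z) Set.univ := by
  intro f U hU h0 hf hf0 _ hf1
  have hfa : AnalyticAt ℂ f 0 := hf.analyticAt (hU.mem_nhds h0)
  obtain ⟨τ, hτ, hτ0, hτ1, hτP⟩ := QuadraticSiegel.exists_normalized_linearization hmod hquad
  obtain ⟨δ, hδ, hδq⟩ := QuadraticSiegel.exists_isInvLin_smul_of_linearizable hmod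
    (P := fun w => lam * (w - w ^ 2 / 2)) (by fun_prop) (by simp) hτ hτ0 hτ1 hτP
    (R := 40) (by norm_num)
  have he1 : deriv (fun w => f w - lam * w) 0 = 0 := by
    have := (hfa.differentiableAt.hasDerivAt.fun_sub
      ((hasDerivAt_id (0 : ℂ)).const_mul lam)).deriv
    simpa [hf1] using this
  have he : AnalyticAt ℂ (fun w => f w - lam * w) 0 := by fun_prop
  obtain ⟨M, hM, ρ, hρ, hb⟩ := QuadraticSiegel.exists_uniform_taylor_bound hmod hδ
    (by simpa only [mul_assoc] using hδq) he (by simp [hf0]) he1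
  obtain ⟨S, hS, hS0, hS1, hSe⟩ :=
    QuadraticSiegel.exists_inverse_linearization_of_uniform_bound hmod he hM hρ hb
  exact QuadraticSiegel.holLocallyConj_of_inverse_linearization hmod hU h0 hS hS0 hS1
    (hSe.mono fun z hz => by simpa using hz)
end

section
/- Let f be a holomorphic local dynamical system at O ∈ ℂⁿ (n ≥ 2) tangent to the identity, with homogeneous expansion f(z) = z + P_ν(z) + P_{ν+1}(z) + ⋯ where P_ν ≢ 0 is the first non-zero term (ν ≥ 2). If there is an orbit {f^k(z₀)} of f converging to the origin tangentially to a direction [v] ∈ ℙ^{n−1}(ℂ) — that is, f^k(z₀) → O in ℂⁿ with f^k(z₀) ≠ O for all k, and [f^k(z₀)] → [v] in ℙ^{n−1}(ℂ) — then v is a characteristic direction of f, i.e. P_ν(v) = λv for some λ ∈ ℂ. -/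
open Set Filter Topology

/-- The quotient topology on the complex projective space `ℙ^{n-1}(ℂ)`. -/
noncomputable instance (n : ℕ) : TopologicalSpace (Projectivization ℂ (Fin n → ℂ)) :=
  inferInstanceAs (TopologicalSpace (Quotient _))

/-- If `x → 0` with steps comparable to at most `x ^ ν`, `ν ≥ 2`, then a sequence whose steps are
equivalent to `x ^ ν` cannot be negligible with respect to `x`. -/
theorem not_tendsto_div_zero_of_step_tendsto_one {ν : ℕ} (hν : 2 ≤ ν) {x y : ℕ → ℂ} {a : ℂ}
    (hx0 : ∀ᶠ k in atTop, x k ≠ 0) (hx : Tendsto x atTop (𝓝 0))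
    (hstep : Tendsto (fun k => (x (k + 1) - x k) / x k ^ ν) atTop (𝓝 a))
    (hystep : Tendsto (fun k => (y (k + 1) - y k) / x k ^ ν) atTop (𝓝 1)) :
    ¬ Tendsto (fun k => y k / x k) atTop (𝓝 0) := by
  intro hyx
  obtain ⟨ρ, hρ, hρ1, hpow⟩ : ∃ ρ : ℝ, 0 < ρ ∧ ρ ≤ 1 ∧
      ∀ t : ℂ, ‖t - 1‖ ≤ ρ → ‖t ^ ν - 1‖ ≤ 1 / 4 := by
    have hc : Tendsto (fun t : ℂ => t ^ ν) (𝓝 1) (𝓝 1) := by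
      simpa using (continuous_pow (M := ℂ) ν).tendsto 1
    obtain ⟨r, hr, h⟩ := Metric.tendsto_nhds_nhds.1 hc (1 / 4) (by norm_num)
    refine ⟨min (r / 2) 1, by positivity, min_le_right _ _, fun t ht => ?_⟩
    have h1 : dist t 1 < r := by
      rw [dist_eq_norm]
      linarith [min_le_left (r / 2) 1]
    simpa [dist_eq_norm] using (h h1).le
  set C : ℝ := ‖a‖ + 1 with hCdef
  have hC : 0 < C := by positivity
  set κ : ℝ := ρ / (100 * C) with hκ
  have hκ0 : 0 < κ := by positivity
  have e1 : ∀ᶠ k in atTop, ‖(x (k + 1) - x k) / x k ^ ν‖ < C :=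
    hstep.norm.eventually_lt_const (by linarith)
  have e2 : ∀ᶠ k in atTop, ‖(y (k + 1) - y k) / x k ^ ν - 1‖ < 1 / 4 := by
    have := (hystep.sub_const 1).norm
    rw [sub_self, norm_zero] at this
    exact this.eventually_lt_const (by norm_num)
  have e3 : ∀ᶠ k in atTop, ‖y k / x k‖ < κ := by
    have := hyx.norm
    rw [norm_zero] at this
    exact this.eventually_lt_const hκ0
  have e4 : ∀ᶠ k in atTop, ‖x k‖ ^ (ν - 1) < ρ / (4 * C) := by
    have := hx.norm.pow (ν - 1)
    rw [norm_zero, zero_pow (by omega)] at this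
    exact this.eventually_lt_const (by positivity)
  obtain ⟨N, hN⟩ := eventually_atTop.1 (hx0.and (e1.and (e2.and (e3.and e4))))
  have hxne (k : ℕ) (hk : N ≤ k) : x k ≠ 0 := (hN k hk).1
  have hxs (k : ℕ) (hk : N ≤ k) : ‖x (k + 1) - x k‖ ≤ C * ‖x k‖ ^ ν := by
    have h := (hN k hk).2.1.le
    rwa [norm_div, norm_pow, div_le_iff₀ (pow_pos (norm_pos_iff.2 (hxne k hk)) _)] at h
  have hys (k : ℕ) (hk : N ≤ k) : ‖y (k + 1) - y k - x k ^ ν‖ ≤ 1 / 4 * ‖x k‖ ^ ν := by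
    have h := (hN k hk).2.2.1.le
    have h0 := pow_ne_zero ν (hxne k hk)
    rwa [div_sub_one h0, norm_div, norm_pow,
      div_le_iff₀ (pow_pos (norm_pos_iff.2 (hxne k hk)) _)] at h
  have hyb (k : ℕ) (hk : N ≤ k) : ‖y k‖ ≤ κ * ‖x k‖ := by
    have h := (hN k hk).2.2.2.1.le
    rwa [norm_div, div_le_iff₀ (norm_pos_iff.2 (hxne k hk))] at h
  have hsmall := (hN N le_rfl).2.2.2.2
  have hX := hxne N le_rfl
  set X := x N with hXdef
  have hε : 0 < ‖X‖ := norm_pos_iff.2 hX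
  set q : ℝ := ‖X‖ ^ (ν - 1) with hq
  have hq0 : 0 < q := pow_pos hε _
  have hqν : ‖X‖ ^ ν = q * ‖X‖ := by
    rw [hq, ← pow_succ]
    congr 1
    omega
  set m : ℕ := ⌊ρ / (2 * C * q)⌋₊ with hm
  have hm1 : (m : ℝ) * (2 * C * q) ≤ ρ := by
    rw [← le_div_iff₀ (by positivity)]
    exact Nat.floor_le (by positivity)
  have hm2 : ρ < ((m : ℝ) + 1) * (2 * C * q) := by
    rw [← div_lt_iff₀ (by positivity)]
    exact Nat.lt_floor_add_one _
  have near_pow {w : ℂ} (hw : ‖w - X‖ ≤ ρ * ‖X‖) :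
      ‖w ^ ν - X ^ ν‖ ≤ 1 / 4 * ‖X‖ ^ ν ∧ ‖w‖ ^ ν ≤ 5 / 4 * ‖X‖ ^ ν := by
    have h1 : ‖w / X - 1‖ ≤ ρ := by
      rwa [div_sub_one hX, norm_div, div_le_iff₀ hε]
    have h2 := hpow _ h1
    rw [div_pow, div_sub_one (pow_ne_zero ν hX), norm_div, norm_pow, div_le_iff₀ (by positivity)]
      at h2
    refine ⟨h2, ?_⟩
    have h3 := norm_add_le (w ^ ν - X ^ ν) (X ^ ν)
    rw [sub_add_cancel, norm_pow, norm_pow] at h3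
    linarith
  have key : ∀ j ≤ m, ‖x (N + j) - X‖ ≤ j * (2 * C * q) * ‖X‖ ∧
      ‖y (N + j) - y N - j * X ^ ν‖ ≤ j * (3 / 4 * ‖X‖ ^ ν) := by
    intro j
    induction j with
    | zero => simp [hXdef]
    | succ j ih =>
      intro hj
      obtain ⟨i1, i2⟩ := ih (by omega)
      have hjm : (j : ℝ) ≤ m := by exact_mod_cast (by omega : j ≤ m)
      have hclose : ‖x (N + j) - X‖ ≤ ρ * ‖X‖ := by
        refine i1.trans (mul_le_mul_of_nonneg_right ?_ hε.le)
        exact (mul_le_mul_of_nonneg_right hjm (by positivity)).trans hm1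
      obtain ⟨p1, p2⟩ := near_pow hclose
      have s1 := hxs (N + j) (by omega)
      have s2 := hys (N + j) (by omega)
      have hν0 : 0 < ‖X‖ ^ ν := by positivity
      rw [← add_assoc]
      push_cast
      constructor
      · have h3 := norm_add_le (x (N + j + 1) - x (N + j)) (x (N + j) - X)
        rw [sub_add_sub_cancel] at h3
        have h4 : C * ‖x (N + j)‖ ^ ν ≤ C * (5 / 4 * ‖X‖ ^ ν) :=
          mul_le_mul_of_nonneg_left p2 hC.le
        have h5 : 0 < C * ‖X‖ ^ ν := by positivity
        have h6 : C * ‖X‖ ^ ν = C * q * ‖X‖ := by rw [hqν]; ring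
        linarith
      · have h3 := norm_add₃_le (a := y (N + j + 1) - y (N + j) - x (N + j) ^ ν)
          (b := x (N + j) ^ ν - X ^ ν) (c := y (N + j) - y N - j * X ^ ν)
        have h4 : y (N + j + 1) - y (N + j) - x (N + j) ^ ν + (x (N + j) ^ ν - X ^ ν) +
            (y (N + j) - y N - j * X ^ ν) = y (N + j + 1) - y N - (j + 1) * X ^ ν := by ring
        rw [h4] at h3
        linarith
  obtain ⟨k1, k2⟩ := key m le_rfl
  have b0 := hyb N le_rfl
  have b1 := hyb (N + m) (by omega)
  have hxm : ‖x (N + m)‖ ≤ 2 * ‖X‖ := by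
    have h1 := norm_add_le (x (N + m) - X) X
    rw [sub_add_cancel] at h1
    have h2 := mul_le_mul_of_nonneg_right (hm1.trans hρ1) hε.le
    linarith
  have b2 : ‖(m : ℂ) * X ^ ν‖ ≤ m * (3 / 4 * ‖X‖ ^ ν) + 3 * κ * ‖X‖ := by
    have h1 := norm_sub_le (y (N + m) - y N) (y (N + m) - y N - m * X ^ ν)
    rw [sub_sub_cancel] at h1
    have h2 := norm_sub_le (y (N + m)) (y N)
    have h3 := mul_le_mul_of_nonneg_left hxm hκ0.le
    linarith
  rw [norm_mul, norm_pow, Complex.norm_natCast, hqν] at b2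
  have b3 : m * q ≤ 12 * κ := by
    refine le_of_mul_le_mul_right ?_ hε
    linarith
  have c1 : κ * C = ρ / 100 := by rw [hκ]; field_simp
  have c2 : q * C < ρ / 4 := by
    rw [lt_div_iff₀ (by positivity)] at hsmall
    linarith
  have b4 := mul_le_mul_of_nonneg_right b3 hC.le
  linarith

/-- Convergence in projective space to `[v]` implies convergence in the affine chart at a non-zero
coordinate of `v`. -/
theorem tendsto_affine_chart_of_tendsto_projectivization {n : ℕ} {ι : Type*} {l : Filter ι}
    {z : ι → Fin n → ℂ} (hz : ∀ k, z k ≠ 0) {v : Fin n → ℂ} (hv : v ≠ 0) {j : Fin n}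
    (hvj : v j ≠ 0)
    (h : Tendsto (fun k => Projectivization.mk ℂ (z k) (hz k)) l
      (𝓝 (Projectivization.mk ℂ v hv))) :
    (∀ᶠ k in l, z k j ≠ 0) ∧
      Tendsto (fun k => (z k j)⁻¹ • z k) l (𝓝 ((v j)⁻¹ • v)) := by
  have main (s : Set (Fin n → ℂ)) (hs : IsOpen s) (hvs : (v j)⁻¹ • v ∈ s) :
      ∀ᶠ k in l, z k j ≠ 0 ∧ (z k j)⁻¹ • z k ∈ s := by
    set T : Set (Projectivization ℂ (Fin n → ℂ)) :=
      {p | p.rep j ≠ 0 ∧ (p.rep j)⁻¹ • p.rep ∈ s} with hT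
    have mem_T (w : Fin n → ℂ) (hw : w ≠ 0) :
        Projectivization.mk ℂ w hw ∈ T ↔ w j ≠ 0 ∧ (w j)⁻¹ • w ∈ s := by
      obtain ⟨c, hc⟩ := Projectivization.exists_smul_eq_mk_rep ℂ w hw
      have hc0 : (c : ℂ) ≠ 0 := c.ne_zero
      rw [hT, Set.mem_ofPred_eq, ← hc]
      have e : ((c • w) j)⁻¹ • (c • w) = (w j)⁻¹ • w := by
        ext i
        simp only [Units.smul_def, Pi.smul_apply, smul_eq_mul]
        field_simp
      rw [e]
      simp [Units.smul_def, hc0]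
    have hTo : IsOpen T := by
      refine isOpen_coinduced.2 ?_
      have e : Quotient.mk _ ⁻¹' T =
          {w : {w : Fin n → ℂ // w ≠ 0} | w.1 j ≠ 0 ∧ (w.1 j)⁻¹ • w.1 ∈ s} := by
        ext w
        exact mem_T w.1 w.2
      refine (congrArg IsOpen e).mpr ?_
      rw [isOpen_iff_mem_nhds]
      rintro w ⟨hw1, hw2⟩
      have hcj : ContinuousAt (fun w : {w : Fin n → ℂ // w ≠ 0} => w.1 j) w :=
        ((continuous_apply j).comp continuous_subtype_val).continuousAt
      have hc : ContinuousAt (fun w : {w : Fin n → ℂ // w ≠ 0} => (w.1 j)⁻¹ • w.1) w :=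
        (hcj.inv₀ hw1).smul continuous_subtype_val.continuousAt
      exact (hcj.eventually_ne hw1).and (hc.eventually_mem (hs.mem_nhds hw2))
    filter_upwards [h.eventually_mem (hTo.mem_nhds ((mem_T v hv).2 ⟨hvj, hvs⟩))] with k hk
    exact (mem_T _ _).1 hk
  refine ⟨(main Set.univ isOpen_univ trivial).mono fun k hk => hk.1, ?_⟩
  exact tendsto_nhds.2 fun s hs hvs => (main s hs hvs).mono fun k hk => hk.2

/-- Evaluation of a homogeneous polynomial of degree `m` is homogeneous of degree `m`. -/
theorem eval_smul_of_isHomogeneous {σ R : Type*} [CommSemiring R] {m : ℕ}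
    {p : MvPolynomial σ R} (hp : p.IsHomogeneous m) (c : R) (w : σ → R) :
    MvPolynomial.eval (c • w) p = c ^ m * MvPolynomial.eval w p := by
  rw [MvPolynomial.eval_eq, MvPolynomial.eval_eq, Finset.mul_sum]
  refine Finset.sum_congr rfl fun d hd => ?_
  have hdeg : ∑ i ∈ d.support, d i = m := by
    rw [← hp (MvPolynomial.mem_support_iff.1 hd), Finsupp.weight_apply]
    simp [Finsupp.sum]
  simp only [Pi.smul_apply, smul_eq_mul, mul_pow, Finset.prod_mul_distrib,
    Finset.prod_pow_eq_pow_sum, hdeg]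
  ring

/-- If an orbit of a holomorphic local dynamical system `f` at `O ∈ ℂⁿ` tangent to the identity
(with first non-zero homogeneous term `P_ν`, given by the `n`-tuple `Q` of homogeneous
polynomials of degree `ν`) converges to the origin tangentially to a direction `[v]`, then `v`
is a characteristic direction of `f`, i.e. `P_ν(v) = λ v` for some `λ ∈ ℂ`. -/
theorem characteristic_direction_of_tangential_orbit
    {n : ℕ} (hn : 1 ≤ n)
    (f : (Fin n → ℂ) → Fin n → ℂ) (U : Set (Fin n → ℂ))
    (hU : IsOpen U) (h0 : (0 : Fin n → ℂ) ∈ U)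
    (hf : DifferentiableOn ℂ f U) (hf0 : f 0 = 0) (hfne : ∃ z ∈ U, f z ≠ z)
    (ν : ℕ) (hν : 2 ≤ ν)
    (Q : Fin n → MvPolynomial (Fin n) ℂ)
    (hQhom : ∀ i, (Q i).IsHomogeneous ν) (hQne : ∃ i, Q i ≠ 0)
    -- homogeneous expansion: f(z) = z + P_ν(z) + O(‖z‖^{ν+1}), with P_ν given by Q
    (hexp : (fun z => f z - z - fun i => MvPolynomial.eval z (Q i))
      =O[𝓝 0] fun z : Fin n → ℂ => ‖z‖ ^ (ν + 1))
    (v : Fin n → ℂ) (hv : v ≠ 0)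
    (z₀ : Fin n → ℂ)
    (horb : ∀ k : ℕ, f^[k] z₀ ∈ U)
    (hne : ∀ k : ℕ, f^[k] z₀ ≠ 0)
    (hlim : Tendsto (fun k => f^[k] z₀) atTop (𝓝 0))
    (hdir : Tendsto (fun k => Projectivization.mk ℂ (f^[k] z₀) (hne k)) atTop
      (𝓝 (Projectivization.mk ℂ v hv))) :
    ∃ lam : ℂ, (fun i => MvPolynomial.eval v (Q i)) = lam • v := by
  set P : (Fin n → ℂ) → Fin n → ℂ := fun z i => MvPolynomial.eval z (Q i) with hP
  have hPc : Continuous P := continuous_pi fun i => MvPolynomial.continuous_eval (Q i)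
  have hPhom (c : ℂ) (w : Fin n → ℂ) : P (c • w) = c ^ ν • P w := by
    ext i
    exact eval_smul_of_isHomogeneous (hQhom i) c w
  obtain ⟨j, hvj⟩ := Function.ne_iff.1 hv
  rw [Pi.zero_apply] at hvj
  set z : ℕ → Fin n → ℂ := fun k => f^[k] z₀ with hz
  have hzs (k : ℕ) : z (k + 1) = f (z k) := Function.iterate_succ_apply' f k z₀
  obtain ⟨hzj, hchart⟩ := tendsto_affine_chart_of_tendsto_projectivization hne hv hvj hdir
  set x : ℕ → ℂ := fun k => z k j / v j with hxdef
  have hx0 : ∀ᶠ k in atTop, x k ≠ 0 := hzj.mono fun k hk => div_ne_zero hk hvj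
  have hx : Tendsto x atTop (𝓝 0) := by
    simpa using (tendsto_pi_nhds.1 hlim j).div_const (v j)
  have hu : Tendsto (fun k => (x k)⁻¹ • z k) atTop (𝓝 v) := by
    have h := hchart.const_smul (v j)
    rw [smul_inv_smul₀ hvj] at h
    refine h.congr fun k => ?_
    rw [smul_smul, hxdef, inv_div, div_eq_mul_inv]
  have hR : Tendsto (fun k => (x k ^ ν)⁻¹ • (z (k + 1) - z k - P (z k))) atTop (𝓝 0) := by
    obtain ⟨C, hC⟩ := (hexp.comp_tendsto hlim).bound
    have hb : Tendsto (fun k => C * (‖(x k)⁻¹ • z k‖ ^ ν * ‖z k‖)) atTop (𝓝 0) := by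
      simpa using ((hu.norm.pow ν).mul hlim.norm).const_mul C
    refine squeeze_zero_norm' ?_ hb
    filter_upwards [hC, hx0] with k hk hxk
    simp only [Function.comp_apply, norm_pow, norm_norm] at hk
    rw [norm_smul, norm_inv, norm_pow, hzs]
    calc (‖x k‖ ^ ν)⁻¹ * ‖f (z k) - z k - P (z k)‖
        ≤ (‖x k‖ ^ ν)⁻¹ * (C * ‖z k‖ ^ (ν + 1)) := by gcongr
      _ = C * (‖(x k)⁻¹ • z k‖ ^ ν * ‖z k‖) := by
        rw [norm_smul, norm_inv, mul_pow, inv_pow]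
        ring
  have hD : Tendsto (fun k => (x k ^ ν)⁻¹ • (z (k + 1) - z k)) atTop (𝓝 (P v)) := by
    have h := hR.add ((hPc.tendsto v).comp hu)
    rw [zero_add] at h
    refine h.congr fun k => ?_
    rw [Function.comp_apply, hPhom, inv_pow, ← smul_add, sub_add_cancel]
  have hDi (i : Fin n) := tendsto_pi_nhds.1 hD i
  have hui (i : Fin n) := tendsto_pi_nhds.1 hu i
  refine ⟨P v j / v j, ?_⟩
  by_contra hcon
  obtain ⟨i, hi⟩ := Function.ne_iff.1 hcon
  set c : ℂ := P v i - P v j / v j * v i with hc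
  have hc0 : c ≠ 0 := sub_ne_zero.2 hi
  refine not_tendsto_div_zero_of_step_tendsto_one (x := x) (a := P v j / v j)
    (y := fun k => (z k i - v i / v j * z k j) / c) hν hx0 hx ?_ ?_ ?_
  · refine ((hDi j).div_const (v j)).congr fun k => ?_
    simp only [hxdef, Pi.smul_apply, Pi.sub_apply, smul_eq_mul]
    ring
  · have h := ((hDi i).sub ((hDi j).const_mul (v i / v j))).div_const c
    have e : (P v i - v i / v j * P v j) / c = 1 := by
      rw [div_eq_one_iff_eq hc0, hc]
      ring
    rw [e] at h
    refine h.congr fun k => ?_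
    simp only [Pi.smul_apply, Pi.sub_apply, smul_eq_mul]
    ring
  · have h := ((hui i).sub ((hui j).const_mul (v i / v j))).div_const c
    rw [div_mul_cancel₀ _ hvj, sub_self, zero_div] at h
    refine h.congr fun k => ?_
    simp only [Pi.smul_apply, smul_eq_mul]
    ring
end
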